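/- Fix parameters α ≥ 0 and β > 0, and let N : (0,∞) → ℕ be the counting function of the eigenvalues of the problem (α,β), i.e. N(λ) is the number of eigenvalues not exceeding λ. Set ν := ln κ − 3·ln a and D := (ln κ)/ν. Then there exist a function s : ℝ → ℝ which is ν-periodic (s(t+ν) = s(t) for all t ∈ ℝ) and a nondecreasing function σ : [0,ν] → ℝ whose derivative equals 0 Lebesgue-almost everywhere on [0,ν] (a purely singular function), such that s(t) = e^{−D·t}·σ(t) for all t ∈ [0,ν], and N(λ)·λ^{−D} − s(ln λ) → 0 as λ → +∞. -/

import Mathlib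

open Set Filter

/-- First derivative on `[0,1]` (one-sided at the endpoints). -/
noncomputable def Y1 (y : ℝ → ℝ) : ℝ → ℝ := derivWithin y (Set.Icc 0 1)
/-- Second derivative on `[0,1]`. -/
noncomputable def Y2 (y : ℝ → ℝ) : ℝ → ℝ := iteratedDerivWithin 2 y (Set.Icc 0 1)
/-- Third derivative on `[0,1]`. -/
noncomputable def Y3 (y : ℝ → ℝ) : ℝ → ℝ := iteratedDerivWithin 3 y (Set.Icc 0 1)

/-- `y` is a solution on `[0,1]` of `[y''' - λ P y]' + λ P y' = 0`:
`y ∈ C³[0,1]` and `y''' - λ P y` is (continuously) differentiable on `[0,1]`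
with derivative `-λ P y'`. -/
def SolutionOn (P : ℝ → ℝ) (lam : ℝ) (y : ℝ → ℝ) : Prop :=
  ContDiffOn ℝ 3 y (Set.Icc 0 1) ∧
  ∀ x ∈ Set.Icc (0:ℝ) 1,
    HasDerivWithinAt (fun t => Y3 y t - lam * P t * y t)
      (-(lam * P x * Y1 y x)) (Set.Icc 0 1) x

/-- `y` is not identically zero on `[0,1]`. -/
def Nontrivial01 (y : ℝ → ℝ) : Prop := ∃ x ∈ Set.Icc (0:ℝ) 1, y x ≠ 0

/-- The boundary conditions of the problem `(α, β)`. -/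
def BC (α β : ℝ) (y : ℝ → ℝ) : Prop :=
  Y2 y 0 + α * y 0 - β * Y1 y 0 = 0 ∧
  -β * Y3 y 0 + α * Y2 y 0 = 0 ∧
  Y2 y 1 + α * y 1 + β * Y1 y 1 = 0 ∧
  -β * Y3 y 1 - α * Y2 y 1 = 0

/-- `y` is an eigenfunction of the problem `(α, β)` with eigenvalue `lam`. -/
def Eigenfunction (P : ℝ → ℝ) (α β lam : ℝ) (y : ℝ → ℝ) : Prop :=
  Nontrivial01 y ∧ SolutionOn P lam y ∧ BC α β y

/-- `lam` is an eigenvalue of the problem `(α, β)`. -/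
def IsEigenvalue (P : ℝ → ℝ) (α β lam : ℝ) : Prop :=
  ∃ y : ℝ → ℝ, Eigenfunction P α β lam y

/-- The number `b = (1 - κ a)/(κ - 1)`. -/
noncomputable def bb (κ : ℕ) (a : ℝ) : ℝ := (1 - κ * a) / (κ - 1)

/-- `P` is a nondecreasing continuous function on `[0,1]` with `P 0 = 0`, `P 1 = 1`,
self-similar of Cantor type with parameters `κ ≥ 2` and `0 < a < 1/κ`. -/
def CantorSelfSimilar (P : ℝ → ℝ) (κ : ℕ) (a : ℝ) : Prop :=
  ContinuousOn P (Set.Icc 0 1) ∧ MonotoneOn P (Set.Icc 0 1) ∧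
  P 0 = 0 ∧ P 1 = 1 ∧ 2 ≤ κ ∧ 0 < a ∧ a < 1 / κ ∧
  (∀ k : ℕ, k < κ → ∃ c : ℝ, ∀ x ∈ Set.Icc (0:ℝ) 1,
      (κ : ℝ) * P (k * (a + bb κ a) + a * x) = P x + c) ∧
  (∀ k : ℕ, 1 ≤ k → k < κ →
      ∀ x ∈ Set.Ioo ((k:ℝ) * (a + bb κ a) - bb κ a) ((k:ℝ) * (a + bb κ a)),
      ∀ x' ∈ Set.Ioo ((k:ℝ) * (a + bb κ a) - bb κ a) ((k:ℝ) * (a + bb κ a)),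
      P x = P x')

/-- `q` is negative away from zero on an `n`-dimensional space of vectors. -/
def NegDim {V : Type*} [AddCommGroup V] [Module ℝ V] (q : V → ℝ) (n : ℕ) : Prop :=
  ∃ φ : (Fin n → ℝ) →ₗ[ℝ] V, ∀ c, c ≠ 0 → q (φ c) < 0

/-- `q` is nonnegative on the common kernel of `n` linear functionals. -/
def PosCodim {V : Type*} [AddCommGroup V] [Module ℝ V] (q : V → ℝ) (n : ℕ) : Prop :=
  ∃ l : V →ₗ[ℝ] (Fin n → ℝ), ∀ v, l v = 0 → 0 ≤ q v

section Index

variable {V V' : Type*} [AddCommGroup V] [Module ℝ V] [AddCommGroup V'] [Module ℝ V']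

theorem NegDim.of_finrank {E : Type*} [AddCommGroup E] [Module ℝ E] [FiniteDimensional ℝ E]
    {q : V → ℝ} {n : ℕ} (hn : Module.finrank ℝ E = n) (φ : E →ₗ[ℝ] V)
    (h : ∀ c, c ≠ 0 → q (φ c) < 0) : NegDim q n := by
  let e : (Fin n → ℝ) ≃ₗ[ℝ] E := LinearEquiv.ofFinrankEq _ _ (by simp [hn])
  exact ⟨φ ∘ₗ e.toLinearMap, fun c hc => h _ (by simpa using hc)⟩

theorem PosCodim.of_finrank {E : Type*} [AddCommGroup E] [Module ℝ E] [FiniteDimensional ℝ E]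
    {q : V → ℝ} {n : ℕ} (hn : Module.finrank ℝ E = n) (l : V →ₗ[ℝ] E)
    (h : ∀ v, l v = 0 → 0 ≤ q v) : PosCodim q n := by
  let e : E ≃ₗ[ℝ] (Fin n → ℝ) := LinearEquiv.ofFinrankEq _ _ (by simp [hn])
  exact ⟨e.toLinearMap ∘ₗ l, fun v hv => h _ (by simpa using hv)⟩

theorem NegDim.map {q : V → ℝ} {q' : V' → ℝ} {n : ℕ} (h : NegDim q n) (f : V →ₗ[ℝ] V')
    (hf : ∀ v, q v < 0 → q' (f v) < 0) : NegDim q' n := by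
  obtain ⟨φ, hφ⟩ := h
  exact ⟨f ∘ₗ φ, fun c hc => hf _ (hφ c hc)⟩

theorem NegDim.le {q : V → ℝ} {n m : ℕ} (h : NegDim q n) (h' : PosCodim q m) : n ≤ m := by
  obtain ⟨φ, hφ⟩ := h
  obtain ⟨l, hl⟩ := h'
  have hinj : Function.Injective (l ∘ₗ φ) := by
    rw [← LinearMap.ker_eq_bot, LinearMap.ker_eq_bot']
    intro c hc
    by_contra hne
    exact absurd (hφ c hne) (not_lt.mpr (hl _ hc))
  simpa using LinearMap.finrank_le_finrank_of_injective hinj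

theorem exists_negDim_posCodim (B : LinearMap.BilinForm ℝ V) (hB : ∀ v w, B v w = B w v) {m : ℕ}
    (h : PosCodim (fun v => B v v) m) :
    ∃ n, NegDim (fun v => B v v) n ∧ PosCodim (fun v => B v v) n := by
  classical
  have h0 : NegDim (fun v => B v v) 0 := ⟨0, fun c hc => absurd (Subsingleton.elim c 0) hc⟩
  set n := Nat.findGreatest (NegDim (fun v => B v v)) m with hn
  have hneg : NegDim (fun v => B v v) n := Nat.findGreatest_spec (Nat.zero_le m) h0
  refine ⟨n, hneg, ?_⟩
  obtain ⟨φ, hφ⟩ := hneg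
  refine ⟨(LinearMap.pi fun i => B.flip (φ (Pi.single i 1))), fun v hv => ?_⟩
  by_contra! hneg
  have horth : ∀ c, B v (φ c) = 0 := by
    intro c
    have : B v ∘ₗ φ = 0 := by
      refine LinearMap.pi_ext' fun i => LinearMap.ext_ring ?_
      simpa using congrFun hv i
    simpa using LinearMap.congr_fun this c
  have hbig : NegDim (fun v => B v v) (n + 1) := by
    refine NegDim.of_finrank (E := (Fin n → ℝ) × ℝ) (by simp)
      (φ.coprod (LinearMap.toSpanSingleton ℝ V v)) fun c hc => ?_
    obtain ⟨c, t⟩ := c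
    have hval : B (φ c + t • v) (φ c + t • v) = B (φ c) (φ c) + t ^ 2 * B v v := by
      simp only [map_add, LinearMap.add_apply, map_smul, LinearMap.smul_apply, smul_eq_mul,
        hB (φ c) v, horth]
      ring
    simp only [LinearMap.coprod_apply, LinearMap.toSpanSingleton_apply]
    rw [hval]
    by_cases hc0 : c = 0
    · have ht : t ≠ 0 := by rintro rfl; exact hc (by simp [hc0])
      have : 0 < t ^ 2 := by positivity
      simp only [hc0, map_zero]
      nlinarith
    · have h1 := hφ c hc0
      have h2 : t ^ 2 * B v v ≤ 0 := mul_nonpos_of_nonneg_of_nonpos (sq_nonneg t) hneg.le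
      simp only at h1
      linarith
  have := Nat.le_findGreatest (hbig.le h) hbig
  omega

end Index

section Spectral

open Module.End

open scoped InnerProductSpace

theorem IsCompactOperator.inner_le_of_orthogonal_eigenvectors {H : Type*} [NormedAddCommGroup H]
    [InnerProductSpace ℝ H] [CompleteSpace H] {K : H →L[ℝ] H} (hc : IsCompactOperator K)
    (hs : K.IsSymmetric) (hnn : ∀ x, 0 ≤ ⟪K x, x⟫_ℝ) {r : ℝ} (hr : 0 < r) {v : H}
    (hv : ∀ u θ, r < θ → K u = θ • u → ⟪u, v⟫_ℝ = 0) : ⟪K v, v⟫_ℝ ≤ r * ⟪v, v⟫_ℝ := by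
  let F : Submodule ℝ H := (Submodule.span ℝ {u | ∃ θ, r < θ ∧ K u = θ • u})ᗮ
  have hF : ∀ x, x ∈ F ↔ ∀ u θ, r < θ → K u = θ • u → ⟪u, x⟫_ℝ = 0 := by
    intro x
    refine ⟨fun h u θ hθ hu => (Submodule.mem_orthogonal _ _).1 h u
      (Submodule.subset_span ⟨θ, hθ, hu⟩), fun h => (Submodule.mem_orthogonal _ _).2 ?_⟩
    intro u hu
    induction hu using Submodule.span_induction with
    | mem u hu => obtain ⟨θ, hθ, hu⟩ := hu; exact h u θ hθ hu
    | zero => simp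
    | add x y _ _ hx hy => simp [inner_add_left, hx, hy]
    | smul c x _ hx => simp [inner_smul_left, hx]
  have hinv : ∀ x ∈ F, (K : H →ₗ[ℝ] H) x ∈ F := by
    intro x hx
    rw [hF] at hx ⊢
    intro u θ hθ hu
    have : ⟪u, K x⟫_ℝ = ⟪K u, x⟫_ℝ := (hs u x).symm
    simp [this, hu, inner_smul_left, hx u θ hθ hu]
  let S : F →L[ℝ] F := K.restrict hinv
  have hSc : IsCompactOperator S := hc.restrict' hinv
  have hSs : S.IsSymmetric := hs.restrict_invariant hinv
  have hnorm : ‖S‖₊ ≤ ‖r‖₊ := by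
    rw [← ENNReal.coe_le_coe, ← S.spectralRadius_eq_nnnorm hSs.isSelfAdjoint, spectralRadius]
    refine iSup₂_le fun μ hμ => ?_
    rw [ENNReal.coe_le_coe, ← NNReal.coe_le_coe, coe_nnnorm, coe_nnnorm, Real.norm_eq_abs,
      Real.norm_eq_abs, abs_of_pos hr]
    rcases eq_or_ne μ 0 with rfl | h0
    · simpa using hr.le
    obtain ⟨x, hx⟩ := ((hSc.hasEigenvalue_iff_mem_spectrum h0).2 hμ).exists_hasEigenvector
    have hKx : K (x : H) = μ • (x : H) := congrArg Subtype.val hx.apply_eq_smul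
    have hx0 : (x : H) ≠ 0 := fun h => hx.2 (Subtype.ext h)
    have hpos : 0 < ⟪(x : H), (x : H)⟫_ℝ := real_inner_self_pos.2 hx0
    have h1 := hnn (x : H)
    rw [hKx, inner_smul_left] at h1
    have hμ0 : 0 ≤ μ := by
      by_contra! h
      have := mul_neg_of_neg_of_pos h hpos
      rw [RCLike.conj_to_real] at h1
      linarith
    rw [abs_of_nonneg hμ0]
    by_contra! hlt
    exact hpos.ne' ((hF x).1 x.2 x μ hlt hKx)
  have hvF : v ∈ F := (hF v).2 hv
  have h2 : ‖S ⟨v, hvF⟩‖ ≤ r * ‖v‖ := by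
    refine (S.le_opNorm _).trans ?_
    have : ‖S‖ ≤ r := by
      have := NNReal.coe_le_coe.2 hnorm
      simpa [abs_of_pos hr] using this
    simpa using mul_le_mul_of_nonneg_right this (norm_nonneg v)
  calc ⟪K v, v⟫_ℝ ≤ ‖K v‖ * ‖v‖ := real_inner_le_norm _ _
    _ ≤ (r * ‖v‖) * ‖v‖ := mul_le_mul_of_nonneg_right h2 (norm_nonneg v)
    _ = r * ⟪v, v⟫_ℝ := by rw [real_inner_self_eq_norm_sq]; ring

theorem ContinuousLinearMap.norm_apply_sq_le_of_inner_le {H : Type*} [NormedAddCommGroup H]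
    [InnerProductSpace ℝ H] {K : H →L[ℝ] H} (hs : K.IsSymmetric)
    (hnn : ∀ x, 0 ≤ ⟪K x, x⟫_ℝ) (hle : ∀ x, ⟪K x, x⟫_ℝ ≤ ⟪x, x⟫_ℝ) (x : H) :
    ‖K x‖ ^ 2 ≤ ⟪K x, x⟫_ℝ := by
  let B : LinearMap.BilinForm ℝ H := (innerₗ H).comp (K : H →ₗ[ℝ] H)
  have hB : ∀ x y, B x y = ⟪K x, y⟫_ℝ := fun x y => rfl
  have h := LinearMap.BilinForm.apply_sq_le_of_symm B hnn
    ⟨fun u w => by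
      rw [RingHom.id_apply, hB, hB, real_inner_comm]; exact (hs w u).symm⟩ x (K x)
  rw [hB, hB, hB, real_inner_self_eq_norm_sq] at h
  have h3 := hle (K x)
  rw [real_inner_self_eq_norm_sq] at h3
  rcases (norm_nonneg (K x)).eq_or_lt with h0 | h0
  · rw [← h0]; simpa using hnn x
  · have h4 : (‖K x‖ ^ 2) * ‖K x‖ ^ 2 ≤ ⟪K x, x⟫_ℝ * ‖K x‖ ^ 2 := by
      calc _ = (‖K x‖ ^ 2) ^ 2 := by ring
        _ ≤ _ := h.trans (mul_le_mul_of_nonneg_left h3 (hnn x))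
    exact le_of_mul_le_mul_right h4 (by positivity)

theorem ContinuousLinearMap.isCompactOperator_of_inner_le {H : Type*} [NormedAddCommGroup H]
    [InnerProductSpace ℝ H] [CompleteSpace H] {K : H →L[ℝ] H}
    (hs : K.IsSymmetric) (hnn : ∀ x, 0 ≤ ⟪K x, x⟫_ℝ) (hle : ∀ x, ⟪K x, x⟫_ℝ ≤ ⟪x, x⟫_ℝ)
    (happrox : ∀ ε : ℝ, 0 < ε → ∃ (n : ℕ) (l : H →ₗ[ℝ] (Fin n → ℝ)), ∀ v, l v = 0 →
      ⟪K v, v⟫_ℝ ≤ ε * ⟪v, v⟫_ℝ) : IsCompactOperator K := by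
  have key : ∀ ε : ℝ, 0 < ε → ∃ T : H →L[ℝ] H, IsCompactOperator T ∧ ‖K - T‖ ≤ ε := by
    intro ε hε
    obtain ⟨n, l, hl⟩ := happrox (ε ^ 2) (by positivity)
    let G : Submodule ℝ H := (LinearMap.ker l).topologicalClosure
    have hG : ∀ v ∈ G, ⟪K v, v⟫_ℝ ≤ ε ^ 2 * ⟪v, v⟫_ℝ := by
      intro v hv
      have hcl : IsClosed {v : H | ⟪K v, v⟫_ℝ ≤ ε ^ 2 * ⟪v, v⟫_ℝ} :=
        isClosed_le (by fun_prop) (by fun_prop)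
      exact closure_minimal (fun v hv => hl v hv) hcl hv
    have : CompleteSpace G := (Submodule.isClosed_topologicalClosure _).completeSpace_coe
    have : FiniteDimensional ℝ Gᗮ := by
      have hle' : Gᗮ ≤ (LinearMap.ker l)ᗮ :=
        Submodule.orthogonal_le (Submodule.le_topologicalClosure _)
      refine FiniteDimensional.of_injective (l ∘ₗ Gᗮ.subtype) ?_
      rw [← LinearMap.ker_eq_bot, LinearMap.ker_eq_bot']
      intro x hx
      have h1 : (x : H) ∈ LinearMap.ker l := hx
      have h2 := (Submodule.mem_orthogonal _ _).1 (hle' x.2) _ h1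
      exact Subtype.ext (inner_self_eq_zero.1 h2)
    refine ⟨K ∘L Gᗮ.starProjection, ?_, ?_⟩
    · have : IsCompactOperator (Gᗮ.orthogonalProjectionOnto : H →L[ℝ] Gᗮ) :=
        isCompactOperator_of_locallyCompactSpace_dom
          (Gᗮ.orthogonalProjectionOnto : H →L[ℝ] Gᗮ)
      exact this.clm_comp (K ∘L Gᗮ.subtypeL)
    · have hKP : K - K ∘L Gᗮ.starProjection = K ∘L G.starProjection := by
        ext x; simp [Submodule.starProjection_orthogonal']
      rw [hKP]
      refine ContinuousLinearMap.opNorm_le_bound _ hε.le fun x => ?_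
      have h1 := K.norm_apply_sq_le_of_inner_le hs hnn hle (G.starProjection x)
      have h2 := hG _ (G.starProjection_apply_mem x)
      rw [real_inner_self_eq_norm_sq] at h2
      have h3 : ‖K (G.starProjection x)‖ ≤ ε * ‖G.starProjection x‖ := by
        refine abs_le_of_sq_le_sq' ?_ (by positivity) |>.2
        rw [mul_pow]; exact h1.trans h2
      refine h3.trans (mul_le_mul_of_nonneg_left ?_ hε.le)
      simpa using G.starProjection.le_of_opNorm_le G.starProjection_norm_le x
  have hmem : K ∈ closure {T : H →L[ℝ] H | IsCompactOperator T} := by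
    rw [Metric.mem_closure_iff]
    intro ε hε
    obtain ⟨T, hT, hKT⟩ := key (ε / 2) (by positivity)
    exact ⟨T, hT, by rw [dist_eq_norm]; linarith⟩
  rwa [isClosed_setOfPred_isCompactOperator.closure_eq] at hmem

/-- Spectral theorem for a pair of forms, `m` being compact with respect to `B`. -/
theorem form_le_of_orthogonal_eigenvectors {V E : Type*} [AddCommGroup V] [Module ℝ V]
    [NormedAddCommGroup E] [NormedSpace ℝ E] [CompleteSpace E] (e : V ≃ₗ[ℝ] E)
    (B m : LinearMap.BilinForm ℝ V) (hB : ∀ v w, B v w = B w v) (hm : ∀ v w, m v w = m w v)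
    (hm0 : ∀ v, 0 ≤ m v v) (hmB : ∀ v, m v v ≤ B v v) {c C : ℝ} (hc : 0 < c)
    (hcB : ∀ v, c * ‖e v‖ ^ 2 ≤ B v v) (hBC : ∀ v, B v v ≤ C * ‖e v‖ ^ 2)
    (happrox : ∀ ε : ℝ, 0 < ε → ∃ (n : ℕ) (l : V →ₗ[ℝ] (Fin n → ℝ)), ∀ v, l v = 0 →
      m v v ≤ ε * B v v)
    {r : ℝ} (hr : 0 < r) {v : V}
    (hv : ∀ u θ, r < θ → (∀ z, m u z = θ * B u z) → B u v = 0) : m v v ≤ r * B v v := by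
  let core : InnerProductSpace.Core ℝ V :=
    { inner := fun x y => B x y
      conj_inner_symm := fun x y => by simpa using hB y x
      re_inner_nonneg := fun x => by
        simpa using (mul_nonneg hc.le (sq_nonneg ‖e x‖)).trans (hcB x)
      add_left := fun x y z => by simp
      smul_left := fun x y r => by simp
      definite := fun x hx => by
        have h : B x x = 0 := hx
        have h1 := hcB x
        rw [h] at h1
        have h2 : ‖e x‖ ^ 2 = 0 := le_antisymm (by
          by_contra! h3
          exact absurd (mul_pos hc h3) (not_lt.2 h1)) (sq_nonneg _)
        simpa using h2 }
  let _ : NormedAddCommGroup V := core.toNormedAddCommGroup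
  let _ : InnerProductSpace ℝ V := InnerProductSpace.ofCore core.toCore
  have hin : ∀ x y : V, ⟪x, y⟫_ℝ = B x y := fun x y => rfl
  have hnorm : ∀ x : V, ‖x‖ ^ 2 = B x x := fun x => by rw [← real_inner_self_eq_norm_sq, hin]
  have hC0 : 0 ≤ max C 0 := le_max_right _ _
  have hcont : Continuous e.symm := by
    refine AddMonoidHomClass.continuous_of_bound e.symm √(max C 0) fun x => ?_
    refine abs_le_of_sq_le_sq' ?_ (by positivity) |>.2
    have h1 := hBC (e.symm x)
    simp only [LinearEquiv.apply_symm_apply] at h1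
    rw [mul_pow, Real.sq_sqrt hC0]
    exact ((hnorm (e.symm x)).trans_le h1).trans (mul_le_mul_of_nonneg_right (le_max_left _ _)
      (sq_nonneg _))
  have hcont' : Continuous e := by
    refine AddMonoidHomClass.continuous_of_bound e √(c⁻¹) fun x => ?_
    refine abs_le_of_sq_le_sq' ?_ (by positivity) |>.2
    rw [mul_pow, Real.sq_sqrt (by positivity), hnorm]
    have := hcB x
    rw [inv_mul_eq_div, le_div_iff₀ hc]; linarith
  let e' : V ≃L[ℝ] E := ⟨e, hcont', hcont⟩
  have : CompleteSpace V :=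
    (completeSpace_congr (e := e.toEquiv) e'.isUniformEmbedding).2 inferInstance
  have hCS : ∀ x y, |m x y| ≤ 1 * ‖x‖ * ‖y‖ := by
    intro x y
    refine abs_le_of_sq_le_sq ?_ (by positivity)
    have h := LinearMap.BilinForm.apply_sq_le_of_symm m hm0 ⟨fun u w => by simpa using hm u w⟩ x y
    rw [one_mul, mul_pow, hnorm, hnorm]
    exact h.trans (mul_le_mul (hmB x) (hmB y) (hm0 y) ((hm0 x).trans (hmB x)))
  let mc : V →L[ℝ] V →L[ℝ] ℝ := LinearMap.mkContinuous₂ m 1 hCS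
  let K : V →L[ℝ] V := InnerProductSpace.continuousLinearMapOfBilin (𝕜 := ℝ) mc
  have hK : ∀ x y, ⟪K x, y⟫_ℝ = m x y := fun x y =>
    InnerProductSpace.continuousLinearMapOfBilin_apply (𝕜 := ℝ) mc x y
  have hs : K.IsSymmetric := fun x y => by
    change ⟪K x, y⟫_ℝ = ⟪x, K y⟫_ℝ
    rw [real_inner_comm (K y), hK, hK, hm]
  have hnn : ∀ x, 0 ≤ ⟪K x, x⟫_ℝ := fun x => by rw [hK]; exact hm0 x
  have hcomp : IsCompactOperator K := by
    refine ContinuousLinearMap.isCompactOperator_of_inner_le hs hnn (fun x => ?_) ?_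
    · rw [hK, hin]; exact hmB x
    · simpa only [hK, hin] using happrox
  have h := hcomp.inner_le_of_orthogonal_eigenvectors hs hnn hr (v := v) (fun u θ hθ hu => ?_)
  · rwa [hK, hin] at h
  · rw [hin]
    refine hv u θ hθ fun z => ?_
    rw [← hK, hu, inner_smul_left, hin]
    simp

end Spectral

section CantorMeasure

open MeasureTheory

/-- A continuous distribution function on `[0,1]`, self-similar under the maps
`x ↦ j * d + a * x` for `j < κ`. -/
structure SelfSimilarCDF (F : ℝ → ℝ) (κ : ℕ) (a d : ℝ) : Prop where
  two_le : 2 ≤ κ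
  a_pos : 0 < a
  a_lt : a < d
  span_eq : (κ - 1) * d + a = 1
  cont : Continuous F
  mono : Monotone F
  of_nonpos : ∀ x ≤ 0, F x = 0
  of_one_le : ∀ x, 1 ≤ x → F x = 1
  sum_eq : ∀ x, ∑ j ∈ Finset.range κ, F ((x - j * d) / a) = κ * F x

/-- The function constantly extended from `[0,1]` to the line. -/
noncomputable def clamp (P : ℝ → ℝ) : ℝ → ℝ := fun x => P (max 0 (min x 1))

theorem clamp_eq (P : ℝ → ℝ) {x : ℝ} (hx : x ∈ Icc (0 : ℝ) 1) : clamp P x = P x := by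
  rw [clamp, min_eq_left hx.2, max_eq_right hx.1]

theorem CantorSelfSimilar.selfSimilarCDF {P : ℝ → ℝ} {κ : ℕ} {a : ℝ}
    (hP : CantorSelfSimilar P κ a) :
    SelfSimilarCDF (clamp P) κ a (a + bb κ a) := by
  change SelfSimilarCDF (fun x => P (max 0 (min x 1))) κ a (a + bb κ a)
  obtain ⟨hc, hm, h0, h1, hκ, ha, haκ, hs, hgap⟩ := hP
  have hκR : (2 : ℝ) ≤ κ := by exact_mod_cast hκ
  set b := bb κ a with hb
  have hbpos : 0 < b := by
    rw [lt_div_iff₀ (by linarith)] at haκ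
    exact div_pos (by linarith) (by linarith)
  have hspan : (κ - 1) * (a + b) + a = 1 := by
    rw [hb, bb, mul_add, mul_div_cancel₀ _ (by linarith)]; ring
  set d := a + b with hd
  have hdpos : 0 < d := by linarith
  have hclamp : ∀ x : ℝ, max 0 (min x 1) ∈ Icc (0 : ℝ) 1 := fun x =>
    ⟨le_max_left _ _, max_le zero_le_one (min_le_right _ _)⟩
  have hclamp' : ∀ x ∈ Icc (0 : ℝ) 1, max 0 (min x 1) = x := fun x hx => by
    rw [min_eq_left hx.2, max_eq_right hx.1]
  have hF0 : ∀ x : ℝ, x ≤ 0 → P (max 0 (min x 1)) = 0 := fun x hx => by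
    rw [max_eq_left ((min_le_left _ _).trans hx), h0]
  have hF1 : ∀ x : ℝ, 1 ≤ x → P (max 0 (min x 1)) = 1 := fun x hx => by
    rw [min_eq_right hx, max_eq_right zero_le_one, h1]
  have hjd : ∀ j : ℕ, j < κ → (j : ℝ) * d + a ≤ 1 := fun j hj => by
    have : (j : ℝ) + 1 ≤ κ := by exact_mod_cast hj
    nlinarith
  have hgapv : ∀ j : ℕ, j + 1 < κ → ∀ x ∈ Icc ((j : ℝ) * d + a) ((j + 1 : ℝ) * d),
      P x = P (j * d + a) := by
    intro j hj x hx
    have hg := hgap (j + 1) (by omega) hj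
    have hl : ((j + 1 : ℕ) : ℝ) * d - b = j * d + a := by push_cast; rw [hd]; ring
    rw [hl] at hg
    push_cast at hg
    have hlt : (j : ℝ) * d + a < (j + 1 : ℝ) * d := by linarith
    have hsub : Icc ((j : ℝ) * d + a) ((j + 1 : ℝ) * d) ⊆ Icc (0 : ℝ) 1 := by
      refine Icc_subset_Icc (by positivity) ?_
      have := hjd (j + 1) hj
      push_cast at this
      linarith
    obtain ⟨z, hz⟩ : (Ioo ((j : ℝ) * d + a) ((j + 1 : ℝ) * d)).Nonempty := nonempty_Ioo.2 hlt
    have hall : ∀ x ∈ Icc ((j : ℝ) * d + a) ((j + 1 : ℝ) * d), P x = P z := by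
      have hcl : Icc ((j : ℝ) * d + a) ((j + 1 : ℝ) * d) ⊆
          closure (Ioo ((j : ℝ) * d + a) ((j + 1 : ℝ) * d)) := by
        rw [closure_Ioo hlt.ne]
      exact Set.EqOn.of_subset_closure (t := Icc ((j : ℝ) * d + a) ((j + 1 : ℝ) * d))
        (fun x hx => hg x hx z hz) (hc.mono hsub)
        continuousOn_const Ioo_subset_Icc_self hcl
    rw [hall x hx, hall _ (left_mem_Icc.2 hlt.le)]
  have hcell : ∀ j : ℕ, j < κ → ∀ x ∈ Icc (0 : ℝ) 1, κ * P (j * d + a * x) = P x + j := by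
    intro j
    induction j with
    | zero =>
      intro hj x hx
      obtain ⟨c, hc⟩ := hs 0 hj
      have := hc 0 (left_mem_Icc.2 zero_le_one)
      have h2 := hc x hx
      simp only [Nat.cast_zero, zero_mul, zero_add, mul_zero, h0] at this h2 ⊢
      linarith
    | succ j ih =>
      intro hj x hx
      obtain ⟨c, hc⟩ := hs (j + 1) hj
      have e1 := hc 0 (left_mem_Icc.2 zero_le_one)
      have e2 := hc x hx
      have e3 := ih (by omega) 1 (right_mem_Icc.2 zero_le_one)
      have e4 := hgapv j hj ((j + 1 : ℝ) * d) (right_mem_Icc.2 (by linarith))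
      simp only [mul_one, mul_zero, add_zero, h0, h1, zero_add] at e1 e3
      push_cast at e1 e2 e4 ⊢
      rw [e4] at e1
      linarith
  refine ⟨hκ, ha, by linarith, hspan, ?_, ?_, hF0, hF1, ?_⟩
  · exact hc.comp_continuous (by fun_prop) hclamp
  · intro x y hxy
    exact hm (hclamp x) (hclamp y) (max_le_max le_rfl (min_le_min hxy le_rfl))
  · have hsplit : ∀ (j : ℕ) (x : ℝ), j < κ → j * d ≤ x → x ≤ j * d + d →
        ∑ i ∈ Finset.range κ, P (max 0 (min ((x - i * d) / a) 1)) =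
          j + P (max 0 (min ((x - j * d) / a) 1)) := by
      intro j x hj hx1 hx2
      rw [← Finset.sum_range_add_sum_Ico _ hj.le, Finset.sum_eq_sum_Ico_succ_bot hj]
      have e1 : ∑ i ∈ Finset.range j, P (max 0 (min ((x - i * d) / a) 1)) = j := by
        rw [Finset.sum_congr rfl (g := fun _ => (1 : ℝ))]
        · simp
        · intro i hi
          have hi' : (i : ℝ) + 1 ≤ j := by exact_mod_cast Finset.mem_range.1 hi
          refine hF1 _ ?_
          rw [le_div_iff₀ ha]
          nlinarith
      have e2 : ∑ i ∈ Finset.Ico (j + 1) κ, P (max 0 (min ((x - i * d) / a) 1)) = 0 := by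
        refine Finset.sum_eq_zero fun i hi => hF0 _ ?_
        have hi' : (j : ℝ) + 1 ≤ i := by exact_mod_cast (Finset.mem_Ico.1 hi).1
        refine div_nonpos_of_nonpos_of_nonneg ?_ ha.le
        nlinarith
      rw [e1, e2, add_zero]
    intro x
    rcases le_total x 0 with hx0 | hx0
    · rw [hF0 x hx0, mul_zero]
      refine Finset.sum_eq_zero fun i _ => hF0 _ ?_
      exact div_nonpos_of_nonpos_of_nonneg (by nlinarith [(Nat.cast_nonneg i : (0 : ℝ) ≤ i)]) ha.le
    rcases le_total 1 x with hx1 | hx1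
    · rw [hF1 x hx1, Finset.sum_congr rfl (g := fun _ => (1 : ℝ))]
      · simp
      · intro i hi
        refine hF1 _ ?_
        rw [le_div_iff₀ ha]
        linarith [hjd i (Finset.mem_range.1 hi)]
    set j := ⌊x / d⌋₊ with hj
    have hj1 : (j : ℝ) * d ≤ x := by
      rw [← le_div_iff₀ hdpos]; exact Nat.floor_le (by positivity)
    have hj2 : x < j * d + d := by
      have := Nat.lt_floor_add_one (x / d)
      rw [div_lt_iff₀ hdpos] at this
      rw [hj]; linarith
    have hjκ : j < κ := by
      by_contra! h
      have : (κ : ℝ) ≤ j := by exact_mod_cast h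
      nlinarith
    rw [hsplit j x hjκ hj1 hj2.le, hclamp' x ⟨hx0, hx1⟩]
    rcases le_total x (j * d + a) with hxa | hxa
    · have hmem : (x - j * d) / a ∈ Icc (0 : ℝ) 1 :=
        ⟨div_nonneg (by linarith) ha.le, by rw [div_le_one ha]; linarith⟩
      have := hcell j hjκ _ hmem
      rw [mul_div_cancel₀ _ ha.ne', add_sub_cancel] at this
      rw [hclamp' _ hmem, this, add_comm]
    · have e1 : P (max 0 (min ((x - j * d) / a) 1)) = 1 :=
        hF1 _ (by rw [le_div_iff₀ ha]; linarith)
      have e2 : P x = P (j * d + a) := by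
        rcases Nat.lt_or_ge (j + 1) κ with h | h
        · exact hgapv j h x ⟨hxa, by linarith⟩
        · have : (κ : ℝ) ≤ j + 1 := by exact_mod_cast h
          have h3 : x = j * d + a := le_antisymm (by nlinarith) hxa
          rw [← h3]
      have e3 := hcell j hjκ 1 (right_mem_Icc.2 zero_le_one)
      rw [mul_one, h1] at e3
      rw [e1, e2, e3, add_comm]

namespace SelfSimilarCDF

variable {F : ℝ → ℝ} {κ : ℕ} {a d : ℝ}

theorem cast_two_le (h : SelfSimilarCDF F κ a d) : (2 : ℝ) ≤ κ := by exact_mod_cast h.two_le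

theorem kappa_mul_lt (h : SelfSimilarCDF F κ a d) : κ * a < 1 := by
  have := h.span_eq
  nlinarith [h.a_lt, h.cast_two_le]

theorem a_lt_half (h : SelfSimilarCDF F κ a d) : a < 1 / 2 := by
  nlinarith [h.kappa_mul_lt, h.cast_two_le, h.a_pos]

theorem exists_measure (h : SelfSimilarCDF F κ a d) :
    ∃ μ : Measure ℝ, IsProbabilityMeasure μ ∧ NullSingletonClass μ ∧
      ∀ x, μ (Iic x) = ENNReal.ofReal (F x) := by
  let G : StieltjesFunction ℝ := ⟨F, h.mono, fun x => h.cont.continuousWithinAt⟩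
  have hbot : Tendsto G atBot (nhds 0) :=
    tendsto_const_nhds.congr' (by
      filter_upwards [eventually_le_atBot 0] with x hx using (h.of_nonpos x hx).symm)
  have htop : Tendsto G atTop (nhds 1) :=
    tendsto_const_nhds.congr' (by
      filter_upwards [eventually_ge_atTop 1] with x hx using (h.of_one_le x hx).symm)
  refine ⟨G.measure, ⟨?_⟩, ⟨fun x => ?_⟩, fun x => ?_⟩
  · rw [G.measure_univ hbot htop]; simp
  · rw [G.measure_singleton,
      leftLim_eq_of_tendsto (h.cont.tendsto x |>.mono_left nhdsWithin_le_nhds)]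
    simp [G]
  · rw [G.measure_Iic hbot, sub_zero]

end SelfSimilarCDF

end CantorMeasure

namespace SelfSimilarCDF

open MeasureTheory

variable {F : ℝ → ℝ} {κ : ℕ} {a d : ℝ} {μ : Measure ℝ} [IsProbabilityMeasure μ]

theorem nonneg (h : SelfSimilarCDF F κ a d) (x : ℝ) : 0 ≤ F x := by
  rcases le_total x 0 with hx | hx
  · rw [h.of_nonpos x hx]
  · rw [← h.of_nonpos 0 le_rfl]; exact h.mono hx

theorem measureReal_Ioc (h : SelfSimilarCDF F κ a d)
    (hμ : ∀ x, μ (Iic x) = ENNReal.ofReal (F x)) {x y : ℝ} (hxy : x ≤ y) :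
    μ.real (Ioc x y) = F y - F x := by
  have h1 : ∀ z, μ.real (Iic z) = F z := fun z => by
    rw [measureReal_def, hμ, ENNReal.toReal_ofReal (h.nonneg z)]
  have : Ioc x y = Iic y \ Iic x := by ext z; simp [and_comm]
  rw [this, measureReal_sdiff (Iic_subset_Iic.2 hxy) measurableSet_Iic, h1, h1]

theorem ae_mem_Icc (h : SelfSimilarCDF F κ a d)
    (hμ : ∀ x, μ (Iic x) = ENNReal.ofReal (F x)) : ∀ᵐ x ∂μ, x ∈ Icc (0 : ℝ) 1 := by
  have h0 : μ (Iic 0) = 0 := by rw [hμ, h.of_nonpos 0 le_rfl]; simp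
  have h1 : μ (Iic 1)ᶜ = 0 := by
    rw [prob_compl_eq_zero_iff measurableSet_Iic, hμ, h.of_one_le 1 le_rfl]; simp
  have e0 : ∀ᵐ x ∂μ, x ∉ Iic (0 : ℝ) := measure_eq_zero_iff_ae_notMem.1 h0
  have e1 : ∀ᵐ x ∂μ, x ∉ (Iic (1 : ℝ))ᶜ := measure_eq_zero_iff_ae_notMem.1 h1
  filter_upwards [e0, e1] with x hx0 hx1
  exact ⟨(not_le.1 hx0).le, not_not.1 hx1⟩

theorem restrict_Icc (h : SelfSimilarCDF F κ a d)
    (hμ : ∀ x, μ (Iic x) = ENNReal.ofReal (F x)) : μ.restrict (Icc 0 1) = μ :=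
  Measure.restrict_eq_self_of_ae_mem (h.ae_mem_Icc hμ)

theorem integrable (h : SelfSimilarCDF F κ a d)
    (hμ : ∀ x, μ (Iic x) = ENNReal.ofReal (F x)) {f : ℝ → ℝ} (hf : Continuous f) :
    Integrable f μ := by
  rw [← h.restrict_Icc hμ]
  exact hf.integrableOn_Icc

theorem eq_sum_map (h : SelfSimilarCDF F κ a d)
    (hμ : ∀ x, μ (Iic x) = ENNReal.ofReal (F x)) :
    μ = (κ : ENNReal)⁻¹ • ∑ j ∈ Finset.range κ, μ.map (fun x => j * d + a * x) := by
  have hκ : (κ : ENNReal) ≠ 0 := by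
    have := h.two_le
    simp; omega
  refine Measure.ext_of_Iic _ _ fun x => ?_
  have hpre : ∀ j : ℕ, (fun y : ℝ => j * d + a * y) ⁻¹' Iic x = Iic ((x - j * d) / a) := by
    intro j
    ext y
    simp only [mem_preimage, mem_Iic]
    rw [le_div_iff₀ h.a_pos]
    constructor <;> intro <;> linarith
  have hmap : ∀ j : ℕ, μ.map (fun y : ℝ => j * d + a * y) (Iic x) =
      ENNReal.ofReal (F ((x - j * d) / a)) := by
    intro j
    rw [Measure.map_apply (by fun_prop) measurableSet_Iic, hpre, hμ]
  rw [Measure.smul_apply, Measure.finsetSum_apply]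
  simp only [hmap, smul_eq_mul]
  rw [← ENNReal.ofReal_sum_of_nonneg fun i _ => h.nonneg _, h.sum_eq,
    ENNReal.ofReal_mul (by positivity), ENNReal.ofReal_natCast, ← mul_assoc,
    ENNReal.inv_mul_cancel hκ (by simp), one_mul, hμ]

theorem integral_eq_sum (h : SelfSimilarCDF F κ a d)
    (hμ : ∀ x, μ (Iic x) = ENNReal.ofReal (F x)) {f : ℝ → ℝ} (hf : Continuous f) :
    ∫ x, f x ∂μ = (κ : ℝ)⁻¹ * ∑ j ∈ Finset.range κ, ∫ x, f (j * d + a * x) ∂μ := by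
  have hint : ∀ j : ℕ, Integrable f (μ.map (fun x => j * d + a * x)) := fun j =>
    (integrable_map_measure hf.aestronglyMeasurable (by fun_prop)).2
      (h.integrable hμ (hf.comp (by fun_prop)))
  conv_lhs => rw [h.eq_sum_map hμ]
  rw [integral_smul_measure, integral_finsetSum_measure fun j _ => hint j]
  simp only [ENNReal.toReal_inv, ENNReal.toReal_natCast, smul_eq_mul]
  congr 1
  refine Finset.sum_congr rfl fun j _ => ?_
  rw [integral_map (by fun_prop) hf.aestronglyMeasurable]

theorem integral_sq_sub_pos [NullSingletonClass μ] (h : SelfSimilarCDF F κ a d)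
    (hμ : ∀ x, μ (Iic x) = ENNReal.ofReal (F x)) (c : ℝ) : 0 < ∫ x, (x - c) ^ 2 ∂μ := by
  have hc : Continuous fun x : ℝ => (x - c) ^ 2 := (continuous_id.sub continuous_const).pow 2
  rw [integral_pos_iff_support_of_nonneg (fun x => sq_nonneg _) (h.integrable hμ hc)]
  have : Function.support (fun x : ℝ => (x - c) ^ 2) = {c}ᶜ := by
    ext x; simp [sub_eq_zero]
  rw [this, prob_compl_eq_one_sub (measurableSet_singleton c), measure_singleton]
  simp

/-- Integration by parts against the measure with distribution function `F`. -/
theorem setIntegral_Ioc (h : SelfSimilarCDF F κ a d)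
    (hμ : ∀ x, μ (Iic x) = ENNReal.ofReal (F x)) {f f' : ℝ → ℝ}
    (hf : ∀ x, HasDerivAt f (f' x) x) (hf' : Continuous f') {v : ℝ} (hv : 0 ≤ v) :
    ∫ x in Ioc 0 v, f x ∂μ = f v * F v - ∫ x in (0 : ℝ)..v, f' x * F x := by
  have hfc : Continuous f := continuous_iff_continuousAt.2 fun x => (hf x).continuousAt
  have hint : ∀ s t, IntervalIntegrable (fun x => f' x * F x) volume s t := fun s t =>
    (hf'.mul h.cont).intervalIntegrable _ _
  obtain ⟨C, hC⟩ := (isCompact_Icc (a := (0 : ℝ)) (b := v)).exists_bound_of_continuousOn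
    hf'.continuousOn
  have hC0 : 0 ≤ C := (norm_nonneg _).trans (hC 0 (left_mem_Icc.2 hv))
  let H : ℝ → ℝ := fun t => (∫ x in Ioc 0 t, f x ∂μ) - (f t * F t - ∫ x in (0 : ℝ)..t, f' x * F x)
  have hincr : ∀ s t, 0 ≤ s → s ≤ t → t ≤ v → |H t - H s| ≤ 2 * C * (t - s) * (F t - F s) := by
    intro s t hs hst htv
    have hFst : 0 ≤ F t - F s := sub_nonneg.2 (h.mono hst)
    have hlip : ∀ x ∈ Icc s t, |f x - f t| ≤ C * (t - s) := by
      intro x hx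
      have := (convex_Icc s t).norm_image_sub_le_of_norm_hasDerivWithin_le
        (fun y _ => (hf y).hasDerivWithinAt) (fun y hy => hC y ⟨hs.trans hy.1, hy.2.trans htv⟩)
        (right_mem_Icc.2 hst) hx
      refine this.trans (mul_le_mul_of_nonneg_left ?_ hC0)
      rw [Real.norm_eq_abs, abs_sub_comm, abs_of_nonneg (sub_nonneg.2 hx.2)]
      linarith [hx.1]
    have e1 : (∫ x in Ioc 0 t, f x ∂μ) =
        (∫ x in Ioc 0 s, f x ∂μ) + ((∫ x in Ioc s t, (f x - f t) ∂μ) + f t * (F t - F s)) := by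
      have hi := h.integrable hμ hfc
      rw [← Ioc_union_Ioc_eq_Ioc hs hst, setIntegral_union (Ioc_disjoint_Ioc_of_le le_rfl)
        measurableSet_Ioc hi.integrableOn hi.integrableOn,
        integral_sub hi.integrableOn (integrable_const _), setIntegral_const,
        h.measureReal_Ioc hμ hst, smul_eq_mul]
      ring
    have e2 : (∫ x in (0 : ℝ)..t, f' x * F x) = (∫ x in (0 : ℝ)..s, f' x * F x) +
        ((∫ x in s..t, f' x * (F x - F s)) + (f t - f s) * F s) := by
      rw [← intervalIntegral.integral_add_adjacent_intervals (hint 0 s) (hint s t)]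
      have : ∫ x in s..t, f' x = f t - f s :=
        intervalIntegral.integral_eq_sub_of_hasDerivAt (fun x _ => hf x)
          (hf'.intervalIntegrable _ _)
      rw [← this, ← intervalIntegral.integral_mul_const, ← intervalIntegral.integral_add]
      · congr 1
        refine intervalIntegral.integral_congr fun x _ => ?_
        ring
      · exact (hf'.mul (h.cont.sub continuous_const)).intervalIntegrable _ _
      · exact (hf'.mul continuous_const).intervalIntegrable _ _
    have e3 : H t - H s = (∫ x in Ioc s t, (f x - f t) ∂μ) + ∫ x in s..t, f' x * (F x - F s) := by
      simp only [H]
      rw [e1, e2]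
      ring
    have b1 : |∫ x in Ioc s t, (f x - f t) ∂μ| ≤ C * (t - s) * (F t - F s) := by
      rw [← h.measureReal_Ioc hμ hst, ← Real.norm_eq_abs]
      exact norm_setIntegral_le_of_norm_le_const (measure_lt_top _ _)
        fun x hx => hlip x (Ioc_subset_Icc_self hx)
    have b2 : |∫ x in s..t, f' x * (F x - F s)| ≤ C * (F t - F s) * (t - s) := by
      have := intervalIntegral.norm_integral_le_of_norm_le_const (a := s) (b := t)
        (f := fun x => f' x * (F x - F s)) (C := C * (F t - F s)) (fun x hx => ?_)
      · rwa [abs_of_nonneg (sub_nonneg.2 hst)] at this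
      · rw [uIoc_of_le hst] at hx
        rw [norm_mul]
        refine mul_le_mul (hC x ⟨hs.trans hx.1.le, hx.2.trans htv⟩) ?_ (norm_nonneg _) hC0
        rw [Real.norm_eq_abs, abs_of_nonneg (sub_nonneg.2 (h.mono hx.1.le))]
        linarith [h.mono hx.2]
    rw [e3]
    refine (abs_add_le _ _).trans ?_
    linarith
  have hH0 : H 0 = 0 := by simp [H, h.of_nonpos 0 le_rfl]
  have hbound : ∀ s t, 0 ≤ s → s ≤ t → t ≤ v → |H t - H s| ≤ 2 * C * (t - s) := by
    intro s t hs hst htv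
    refine (hincr s t hs hst htv).trans ?_
    have : F t - F s ≤ 1 := by
      have h1 := h.nonneg s
      have h2 := h.mono (le_max_left t 1)
      rw [h.of_one_le _ (le_max_right t 1)] at h2
      linarith
    exact mul_le_of_le_one_right (mul_nonneg (by positivity) (sub_nonneg.2 hst)) this
  have hcont : ContinuousOn H (Icc 0 v) := by
    refine LipschitzOnWith.continuousOn (K := (2 * C).toNNReal)
      (LipschitzOnWith.of_dist_le_mul fun x hx y hy => ?_)
    rw [Real.coe_toNNReal _ (by positivity), Real.dist_eq, Real.dist_eq]
    rcases le_total x y with hxy | hxy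
    · rw [abs_sub_comm, abs_sub_comm x, abs_of_nonneg (sub_nonneg.2 hxy)]
      exact hbound x y hx.1 hxy hy.2
    · rw [abs_of_nonneg (sub_nonneg.2 hxy)]
      exact hbound y x hy.1 hxy hx.2
  have hderiv : ∀ x ∈ Ico 0 v, HasDerivWithinAt H 0 (Ici x) x := by
    intro x hx
    rw [hasDerivWithinAt_iff_isLittleO, Asymptotics.isLittleO_iff]
    intro c hc
    have hF : Tendsto (fun t => 2 * C * (F t - F x)) (nhdsWithin x (Ici x)) (nhds 0) := by
      have : Tendsto (fun t => 2 * C * (F t - F x)) (nhds x) (nhds (2 * C * (F x - F x))) :=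
        (continuous_const.mul (h.cont.sub continuous_const)).tendsto x
      rw [sub_self, mul_zero] at this
      exact this.mono_left nhdsWithin_le_nhds
    filter_upwards [hF.eventually (gt_mem_nhds hc), self_mem_nhdsWithin,
      nhdsWithin_le_nhds (Iio_mem_nhds hx.2)] with t ht hxt htv
    have h1 := hincr x t hx.1 hxt (le_of_lt htv)
    rw [smul_zero, sub_zero, Real.norm_eq_abs, Real.norm_eq_abs,
      abs_of_nonneg (sub_nonneg.2 (mem_Ici.1 hxt))]
    refine h1.trans ?_
    have : 0 ≤ t - x := sub_nonneg.2 hxt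
    nlinarith
  have := constant_of_has_deriv_right_zero hcont hderiv v (right_mem_Icc.2 hv)
  rw [hH0] at this
  exact sub_eq_zero.1 this

end SelfSimilarCDF

section Hilbert

open MeasureTheory

open scoped InnerProductSpace

/-- Square integrable functions on `[0,1]`. -/
abbrev L2I : Type := Lp ℝ 2 (volume.restrict (Icc (0 : ℝ) 1))

/-- Functions on `[0,1]` with square integrable second derivative, encoded by the value at `0`,
the derivative at `0` and the second derivative. -/
abbrev H2 : Type := ℝ × ℝ × L2I

theorem memLp_two_of_bounded {f : ℝ → ℝ} (hf : Measurable f) {C : ℝ}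
    (hC : ∀ t ∈ Icc (0 : ℝ) 1, |f t| ≤ C) :
    MemLp f 2 (volume.restrict (Icc (0 : ℝ) 1)) :=
  MemLp.of_bound hf.aestronglyMeasurable C
    ((ae_restrict_iff' measurableSet_Icc).2 (Eventually.of_forall hC))

theorem L2I.norm_toLp_le {f : ℝ → ℝ} (hf : MemLp f 2 (volume.restrict (Icc (0 : ℝ) 1))) {C : ℝ}
    (h0 : 0 ≤ C) (hC : ∀ t ∈ Icc (0 : ℝ) 1, |f t| ≤ C) : ‖hf.toLp f‖ ≤ C := by
  have := Lp.norm_le_of_ae_bound (f := hf.toLp f) h0 (by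
    filter_upwards [hf.coeFn_toLp, ae_restrict_mem measurableSet_Icc] with t ht htI
    rw [ht]; exact hC t htI)
  simpa [measureUnivNNReal] using this

theorem L2I.inner_toLp {f g : ℝ → ℝ} (hf : MemLp f 2 (volume.restrict (Icc (0 : ℝ) 1)))
    (hg : MemLp g 2 (volume.restrict (Icc (0 : ℝ) 1))) :
    ⟪hf.toLp f, hg.toLp g⟫_ℝ = ∫ t in (0 : ℝ)..1, f t * g t := by
  rw [L2.inner_def, intervalIntegral.integral_of_le zero_le_one, ← integral_Icc_eq_integral_Ioc]
  refine integral_congr_ae ?_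
  filter_upwards [hf.coeFn_toLp, hg.coeFn_toLp] with t h1 h2
  rw [h1, h2]
  simp [mul_comm]

theorem abs_ramp_sub_le (x y t : ℝ) : |max (x - t) 0 - max (y - t) 0| ≤ |x - y| := by
  simpa using abs_max_sub_max_le_abs (x - t) (y - t) 0

theorem memLp_ramp (x : ℝ) :
    MemLp (fun t => max (x - t) 0) 2 (volume.restrict (Icc (0 : ℝ) 1)) :=
  memLp_two_of_bounded (C := |x|) (by fun_prop) fun t ht => by
    rw [abs_of_nonneg (le_max_right _ _)]
    exact max_le (by linarith [ht.1, le_abs_self x]) (abs_nonneg x)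

/-- The kernel representing evaluation at `x`. -/
noncomputable def rampL2 (x : ℝ) : L2I := (memLp_ramp x).toLp _

theorem norm_rampL2_sub_le (x y : ℝ) : ‖rampL2 x - rampL2 y‖ ≤ |x - y| := by
  rw [rampL2, rampL2, ← MemLp.toLp_sub]
  exact L2I.norm_toLp_le _ (abs_nonneg _) fun t _ => abs_ramp_sub_le x y t

theorem norm_rampL2_le {x : ℝ} (hx : x ∈ Icc (0 : ℝ) 1) : ‖rampL2 x‖ ≤ 1 :=
  L2I.norm_toLp_le _ zero_le_one fun t ht => by
    rw [abs_of_nonneg (le_max_right _ _)]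
    exact max_le (by linarith [ht.1, hx.2]) zero_le_one

theorem continuous_rampL2 : Continuous rampL2 :=
  (LipschitzWith.of_dist_le_mul (K := 1) fun x y => by
    simpa [dist_eq_norm] using norm_rampL2_sub_le x y).continuous

theorem memLp_one : MemLp (fun _ => (1 : ℝ)) 2 (volume.restrict (Icc (0 : ℝ) 1)) :=
  memLp_two_of_bounded (C := 1) measurable_const fun _ _ => by simp

/-- The kernel representing evaluation of the derivative at `1`. -/
noncomputable def oneL2 : L2I := memLp_one.toLp _

theorem norm_oneL2_le : ‖oneL2‖ ≤ 1 := L2I.norm_toLp_le _ zero_le_one fun t _ => by simp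

namespace H2

/-- The second derivative. -/
noncomputable def dd : H2 →ₗ[ℝ] L2I := LinearMap.snd ℝ ℝ L2I ∘ₗ LinearMap.snd ℝ ℝ (ℝ × L2I)

/-- The value at `0`. -/
noncomputable def val0 : H2 →ₗ[ℝ] ℝ := LinearMap.fst ℝ ℝ (ℝ × L2I)

/-- The derivative at `0`. -/
noncomputable def der0 : H2 →ₗ[ℝ] ℝ := LinearMap.fst ℝ ℝ L2I ∘ₗ LinearMap.snd ℝ ℝ (ℝ × L2I)

/-- The value at `x`. -/
noncomputable def ev (x : ℝ) : H2 →ₗ[ℝ] ℝ := val0 + x • der0 + innerₗ L2I (rampL2 x) ∘ₗ dd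

/-- The derivative at `1`. -/
noncomputable def der1 : H2 →ₗ[ℝ] ℝ := der0 + innerₗ L2I oneL2 ∘ₗ dd

theorem ev_apply (x : ℝ) (v : H2) : ev x v = val0 v + x * der0 v + ⟪rampL2 x, dd v⟫_ℝ := by
  simp [ev]

theorem der1_apply (v : H2) : der1 v = der0 v + ⟪oneL2, dd v⟫_ℝ := by simp [der1]

theorem continuous_ev (v : H2) : Continuous fun x => ev x v := by
  simp only [ev_apply]
  exact (continuous_const.add (continuous_id.mul continuous_const)).add
    (continuous_rampL2.inner continuous_const)

theorem abs_inner_ramp_le {x : ℝ} (hx : x ∈ Icc (0 : ℝ) 1) (w : L2I) :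
    |⟪rampL2 x, w⟫_ℝ| ≤ ‖w‖ := by
  refine (abs_real_inner_le_norm _ _).trans ?_
  simpa using mul_le_mul_of_nonneg_right (norm_rampL2_le hx) (norm_nonneg w)

theorem abs_inner_one_le (w : L2I) : |⟪oneL2, w⟫_ℝ| ≤ ‖w‖ := by
  refine (abs_real_inner_le_norm _ _).trans ?_
  simpa using mul_le_mul_of_nonneg_right norm_oneL2_le (norm_nonneg w)

theorem abs_ev_sub_ev_le (x y : ℝ) (v : H2) :
    |ev x v - ev y v| ≤ |x - y| * (|der0 v| + ‖dd v‖) := by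
  have : ev x v - ev y v = (x - y) * der0 v + ⟪rampL2 x - rampL2 y, dd v⟫_ℝ := by
    rw [ev_apply, ev_apply, inner_sub_left]; ring
  rw [this, mul_add]
  refine (abs_add_le _ _).trans (add_le_add (abs_mul _ _).le ?_)
  exact (abs_real_inner_le_norm _ _).trans
    (mul_le_mul_of_nonneg_right (norm_rampL2_sub_le x y) (norm_nonneg _))

/-- The bending energy. -/
noncomputable def energy : LinearMap.BilinForm ℝ H2 := (innerₗ L2I).compl₁₂ dd dd

theorem energy_apply (v z : H2) : energy v z = ⟪dd v, dd z⟫_ℝ := rfl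

theorem energy_self (v : H2) : energy v v = ‖dd v‖ ^ 2 := by
  rw [energy_apply, real_inner_self_eq_norm_sq]

/-- The mass form. -/
noncomputable def mass (μ : Measure ℝ) [IsFiniteMeasure μ] : LinearMap.BilinForm ℝ H2 :=
  LinearMap.mk₂ ℝ (fun v z => ∫ x in Icc 0 1, ev x v * ev x z ∂μ)
    (fun v v' z => by
      simp only [map_add, add_mul]
      exact integral_add ((continuous_ev v).mul (continuous_ev z)).integrableOn_Icc
        ((continuous_ev v').mul (continuous_ev z)).integrableOn_Icc)
    (fun c v z => by simp only [map_smul, smul_eq_mul, mul_assoc, integral_const_mul])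
    (fun v z z' => by
      simp only [map_add, mul_add]
      exact integral_add ((continuous_ev v).mul (continuous_ev z)).integrableOn_Icc
        ((continuous_ev v).mul (continuous_ev z')).integrableOn_Icc)
    (fun c v z => by
      simp only [map_smul, smul_eq_mul, mul_left_comm _ c, integral_const_mul])

theorem mass_apply (μ : Measure ℝ) [IsFiniteMeasure μ] (v z : H2) :
    mass μ v z = ∫ x in Icc 0 1, ev x v * ev x z ∂μ := rfl

theorem mass_self_nonneg (μ : Measure ℝ) [IsFiniteMeasure μ] (v : H2) : 0 ≤ mass μ v v :=
  integral_nonneg fun _ => mul_self_nonneg _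

theorem mass_comm (μ : Measure ℝ) [IsFiniteMeasure μ] (v z : H2) : mass μ v z = mass μ z v := by
  simp only [mass_apply, mul_comm]

theorem energy_comm (v z : H2) : energy v z = energy z v :=
  (real_inner_comm (dd v) (dd z)).symm

/-- The energy together with the boundary terms of the problem `(α, β)`. -/
noncomputable def fullEnergy (α β : ℝ) : LinearMap.BilinForm ℝ H2 :=
  energy + β⁻¹ • LinearMap.BilinForm.linMulLin (β • der0 - α • val0) (β • der0 - α • val0) +
    β⁻¹ • LinearMap.BilinForm.linMulLin (α • ev 1 + β • der1) (α • ev 1 + β • der1)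

theorem fullEnergy_apply (α β : ℝ) (v z : H2) : fullEnergy α β v z = energy v z +
    β⁻¹ * ((β * der0 v - α * val0 v) * (β * der0 z - α * val0 z)) +
    β⁻¹ * ((α * ev 1 v + β * der1 v) * (α * ev 1 z + β * der1 z)) := by
  simp [fullEnergy, LinearMap.BilinForm.linMulLin_apply]

theorem fullEnergy_comm (α β : ℝ) (v z : H2) : fullEnergy α β v z = fullEnergy α β z v := by
  rw [fullEnergy_apply, fullEnergy_apply, energy_comm]; ring

/-- The sum of squares of the boundary data. -/
noncomputable def trace (v : H2) : ℝ := val0 v ^ 2 + der0 v ^ 2 + ev 1 v ^ 2 + der1 v ^ 2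

theorem energy_le_fullEnergy (α : ℝ) {β : ℝ} (hβ : 0 < β) (v : H2) :
    energy v v ≤ fullEnergy α β v v := by
  rw [fullEnergy_apply, add_assoc]
  have h1 := mul_nonneg (inv_nonneg.2 hβ.le) (mul_self_nonneg (β * der0 v - α * val0 v))
  have h2 := mul_nonneg (inv_nonneg.2 hβ.le) (mul_self_nonneg (α * ev 1 v + β * der1 v))
  linarith

theorem fullEnergy_le (α : ℝ) {β : ℝ} (hβ : 0 < β) (v : H2) :
    fullEnergy α β v v ≤ energy v v + β⁻¹ * (2 * (α ^ 2 + β ^ 2)) * trace v := by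
  rw [fullEnergy_apply, trace, add_assoc, ← mul_add, mul_assoc]
  refine add_le_add le_rfl (mul_le_mul_of_nonneg_left ?_ (inv_nonneg.2 hβ.le))
  nlinarith [sq_nonneg (β * val0 v + α * der0 v), sq_nonneg (β * der0 v),
    sq_nonneg (β * ev 1 v - α * der1 v), sq_nonneg (α * val0 v), sq_nonneg (β * val0 v),
    sq_nonneg (α * der0 v), sq_nonneg (α * ev 1 v), sq_nonneg (β * ev 1 v),
    sq_nonneg (α * der1 v), sq_nonneg (β * der1 v),
    sq_nonneg (α * val0 v + β * der0 v), sq_nonneg (α * ev 1 v - β * der1 v)]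

theorem trace_nonneg (v : H2) : 0 ≤ trace v := by unfold trace; positivity

theorem energy_self_nonneg (v : H2) : 0 ≤ energy v v := by rw [energy_self]; positivity

theorem norm_le (v : H2) : ‖v‖ ^ 2 ≤ val0 v ^ 2 + der0 v ^ 2 + ‖dd v‖ ^ 2 := by
  have h : ‖v‖ = max |val0 v| (max |der0 v| ‖dd v‖) := rfl
  rw [h, ← sq_abs (val0 v), ← sq_abs (der0 v)]
  have := sq_nonneg |val0 v|
  have := sq_nonneg |der0 v|
  have := sq_nonneg ‖dd v‖
  rcases max_cases |val0 v| (max |der0 v| ‖dd v‖) with ⟨h1, _⟩ | ⟨h1, _⟩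
  · rw [h1]; linarith
  · rcases max_cases |der0 v| ‖dd v‖ with ⟨h2, _⟩ | ⟨h2, _⟩ <;> rw [h1, h2] <;> linarith

theorem abs_val0_le (v : H2) : |val0 v| ≤ ‖v‖ := norm_fst_le v

theorem abs_der0_le (v : H2) : |der0 v| ≤ ‖v‖ := (norm_fst_le v.2).trans (norm_snd_le v)

theorem norm_dd_le (v : H2) : ‖dd v‖ ≤ ‖v‖ := (norm_snd_le v.2).trans (norm_snd_le v)

theorem abs_ev_le {x : ℝ} (hx : x ∈ Icc (0 : ℝ) 1) (v : H2) :
    |ev x v| ≤ |val0 v| + |der0 v| + ‖dd v‖ := by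
  rw [ev_apply]
  refine (abs_add_three _ _ _).trans (add_le_add (add_le_add le_rfl ?_) (abs_inner_ramp_le hx _))
  rw [abs_mul, abs_of_nonneg hx.1]
  exact mul_le_of_le_one_left (abs_nonneg _) hx.2

theorem abs_der1_le (v : H2) : |der1 v| ≤ |der0 v| + ‖dd v‖ := by
  rw [der1_apply]
  exact (abs_add_le _ _).trans (add_le_add le_rfl (abs_inner_one_le _))

theorem sq_ev_le {x : ℝ} (hx : x ∈ Icc (0 : ℝ) 1) (v : H2) :
    ev x v ^ 2 ≤ 3 * (val0 v ^ 2 + der0 v ^ 2 + ‖dd v‖ ^ 2) := by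
  have h := abs_ev_le hx v
  have h1 : ev x v ^ 2 ≤ (|val0 v| + |der0 v| + ‖dd v‖) ^ 2 := by
    rw [← sq_abs (ev x v)]; exact pow_le_pow_left₀ (abs_nonneg _) h 2
  rw [← sq_abs (val0 v), ← sq_abs (der0 v)]
  nlinarith [sq_nonneg (|val0 v| - |der0 v|), sq_nonneg (|val0 v| - ‖dd v‖),
    sq_nonneg (|der0 v| - ‖dd v‖)]

theorem trace_le (v : H2) : trace v ≤ 6 * (val0 v ^ 2 + der0 v ^ 2 + ‖dd v‖ ^ 2) := by
  have h1 := sq_ev_le (right_mem_Icc.2 zero_le_one) v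
  have h2 : der1 v ^ 2 ≤ (|der0 v| + ‖dd v‖) ^ 2 := by
    rw [← sq_abs (der1 v)]; exact pow_le_pow_left₀ (abs_nonneg _) (abs_der1_le v) 2
  have h3 : (|der0 v| + ‖dd v‖) ^ 2 ≤ 2 * (der0 v ^ 2 + ‖dd v‖ ^ 2) := by
    rw [← sq_abs (der0 v)]
    nlinarith [sq_nonneg (|der0 v| - ‖dd v‖)]
  unfold trace
  nlinarith [sq_nonneg (val0 v), sq_nonneg (der0 v), sq_nonneg ‖dd v‖]

theorem mass_self_le (μ : Measure ℝ) [IsProbabilityMeasure μ] (v : H2) :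
    mass μ v v ≤ 3 * (val0 v ^ 2 + der0 v ^ 2 + ‖dd v‖ ^ 2) := by
  set c := 3 * (val0 v ^ 2 + der0 v ^ 2 + ‖dd v‖ ^ 2) with hc
  have hc0 : 0 ≤ c := by positivity
  calc mass μ v v ≤ ∫ x in Icc 0 1, c ∂μ := by
        rw [mass_apply]
        refine setIntegral_mono_on ((continuous_ev v).mul (continuous_ev v)).integrableOn_Icc
          (integrable_const _) measurableSet_Icc fun x hx => ?_
        rw [← sq]; exact sq_ev_le hx v
    _ ≤ c := by
        rw [setIntegral_const, smul_eq_mul]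
        exact mul_le_of_le_one_left hc0 measureReal_le_one

theorem exists_mass_le_energy (μ : Measure ℝ) [IsProbabilityMeasure μ] {ε : ℝ} (hε : 0 < ε) :
    ∃ (n : ℕ) (l : H2 →ₗ[ℝ] (Fin n → ℝ)), ∀ v, l v = 0 → mass μ v v ≤ ε * energy v v := by
  obtain ⟨n, hn⟩ := exists_nat_gt (max 1 ε⁻¹)
  have hn1 : (1 : ℝ) < n := (le_max_left _ _).trans_lt hn
  have hn0 : (0 : ℝ) < n := by linarith
  have hn2 : ε⁻¹ < n := (le_max_right _ _).trans_lt hn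
  let l : H2 →ₗ[ℝ] (ℝ × (Fin (n + 1) → ℝ)) :=
    der0.prod (LinearMap.pi fun i => ev ((i : ℕ) / n : ℝ))
  let e : (ℝ × (Fin (n + 1) → ℝ)) ≃ₗ[ℝ] (Fin (1 + (n + 1)) → ℝ) :=
    LinearEquiv.ofFinrankEq _ _ (by simp)
  refine ⟨_, e.toLinearMap ∘ₗ l, fun v hv => ?_⟩
  have hl : l v = 0 := by simpa using hv
  have hd : der0 v = 0 := congrArg Prod.fst hl
  have he : ∀ i : Fin (n + 1), ev ((i : ℕ) / n : ℝ) v = 0 := fun i =>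
    congrFun (congrArg Prod.snd hl) i
  have hev : ∀ x ∈ Icc (0 : ℝ) 1, ev x v * ev x v ≤ ε * ‖dd v‖ ^ 2 := by
    intro x hx
    have hnx : 0 ≤ n * x := mul_nonneg hn0.le hx.1
    have hi : ⌊n * x⌋₊ < n + 1 := by
      rw [Nat.floor_lt hnx]
      push_cast
      nlinarith [hx.2]
    have h1 := abs_ev_sub_ev_le x ((⌊n * x⌋₊ : ℕ) / n : ℝ) v
    rw [he ⟨_, hi⟩, hd, sub_zero, abs_zero, zero_add] at h1
    have h2 : |x - (⌊n * x⌋₊ : ℕ) / n| ≤ 1 / n := by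
      have f1 := Nat.floor_le hnx
      have f2 := (Nat.lt_floor_add_one (n * x)).le
      rw [abs_le]
      constructor
      · rw [neg_le_sub_iff_le_add, ← sub_le_iff_le_add, ← sub_div, div_le_iff₀ hn0]
        linarith
      · rw [sub_le_iff_le_add, ← add_div, le_div_iff₀ hn0]
        linarith
    have h3 : |ev x v| ≤ 1 / n * ‖dd v‖ := h1.trans (mul_le_mul_of_nonneg_right h2 (norm_nonneg _))
    rw [← sq, ← sq_abs]
    calc |ev x v| ^ 2 ≤ (1 / n * ‖dd v‖) ^ 2 := pow_le_pow_left₀ (abs_nonneg _) h3 2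
      _ = (1 / n) ^ 2 * ‖dd v‖ ^ 2 := by ring
      _ ≤ ε * ‖dd v‖ ^ 2 := by
          refine mul_le_mul_of_nonneg_right ?_ (sq_nonneg _)
          have : 1 / (n : ℝ) < ε := by
            rw [one_div]; exact inv_lt_of_inv_lt₀ hε hn2
          have h5 : 1 / (n : ℝ) ≤ 1 := by rw [div_le_one hn0]; exact hn1.le
          have h6 : 0 < 1 / (n : ℝ) := by positivity
          nlinarith
  rw [mass_apply, energy_self]
  calc ∫ x in Icc 0 1, ev x v * ev x v ∂μ ≤ ∫ x in Icc 0 1, ε * ‖dd v‖ ^ 2 ∂μ :=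
        setIntegral_mono_on ((continuous_ev v).mul (continuous_ev v)).integrableOn_Icc
          (integrable_const _) measurableSet_Icc hev
    _ ≤ ε * ‖dd v‖ ^ 2 := by
        rw [setIntegral_const, smul_eq_mul]
        exact mul_le_of_le_one_left (by positivity) measureReal_le_one

theorem exists_coercive {F : ℝ → ℝ} {κ : ℕ} {a d : ℝ} (h : SelfSimilarCDF F κ a d)
    {μ : Measure ℝ} [IsProbabilityMeasure μ] [NullSingletonClass μ]
    (hμ : ∀ x, μ (Iic x) = ENNReal.ofReal (F x)) :
    ∃ C : ℝ, 0 < C ∧ ∀ v : H2, val0 v ^ 2 + der0 v ^ 2 + ‖dd v‖ ^ 2 ≤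
      C * (energy v v + mass μ v v) := by
  set M := ∫ x, x ∂μ with hM
  have i1 : Integrable (fun x : ℝ => x) μ := h.integrable hμ continuous_id
  have i2 : Integrable (fun x : ℝ => x ^ 2) μ := h.integrable hμ (continuous_pow 2)
  set S := ∫ x, x ^ 2 ∂μ with hS
  have hquad : ∀ A B C : ℝ, ∫ x, (A + B * x + C * x ^ 2) ∂μ = A + B * M + C * S := by
    intro A B C
    rw [integral_add (f := fun x => A + B * x) ((integrable_const _).add (i1.const_mul _))
      (i2.const_mul _), integral_add (integrable_const _) (i1.const_mul _), integral_const_mul,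
      integral_const_mul]
    simp [hM, hS]
  have hM01 : 0 ≤ M ∧ M ≤ 1 := by
    constructor
    · refine integral_nonneg_of_ae ?_
      filter_upwards [h.ae_mem_Icc hμ] with x hx using hx.1
    · have := integral_mono_ae i1 (integrable_const (1 : ℝ)) (by
        filter_upwards [h.ae_mem_Icc hμ] with x hx using hx.2)
      simpa using this
  have hVar : 0 < S - M ^ 2 := by
    have := h.integral_sq_sub_pos hμ M
    have e : ∫ x, (x - M) ^ 2 ∂μ = S - M ^ 2 := by
      have : ∀ x : ℝ, (x - M) ^ 2 = M ^ 2 + -(2 * M) * x + 1 * x ^ 2 := fun x => by ring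
      simp only [this]
      rw [hquad]; ring
    rwa [e] at this
  set R := S - M ^ 2 with hR
  refine ⟨6 * R⁻¹ + 5, by positivity, fun v => ?_⟩
  set p := val0 v
  set q := der0 v
  set E := energy v v + mass μ v v with hE
  have hmass : mass μ v v = ∫ x, ev x v * ev x v ∂μ := by
    rw [mass_apply, h.restrict_Icc hμ]
  have key : (p + q * M) ^ 2 + q ^ 2 * R ≤ 2 * E := by
    have e1 : ∫ x, (p + x * q) ^ 2 ∂μ = (p + q * M) ^ 2 + q ^ 2 * R := by
      have : ∀ x : ℝ, (p + x * q) ^ 2 = p ^ 2 + 2 * p * q * x + q ^ 2 * x ^ 2 := fun x => by ring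
      simp only [this]
      rw [hquad, hR]; ring
    rw [← e1, hE, hmass, energy_self]
    have i3 : Integrable (fun x => ev x v * ev x v) μ :=
      h.integrable hμ ((continuous_ev v).mul (continuous_ev v))
    calc ∫ x, (p + x * q) ^ 2 ∂μ ≤ ∫ x, (2 * ‖dd v‖ ^ 2 + 2 * (ev x v * ev x v)) ∂μ := by
          refine integral_mono_ae (h.integrable hμ (by fun_prop))
            ((integrable_const _).add (i3.const_mul _)) ?_
          filter_upwards [h.ae_mem_Icc hμ] with x hx
          have h1 := abs_inner_ramp_le hx (dd v)
          have h2 : ⟪rampL2 x, dd v⟫_ℝ ^ 2 ≤ ‖dd v‖ ^ 2 := by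
            rw [← sq_abs]; exact pow_le_pow_left₀ (abs_nonneg _) h1 2
          have h3 : p + x * q = ev x v - ⟪rampL2 x, dd v⟫_ℝ := by rw [ev_apply]; ring
          simp only [h3]
          nlinarith [sq_nonneg (ev x v + ⟪rampL2 x, dd v⟫_ℝ)]
      _ = _ := by
          rw [integral_add (integrable_const _) (i3.const_mul _), integral_const,
            integral_const_mul, probReal_univ, one_smul, mul_add]
  have hE0 : 0 ≤ E := add_nonneg (energy_self_nonneg v) (mass_self_nonneg μ v)
  have hq : q ^ 2 ≤ 2 * R⁻¹ * E := by
    have : q ^ 2 * R ≤ 2 * E := by linarith [sq_nonneg (p + q * M)]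
    rw [mul_assoc, mul_left_comm, inv_mul_eq_div, le_div_iff₀ hVar]
    exact this
  have hp : p ^ 2 ≤ 4 * E + 2 * q ^ 2 := by
    have : (p + q * M) ^ 2 ≤ 2 * E := by linarith [mul_nonneg (sq_nonneg q) hVar.le]
    have h4 : p ^ 2 ≤ 2 * (p + q * M) ^ 2 + 2 * (q * M) ^ 2 := by
      nlinarith [sq_nonneg (p + q * M + q * M)]
    have h5 : (q * M) ^ 2 ≤ q ^ 2 := by
      rw [mul_pow]
      exact mul_le_of_le_one_right (sq_nonneg _) (pow_le_one₀ hM01.1 hM01.2)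
    linarith
  have hw : ‖dd v‖ ^ 2 ≤ E := by
    rw [hE, energy_self]; linarith [mass_self_nonneg μ v]
  nlinarith

end H2

end Hilbert

section Bounded

open MeasureTheory

open scoped InnerProductSpace

/-- Bounded measurable functions on the line. -/
def BddMeas : Submodule ℝ (ℝ → ℝ) where
  carrier := {w | Measurable w ∧ ∃ C, ∀ x, |w x| ≤ C}
  add_mem' := fun {w w'} ⟨h, C, hC⟩ ⟨h', C', hC'⟩ =>
    ⟨h.add h', C + C', fun x => (abs_add_le _ _).trans (add_le_add (hC x) (hC' x))⟩
  zero_mem' := ⟨measurable_const, 0, fun _ => by simp⟩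
  smul_mem' := fun c w ⟨h, C, hC⟩ =>
    ⟨h.const_smul c, |c| * C, fun x => by
      simpa [abs_mul] using mul_le_mul_of_nonneg_left (hC x) (abs_nonneg c)⟩

namespace BddMeas

theorem measurable (w : BddMeas) : Measurable (w : ℝ → ℝ) := w.2.1

theorem exists_bound (w : BddMeas) : ∃ C, 0 ≤ C ∧ ∀ x, |(w : ℝ → ℝ) x| ≤ C := by
  obtain ⟨C, hC⟩ := w.2.2
  exact ⟨C, (abs_nonneg _).trans (hC 0), hC⟩

theorem intervalIntegrable_mul (w : BddMeas) {f : ℝ → ℝ} (hf : Continuous f) (x y : ℝ) :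
    IntervalIntegrable (fun t => f t * (w : ℝ → ℝ) t) volume x y := by
  obtain ⟨C, -, hC⟩ := BddMeas.exists_bound w
  rw [intervalIntegrable_iff]
  exact (intervalIntegrable_iff.1 (hf.intervalIntegrable x y)).mul_bdd (c := C)
    (BddMeas.measurable w).aestronglyMeasurable (Eventually.of_forall hC)

theorem intervalIntegrable (w : BddMeas) (x y : ℝ) :
    IntervalIntegrable (w : ℝ → ℝ) volume x y := by
  simpa using BddMeas.intervalIntegrable_mul w (f := fun _ => 1) continuous_const x y

theorem intervalIntegrable_mul_self (w z : BddMeas) (x y : ℝ) :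
    IntervalIntegrable (fun t => (w : ℝ → ℝ) t * (z : ℝ → ℝ) t) volume x y := by
  obtain ⟨C, -, hC⟩ := BddMeas.exists_bound z
  rw [intervalIntegrable_iff]
  exact (intervalIntegrable_iff.1 (BddMeas.intervalIntegrable w x y)).mul_bdd (c := C)
    (BddMeas.measurable z).aestronglyMeasurable (Eventually.of_forall hC)

/-- Affine substitution, scaling and restriction to a set. -/
noncomputable def piece {S : Set ℝ} (hS : MeasurableSet S) (c s r : ℝ) : BddMeas →ₗ[ℝ] BddMeas where
  toFun w := ⟨S.indicator fun x => c * (w : ℝ → ℝ) (s + r * x), by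
    refine ⟨(measurable_const.mul ((BddMeas.measurable w).comp (by fun_prop))).indicator hS, ?_⟩
    obtain ⟨C, hC0, hC⟩ := BddMeas.exists_bound w
    refine ⟨|c| * C, fun x => ?_⟩
    by_cases hx : x ∈ S
    · rw [indicator_of_mem hx, abs_mul]
      exact mul_le_mul_of_nonneg_left (hC _) (abs_nonneg c)
    · rw [indicator_of_notMem hx, abs_zero]; positivity⟩
  map_add' w w' := by
    ext x
    by_cases hx : x ∈ S <;> simp [hx, mul_add]
  map_smul' k w := by
    ext x
    by_cases hx : x ∈ S <;> simp [hx, mul_left_comm]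

theorem piece_apply_of_mem {S : Set ℝ} (hS : MeasurableSet S) (c s r : ℝ) (w : BddMeas) {x : ℝ}
    (hx : x ∈ S) : (piece hS c s r w : ℝ → ℝ) x = c * (w : ℝ → ℝ) (s + r * x) :=
  indicator_of_mem hx fun x => c * (w : ℝ → ℝ) (s + r * x)

theorem piece_apply_of_notMem {S : Set ℝ} (hS : MeasurableSet S) (c s r : ℝ) (w : BddMeas) {x : ℝ}
    (hx : x ∉ S) : (piece hS c s r w : ℝ → ℝ) x = 0 :=
  indicator_of_notMem hx fun x => c * (w : ℝ → ℝ) (s + r * x)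

theorem memLp (w : BddMeas) : MemLp (w : ℝ → ℝ) 2 (volume.restrict (Icc (0 : ℝ) 1)) :=
  memLp_two_of_bounded (BddMeas.measurable w) fun t _ => (BddMeas.exists_bound w).choose_spec.2 t

/-- The class in `L²(0,1)`. -/
noncomputable def toL2 : BddMeas →ₗ[ℝ] L2I where
  toFun w := (memLp w).toLp _
  map_add' _ _ := rfl
  map_smul' _ _ := rfl

theorem toL2_eq (w : BddMeas) : toL2 w = (BddMeas.memLp w).toLp _ := rfl

theorem inner_toL2 (w z : BddMeas) :
    ⟪toL2 w, toL2 z⟫_ℝ = ∫ t in (0 : ℝ)..1, (w : ℝ → ℝ) t * (z : ℝ → ℝ) t :=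
  L2I.inner_toLp (memLp w) (memLp z)

end BddMeas

/-- Functions with bounded measurable second derivative, encoded by the value at `0`,
the derivative at `0` and the second derivative. -/
abbrev H2b : Type := ℝ × ℝ × BddMeas

namespace H2b

/-- The second derivative. -/
def dd (u : H2b) : ℝ → ℝ := u.2.2

/-- The value at `x`. -/
noncomputable def val (x : ℝ) : H2b →ₗ[ℝ] ℝ where
  toFun u := u.1 + u.2.1 * x + ∫ t in (0 : ℝ)..x, (x - t) * u.dd t
  map_add' u v := by
    have : ∫ t in (0 : ℝ)..x, (x - t) * dd (u + v) t =
        (∫ t in (0 : ℝ)..x, (x - t) * u.dd t) + ∫ t in (0 : ℝ)..x, (x - t) * v.dd t := by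
      rw [← intervalIntegral.integral_add]
      · simp [dd, mul_add]
      · exact BddMeas.intervalIntegrable_mul u.2.2 (by fun_prop) _ _
      · exact BddMeas.intervalIntegrable_mul v.2.2 (by fun_prop) _ _
    simp only [this, Prod.fst_add, Prod.snd_add]
    ring
  map_smul' c u := by
    have : ∫ t in (0 : ℝ)..x, (x - t) * dd (c • u) t =
        c * ∫ t in (0 : ℝ)..x, (x - t) * u.dd t := by
      rw [← intervalIntegral.integral_const_mul]
      simp [dd, mul_left_comm]
    simp only [this, Prod.smul_fst, Prod.smul_snd, smul_eq_mul, RingHom.id_apply]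
    ring

/-- The derivative at `x`. -/
noncomputable def der (x : ℝ) : H2b →ₗ[ℝ] ℝ where
  toFun u := u.2.1 + ∫ t in (0 : ℝ)..x, u.dd t
  map_add' u v := by
    have : ∫ t in (0 : ℝ)..x, dd (u + v) t =
        (∫ t in (0 : ℝ)..x, u.dd t) + ∫ t in (0 : ℝ)..x, v.dd t :=
      intervalIntegral.integral_add (BddMeas.intervalIntegrable u.2.2 _ _)
        (BddMeas.intervalIntegrable v.2.2 _ _)
    simp only [this, Prod.fst_add, Prod.snd_add]
    ring
  map_smul' c u := by
    have : ∫ t in (0 : ℝ)..x, dd (c • u) t = c * ∫ t in (0 : ℝ)..x, u.dd t := by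
      rw [← intervalIntegral.integral_const_mul]
      simp [dd]
    simp only [this, Prod.smul_fst, Prod.smul_snd, smul_eq_mul, RingHom.id_apply]
    ring

theorem val_apply (x : ℝ) (u : H2b) :
    val x u = u.1 + u.2.1 * x + ∫ t in (0 : ℝ)..x, (x - t) * u.dd t := rfl

theorem der_apply (x : ℝ) (u : H2b) : der x u = u.2.1 + ∫ t in (0 : ℝ)..x, u.dd t := rfl

@[simp] theorem val_zero (u : H2b) : val 0 u = u.1 := by simp [val_apply]

@[simp] theorem der_zero (u : H2b) : der 0 u = u.2.1 := by simp [der_apply]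

theorem der_eq (u : H2b) (x y : ℝ) : der y u = der x u + ∫ t in x..y, u.dd t := by
  have h : (∫ t in (0 : ℝ)..x, u.dd t) + ∫ t in x..y, u.dd t = ∫ t in (0 : ℝ)..y, u.dd t :=
    intervalIntegral.integral_add_adjacent_intervals
      (BddMeas.intervalIntegrable u.2.2 _ _) (BddMeas.intervalIntegrable u.2.2 _ _)
  rw [der_apply, der_apply, add_assoc, h]

/-- Taylor's formula with integral remainder. -/
theorem val_eq (u : H2b) (x y : ℝ) :
    val y u = val x u + (y - x) * der x u + ∫ t in x..y, (y - t) * u.dd t := by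
  have h1 : ∫ t in (0 : ℝ)..y, (y - t) * u.dd t =
      (∫ t in (0 : ℝ)..x, (y - t) * u.dd t) + ∫ t in x..y, (y - t) * u.dd t :=
    (intervalIntegral.integral_add_adjacent_intervals
      (BddMeas.intervalIntegrable_mul u.2.2 (by fun_prop) _ _)
      (BddMeas.intervalIntegrable_mul u.2.2 (by fun_prop) _ _)).symm
  have h2 : ∫ t in (0 : ℝ)..x, (y - t) * u.dd t =
      (∫ t in (0 : ℝ)..x, (x - t) * u.dd t) + (y - x) * ∫ t in (0 : ℝ)..x, u.dd t := by
    rw [← intervalIntegral.integral_const_mul, ← intervalIntegral.integral_add]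
    · refine intervalIntegral.integral_congr fun t _ => ?_
      ring
    · exact BddMeas.intervalIntegrable_mul u.2.2 (by fun_prop) _ _
    · exact BddMeas.intervalIntegrable_mul u.2.2 (by fun_prop) _ _
  rw [val_apply, val_apply, der_apply, h1, h2]
  ring

theorem continuous_der (u : H2b) : Continuous fun x => der x u := by
  simp only [der_apply]
  exact continuous_const.add
    (intervalIntegral.continuous_primitive (fun x y => BddMeas.intervalIntegrable u.2.2 x y) 0)

theorem hasDerivAt_val (u : H2b) (x : ℝ) : HasDerivAt (fun x => val x u) (der x u) x := by
  obtain ⟨C, hC0, hC⟩ := BddMeas.exists_bound u.2.2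
  rw [hasDerivAt_iff_isLittleO]
  have hO : (fun y => val y u - val x u - (y - x) • der x u) =O[nhds x]
      fun y => |y - x| ^ 2 := by
    refine Asymptotics.IsBigO.of_bound C (Eventually.of_forall fun y => ?_)
    have e : val y u - val x u - (y - x) • der x u = ∫ t in x..y, (y - t) * u.dd t := by
      rw [val_eq u x y, smul_eq_mul]; ring
    rw [e]
    have := intervalIntegral.norm_integral_le_of_norm_le_const (a := x) (b := y)
      (f := fun t => (y - t) * u.dd t) (C := |y - x| * C) fun t ht => ?_
    · refine this.trans (le_of_eq ?_)
      rw [Real.norm_eq_abs, abs_pow, abs_abs]; ring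
    · rw [norm_mul]
      refine mul_le_mul ?_ (hC t) (norm_nonneg _) (abs_nonneg _)
      rw [Real.norm_eq_abs, abs_sub_comm y t, abs_sub_comm y x]
      exact abs_sub_left_of_mem_uIcc (by
        rw [uIcc_comm]; exact uIoc_subset_uIcc ht)
  refine hO.trans_isLittleO ?_
  simpa using (Asymptotics.isLittleO_pow_sub_sub x (one_lt_two)).norm_left

theorem continuous_val (u : H2b) : Continuous fun x => val x u :=
  continuous_iff_continuousAt.2 fun x => (hasDerivAt_val u x).continuousAt

/-- The embedding into `H2`. -/
noncomputable def toH2 : H2b →ₗ[ℝ] H2 :=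
  LinearMap.prodMap LinearMap.id (LinearMap.prodMap LinearMap.id BddMeas.toL2)

@[simp] theorem val0_toH2 (u : H2b) : H2.val0 (toH2 u) = u.1 := rfl

@[simp] theorem der0_toH2 (u : H2b) : H2.der0 (toH2 u) = u.2.1 := rfl

@[simp] theorem dd_toH2 (u : H2b) : H2.dd (toH2 u) = BddMeas.toL2 u.2.2 := rfl

theorem ev_toH2 (u : H2b) {x : ℝ} (hx : x ∈ Icc (0 : ℝ) 1) : H2.ev x (toH2 u) = val x u := by
  rw [H2.ev_apply, val0_toH2, der0_toH2, dd_toH2, BddMeas.toL2_eq, rampL2, L2I.inner_toLp,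
    val_apply, mul_comm x]
  congr 1
  have hi : ∀ s t, IntervalIntegrable (fun t => max (x - t) 0 * u.dd t) volume s t := fun s t =>
    BddMeas.intervalIntegrable_mul u.2.2 (by fun_prop) _ _
  change ∫ t in (0 : ℝ)..1, max (x - t) 0 * u.dd t = _
  rw [← intervalIntegral.integral_add_adjacent_intervals (hi 0 x) (hi x 1)]
  have h1 : ∫ t in (0 : ℝ)..x, max (x - t) 0 * u.dd t = ∫ t in (0 : ℝ)..x, (x - t) * u.dd t := by
    refine intervalIntegral.integral_congr fun t ht => ?_
    rw [uIcc_of_le hx.1] at ht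
    simp only [max_eq_left (sub_nonneg.2 ht.2)]
  have h2 : ∫ t in x..1, max (x - t) 0 * u.dd t = ∫ t in x..1, (0 : ℝ) := by
    refine intervalIntegral.integral_congr fun t ht => ?_
    rw [uIcc_of_le hx.2] at ht
    simp only [max_eq_right (sub_nonpos.2 ht.1), zero_mul]
  rw [h1, h2]
  simp

theorem der1_toH2 (u : H2b) : H2.der1 (toH2 u) = der 1 u := by
  rw [H2.der1_apply, der0_toH2, dd_toH2, BddMeas.toL2_eq, oneL2, L2I.inner_toLp, der_apply]
  simp [dd]

theorem energy_toH2 (u v : H2b) :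
    H2.energy (toH2 u) (toH2 v) = ∫ t in (0 : ℝ)..1, u.dd t * v.dd t :=
  BddMeas.inner_toL2 _ _

theorem mass_toH2 (μ : Measure ℝ) [IsFiniteMeasure μ] (u v : H2b) :
    H2.mass μ (toH2 u) (toH2 v) = ∫ x in Icc 0 1, val x u * val x v ∂μ := by
  rw [H2.mass_apply]
  refine setIntegral_congr_fun measurableSet_Icc fun x hx => ?_
  simp only [ev_toH2 _ hx]

theorem trace_toH2 (u : H2b) : H2.trace (toH2 u) =
    val 0 u ^ 2 + der 0 u ^ 2 + val 1 u ^ 2 + der 1 u ^ 2 := by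
  rw [H2.trace, ev_toH2 u (right_mem_Icc.2 zero_le_one), der1_toH2]
  simp

end H2b

end Bounded

section Cells

open MeasureTheory

/-- The function `(x - 1) ^ n` cut off to `(1, 1 + l]`. -/
noncomputable def BddMeas.cut (l : ℝ) (n : ℕ) : BddMeas :=
  ⟨(Ioc 1 (1 + l)).indicator fun x => (x - 1) ^ n, by
    refine ⟨Measurable.indicator (by fun_prop) measurableSet_Ioc, |l| ^ n, fun x => ?_⟩
    by_cases hx : x ∈ Ioc 1 (1 + l)
    · rw [indicator_of_mem hx, abs_pow]
      refine pow_le_pow_left₀ (abs_nonneg _) ?_ n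
      rw [abs_of_pos (by linarith [hx.1])]
      exact (by linarith [hx.2] : x - 1 ≤ l).trans (le_abs_self l)
    · rw [indicator_of_notMem hx, abs_zero]; positivity⟩

theorem BddMeas.cut_apply_of_mem {l : ℝ} (n : ℕ) {x : ℝ} (hx : x ∈ Ioc 1 (1 + l)) :
    (cut l n : ℝ → ℝ) x = (x - 1) ^ n :=
  indicator_of_mem hx fun x => (x - 1) ^ n

theorem BddMeas.cut_apply_of_notMem {l : ℝ} (n : ℕ) {x : ℝ} (hx : x ∉ Ioc 1 (1 + l)) :
    (cut l n : ℝ → ℝ) x = 0 :=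
  indicator_of_notMem hx fun x => (x - 1) ^ n

namespace H2b

theorem dd_mul_intervalIntegrable (u v : H2b) (x y : ℝ) :
    IntervalIntegrable (fun t => dd u t * dd v t) volume x y :=
  BddMeas.intervalIntegrable_mul_self _ _ _ _

/-- Precomposition with `x ↦ s + r * x`. -/
noncomputable def comp (s r : ℝ) : H2b →ₗ[ℝ] H2b :=
  (val s).prod ((r • der s).prod
    (BddMeas.piece MeasurableSet.univ (r ^ 2) s r ∘ₗ LinearMap.snd ℝ ℝ BddMeas ∘ₗ
      LinearMap.snd ℝ ℝ (ℝ × BddMeas)))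

theorem dd_comp (s r : ℝ) (u : H2b) (x : ℝ) : dd (comp s r u) x = r ^ 2 * dd u (s + r * x) :=
  BddMeas.piece_apply_of_mem MeasurableSet.univ _ _ _ _ (mem_univ x)

theorem comp_fst (s r : ℝ) (u : H2b) : (comp s r u).1 = val s u := rfl

theorem comp_snd_fst (s r : ℝ) (u : H2b) : (comp s r u).2.1 = r * der s u := rfl

theorem val_comp (s r : ℝ) (u : H2b) (x : ℝ) : val x (comp s r u) = val (s + r * x) u := by
  have h := intervalIntegral.mul_integral_comp_add_mul (a := 0) (b := x)
    (f := fun t => (s + r * x - t) * dd u t) r s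
  rw [val_eq u s (s + r * x), val_apply, comp_fst, comp_snd_fst]
  simp only [mul_zero, add_zero] at h
  rw [← h, ← intervalIntegral.integral_const_mul]
  simp only [dd_comp]
  have : ∀ t, r * ((s + r * x - (s + r * t)) * dd u (s + r * t)) =
      (x - t) * (r ^ 2 * dd u (s + r * t)) := fun t => by ring
  simp only [this]
  ring

theorem der_comp (s r : ℝ) (u : H2b) (x : ℝ) : der x (comp s r u) = r * der (s + r * x) u := by
  have h := intervalIntegral.mul_integral_comp_add_mul (a := 0) (b := x) (f := fun t => dd u t) r s
  rw [der_eq u s (s + r * x), der_apply, comp_snd_fst]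
  simp only [mul_zero, add_zero] at h
  rw [← h, mul_add, ← intervalIntegral.integral_const_mul, ← intervalIntegral.integral_const_mul]
  simp only [dd_comp]
  have : ∀ t, r * (r * dd u (s + r * t)) = r ^ 2 * dd u (s + r * t) := fun t => by ring
  simp only [this]

theorem integral_dd_comp (s r : ℝ) (u : H2b) (x : ℝ) :
    ∫ t in (0 : ℝ)..x, dd (comp s r u) t * dd (comp s r u) t =
      r ^ 3 * ∫ t in s..(s + r * x), dd u t * dd u t := by
  have h := intervalIntegral.mul_integral_comp_add_mul (a := 0) (b := x)
    (f := fun t => dd u t * dd u t) r s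
  simp only [mul_zero, add_zero] at h
  rw [← h, ← intervalIntegral.integral_const_mul, ← intervalIntegral.integral_const_mul]
  refine intervalIntegral.integral_congr fun t _ => ?_
  simp only [dd_comp]
  ring

theorem val_congr {u v : H2b} (h1 : u.1 = v.1) (h2 : u.2.1 = v.2.1) {T : ℝ}
    (h : ∀ t ∈ Ico 0 T, dd u t = dd v t) {x : ℝ} (hx : x ∈ Icc 0 T) : val x u = val x v := by
  rw [val_apply, val_apply, h1, h2]
  congr 1
  refine intervalIntegral.integral_congr_ae ?_
  filter_upwards [Measure.ae_ne volume T] with t ht htx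
  rw [uIoc_of_le hx.1] at htx
  rw [h t ⟨htx.1.le, lt_of_le_of_ne (htx.2.trans hx.2) ht⟩]

theorem der_congr {u v : H2b} (h2 : u.2.1 = v.2.1) {T : ℝ}
    (h : ∀ t ∈ Ico 0 T, dd u t = dd v t) {x : ℝ} (hx : x ∈ Icc 0 T) : der x u = der x v := by
  rw [der_apply, der_apply, h2]
  congr 1
  refine intervalIntegral.integral_congr_ae ?_
  filter_upwards [Measure.ae_ne volume T] with t ht htx
  rw [uIoc_of_le hx.1] at htx
  rw [h t ⟨htx.1.le, lt_of_le_of_ne (htx.2.trans hx.2) ht⟩]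

/-- Extension from `[0,1]` to `[0,1+l]` by a cubic polynomial matching the data of the second
function at its left end. -/
noncomputable def ext (l : ℝ) : H2b × H2b →ₗ[ℝ] H2b :=
  let A := val 1 ∘ₗ LinearMap.fst ℝ H2b H2b
  let A' := der 1 ∘ₗ LinearMap.fst ℝ H2b H2b
  let B := val 0 ∘ₗ LinearMap.snd ℝ H2b H2b
  let B' := der 0 ∘ₗ LinearMap.snd ℝ H2b H2b
  (val 0 ∘ₗ LinearMap.fst ℝ H2b H2b).prod ((der 0 ∘ₗ LinearMap.fst ℝ H2b H2b).prod
    (BddMeas.piece (measurableSet_Iic (a := (1 : ℝ))) 1 0 1 ∘ₗ LinearMap.snd ℝ ℝ BddMeas ∘ₗ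
      LinearMap.snd ℝ ℝ (ℝ × BddMeas) ∘ₗ LinearMap.fst ℝ H2b H2b +
    ((6 / l ^ 2) • B - (6 / l ^ 2) • A - (4 / l) • A' - (2 / l) • B').smulRight
      (BddMeas.cut l 0) +
    ((12 / l ^ 3) • A - (12 / l ^ 3) • B + (6 / l ^ 2) • A' + (6 / l ^ 2) • B').smulRight
      (BddMeas.cut l 1)))

theorem ext_fst (l : ℝ) (u u' : H2b) : (ext l (u, u')).1 = u.1 := by simp [ext]

theorem ext_snd_fst (l : ℝ) (u u' : H2b) : (ext l (u, u')).2.1 = u.2.1 := by simp [ext]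

theorem dd_ext_of_le (l : ℝ) (u u' : H2b) {x : ℝ} (hx : x ≤ 1) :
    dd (ext l (u, u')) x = dd u x := by
  have hx' : x ∉ Ioc 1 (1 + l) := fun h => absurd h.1 (not_lt.2 hx)
  simp [ext, dd, BddMeas.cut_apply_of_notMem _ hx',
    BddMeas.piece_apply_of_mem measurableSet_Iic _ _ _ _ (mem_Iic.2 hx)]

theorem dd_ext_of_mem (l : ℝ) (u u' : H2b) {x : ℝ} (hx : x ∈ Ioc 1 (1 + l)) :
    dd (ext l (u, u')) x =
      (6 / l ^ 2 * val 0 u' - 6 / l ^ 2 * val 1 u - 4 / l * der 1 u - 2 / l * der 0 u') +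
      (12 / l ^ 3 * val 1 u - 12 / l ^ 3 * val 0 u' + 6 / l ^ 2 * der 1 u + 6 / l ^ 2 * der 0 u') *
        (x - 1) := by
  have hx' : x ∉ Iic (1 : ℝ) := fun h => absurd hx.1 (not_lt.2 h)
  simp [ext, dd, BddMeas.cut_apply_of_mem _ hx,
    BddMeas.piece_apply_of_notMem measurableSet_Iic _ _ _ _ hx']

theorem val_ext (l : ℝ) (u u' : H2b) {x : ℝ} (hx : x ∈ Icc (0 : ℝ) 1) :
    val x (ext l (u, u')) = val x u :=
  val_congr (ext_fst l u u') (ext_snd_fst l u u') (fun _ ht => dd_ext_of_le l u u' ht.2.le) hx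

theorem der_ext (l : ℝ) (u u' : H2b) {x : ℝ} (hx : x ∈ Icc (0 : ℝ) 1) :
    der x (ext l (u, u')) = der x u :=
  der_congr (ext_snd_fst l u u') (fun _ ht => dd_ext_of_le l u u' ht.2.le) hx

theorem integral_dd_ext {l : ℝ} (hl : 0 < l) (u u' : H2b) (g : ℝ → ℝ → ℝ) :
    ∫ t in (1 : ℝ)..(1 + l), g t (dd (ext l (u, u')) t) = ∫ t in (1 : ℝ)..(1 + l), g t
      ((6 / l ^ 2 * val 0 u' - 6 / l ^ 2 * val 1 u - 4 / l * der 1 u - 2 / l * der 0 u') +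
      (12 / l ^ 3 * val 1 u - 12 / l ^ 3 * val 0 u' + 6 / l ^ 2 * der 1 u + 6 / l ^ 2 * der 0 u') *
        (t - 1)) := by
  refine intervalIntegral.integral_congr_ae (Eventually.of_forall fun t ht => ?_)
  rw [uIoc_of_le (by linarith)] at ht
  rw [dd_ext_of_mem l u u' ht]

theorem integral_quadratic (l p q r : ℝ) :
    ∫ t in (1 : ℝ)..(1 + l), (p + q * (t - 1) + r * (t - 1) ^ 2) =
      p * l + q * (l ^ 2 / 2) + r * (l ^ 3 / 3) := by
  have h : ∀ t ∈ uIcc (1 : ℝ) (1 + l), HasDerivAt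
      (fun t : ℝ => p * (t - 1) + q * ((t - 1) ^ 2 / 2) + r * ((t - 1) ^ 3 / 3))
      (p + q * (t - 1) + r * (t - 1) ^ 2) t := by
    intro t _
    have h0 : HasDerivAt (fun t : ℝ => t - 1) 1 t := (hasDerivAt_id t).sub_const 1
    refine (((h0.const_mul p).fun_add (((h0.fun_pow 2).div_const 2).const_mul q)).fun_add
      (((h0.fun_pow 3).div_const 3).const_mul r)).congr_deriv ?_
    push_cast
    ring
  rw [intervalIntegral.integral_eq_sub_of_hasDerivAt h
    (Continuous.intervalIntegrable (by fun_prop) _ _)]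
  ring

theorem der_ext_right {l : ℝ} (hl : 0 < l) (u u' : H2b) :
    der (1 + l) (ext l (u, u')) = der 0 u' := by
  rw [der_eq _ 1, der_ext l u u' (right_mem_Icc.2 zero_le_one),
    integral_dd_ext hl u u' fun _ w => w]
  have := integral_quadratic l
    (6 / l ^ 2 * val 0 u' - 6 / l ^ 2 * val 1 u - 4 / l * der 1 u - 2 / l * der 0 u')
    (12 / l ^ 3 * val 1 u - 12 / l ^ 3 * val 0 u' + 6 / l ^ 2 * der 1 u + 6 / l ^ 2 * der 0 u') 0
  simp only [zero_mul, add_zero] at this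
  rw [this]
  field_simp
  ring

theorem val_ext_right {l : ℝ} (hl : 0 < l) (u u' : H2b) :
    val (1 + l) (ext l (u, u')) = val 0 u' := by
  rw [val_eq _ 1, val_ext l u u' (right_mem_Icc.2 zero_le_one),
    der_ext l u u' (right_mem_Icc.2 zero_le_one),
    integral_dd_ext hl u u' fun t w => (1 + l - t) * w]
  set p := 6 / l ^ 2 * val 0 u' - 6 / l ^ 2 * val 1 u - 4 / l * der 1 u - 2 / l * der 0 u' with hp
  set q := 12 / l ^ 3 * val 1 u - 12 / l ^ 3 * val 0 u' + 6 / l ^ 2 * der 1 u +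
    6 / l ^ 2 * der 0 u' with hq
  have := integral_quadratic l (l * p) (l * q - p) (-q)
  have e : ∀ t, (1 + l - t) * (p + q * (t - 1)) =
      l * p + (l * q - p) * (t - 1) + -q * (t - 1) ^ 2 := fun t => by ring
  simp only [e]
  rw [this, hp, hq]
  field_simp
  ring

theorem exists_integral_sq_ext_le {l : ℝ} (hl : 0 < l) : ∃ C, 0 ≤ C ∧ ∀ u u' : H2b,
    ∫ t in (1 : ℝ)..(1 + l), dd (ext l (u, u')) t * dd (ext l (u, u')) t ≤
      C * (val 1 u ^ 2 + der 1 u ^ 2 + (val 0 u' ^ 2 + der 0 u' ^ 2)) := by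
  have cs : ∀ p q r s A B A' B' : ℝ, (p * B + q * A + r * A' + s * B') ^ 2 ≤
      4 * (p ^ 2 + q ^ 2 + r ^ 2 + s ^ 2) * (A ^ 2 + A' ^ 2 + (B ^ 2 + B' ^ 2)) := by
    intro p q r s A B A' B'
    have h1 : (p * B + q * A + r * A' + s * B') ^ 2 ≤
        4 * ((p * B) ^ 2 + (q * A) ^ 2 + (r * A') ^ 2 + (s * B') ^ 2) := by
      nlinarith [sq_nonneg (p * B - q * A), sq_nonneg (p * B - r * A'), sq_nonneg (p * B - s * B'),
        sq_nonneg (q * A - r * A'), sq_nonneg (q * A - s * B'), sq_nonneg (r * A' - s * B')]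
    have h3 : ∀ x z : ℝ, x ^ 2 ≤ A ^ 2 + A' ^ 2 + (B ^ 2 + B' ^ 2) →
        (z * x) ^ 2 ≤ z ^ 2 * (A ^ 2 + A' ^ 2 + (B ^ 2 + B' ^ 2)) := fun x z h => by
      rw [mul_pow]; exact mul_le_mul_of_nonneg_left h (sq_nonneg z)
    have := h3 B p (by nlinarith)
    have := h3 A q (by nlinarith)
    have := h3 A' r (by nlinarith)
    have := h3 B' s (by nlinarith)
    linarith
  set c := 4 * ((6 / l ^ 2) ^ 2 + (-(6 / l ^ 2)) ^ 2 + (-(4 / l)) ^ 2 + (-(2 / l)) ^ 2) with hc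
  set c' :=
    4 * ((-(12 / l ^ 3)) ^ 2 + (12 / l ^ 3) ^ 2 + (6 / l ^ 2) ^ 2 + (6 / l ^ 2) ^ 2) with hc'
  refine ⟨2 * l * c + l ^ 3 * c', by positivity, fun u u' => ?_⟩
  rw [integral_dd_ext hl u u' fun _ w => w * w]
  have h1 := cs (6 / l ^ 2) (-(6 / l ^ 2)) (-(4 / l)) (-(2 / l))
    (val 1 u) (val 0 u') (der 1 u) (der 0 u')
  have h2 := cs (-(12 / l ^ 3)) (12 / l ^ 3) (6 / l ^ 2) (6 / l ^ 2)
    (val 1 u) (val 0 u') (der 1 u) (der 0 u')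
  rw [← hc] at h1
  rw [← hc'] at h2
  set T := val 1 u ^ 2 + der 1 u ^ 2 + (val 0 u' ^ 2 + der 0 u' ^ 2)
  set p := 6 / l ^ 2 * val 0 u' - 6 / l ^ 2 * val 1 u - 4 / l * der 1 u - 2 / l * der 0 u' with hp
  set q := 12 / l ^ 3 * val 1 u - 12 / l ^ 3 * val 0 u' + 6 / l ^ 2 * der 1 u +
    6 / l ^ 2 * der 0 u' with hq
  have h1' : p ^ 2 ≤ c * T := by refine le_trans (le_of_eq ?_) h1; rw [hp]; ring
  have h2' : q ^ 2 ≤ c' * T := by refine le_trans (le_of_eq ?_) h2; rw [hq]; ring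
  have e : ∀ t, (p + q * (t - 1)) * (p + q * (t - 1)) =
      p ^ 2 + (2 * p * q) * (t - 1) + q ^ 2 * (t - 1) ^ 2 := fun t => by ring
  simp only [e]
  rw [integral_quadratic]
  have h3 : p ^ 2 * l + 2 * p * q * (l ^ 2 / 2) + q ^ 2 * (l ^ 3 / 3) ≤
      2 * l * p ^ 2 + l ^ 3 * q ^ 2 := by
    have : 0 ≤ l * (p - q * l / 2) ^ 2 := by positivity
    have : 0 ≤ l ^ 3 * q ^ 2 := by positivity
    nlinarith
  have h4 : 2 * l * p ^ 2 ≤ 2 * l * (c * T) := by gcongr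
  have h5 : l ^ 3 * q ^ 2 ≤ l ^ 3 * (c' * T) := by gcongr
  linarith

end H2b

end Cells

section Glue

open MeasureTheory

namespace H2b

/-- The bending energy over an interval. -/
noncomputable def bend (s t : ℝ) (u : H2b) : ℝ := ∫ x in s..t, dd u x * dd u x

/-- The squared boundary data at a point. -/
noncomputable def bdry (x : ℝ) (u : H2b) : ℝ := val x u ^ 2 + der x u ^ 2

/-- The squared norm in `L²(μ)`. -/
noncomputable def msq (μ : Measure ℝ) (u : H2b) : ℝ := ∫ x, val x u * val x u ∂μ

theorem bdry_nonneg (x : ℝ) (u : H2b) : 0 ≤ bdry x u := by unfold bdry; positivity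

theorem msq_nonneg (μ : Measure ℝ) (u : H2b) : 0 ≤ msq μ u :=
  integral_nonneg fun _ => mul_self_nonneg _

theorem bend_nonneg {s t : ℝ} (hst : s ≤ t) (u : H2b) : 0 ≤ bend s t u :=
  intervalIntegral.integral_nonneg hst fun _ _ => mul_self_nonneg _

theorem bend_add_bend (r s t : ℝ) (u : H2b) : bend r s u + bend s t u = bend r t u :=
  intervalIntegral.integral_add_adjacent_intervals (dd_mul_intervalIntegrable u u r s)
    (dd_mul_intervalIntegrable u u s t)

theorem bend_comp (s r : ℝ) (u : H2b) (x : ℝ) :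
    bend 0 x (comp s r u) = r ^ 3 * bend s (s + r * x) u :=
  integral_dd_comp s r u x

theorem bend_congr {u v : H2b} {T : ℝ} (hT : 0 ≤ T) (h : ∀ t ∈ Ico 0 T, dd u t = dd v t) :
    bend 0 T u = bend 0 T v := by
  refine intervalIntegral.integral_congr_ae ?_
  filter_upwards [Measure.ae_ne volume T] with t ht htx
  rw [uIoc_of_le hT] at htx
  rw [h t ⟨htx.1.le, lt_of_le_of_ne htx.2 ht⟩]

/-- Gluing a sequence of functions on the cells `[j * d, j * d + a]`, `j < κ`, filling the gaps
with cubic polynomials. -/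
noncomputable def glue (κ : ℕ) (a d : ℝ) : (ℕ → H2b) →ₗ[ℝ] H2b :=
  (val 0 ∘ₗ LinearMap.proj 0).prod ((a⁻¹ • der 0 ∘ₗ LinearMap.proj 0).prod
    (∑ j ∈ Finset.range κ,
      BddMeas.piece (measurableSet_Ico (a := (j * d : ℝ)) (b := ((j + 1 : ℕ) * d : ℝ)))
        (a⁻¹ ^ 2) (-(j * d) * a⁻¹) a⁻¹ ∘ₗ LinearMap.snd ℝ ℝ BddMeas ∘ₗ
          LinearMap.snd ℝ ℝ (ℝ × BddMeas) ∘ₗ ext ((d - a) / a) ∘ₗ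
            (LinearMap.proj j).prod (LinearMap.proj (j + 1))))

variable {κ : ℕ} {a d : ℝ}

theorem glue_fst (u : ℕ → H2b) : (glue κ a d u).1 = val 0 (u 0) := by simp [glue]

theorem glue_snd_fst (u : ℕ → H2b) : (glue κ a d u).2.1 = a⁻¹ * der 0 (u 0) := by simp [glue]

theorem dd_glue (ha : 0 < a) (had : a < d) (u : ℕ → H2b) {j : ℕ} (hj : j < κ) {t : ℝ}
    (ht : t ∈ Ico 0 (1 + (d - a) / a)) :
    a ^ 2 * dd (glue κ a d u) (j * d + a * t) = dd (ext ((d - a) / a) (u j, u (j + 1))) t := by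
  have hd : 0 < d := ha.trans had
  have ht2 : a * t < d := by
    have := mul_lt_mul_of_pos_left ht.2 ha
    have e : a * (1 + (d - a) / a) = d := by field_simp; ring
    rwa [e] at this
  have hmem : (j * d + a * t : ℝ) ∈ Ico (j * d : ℝ) ((j + 1 : ℕ) * d) :=
    ⟨by nlinarith [ht.1], by push_cast; linarith⟩
  have hdd : dd (glue κ a d u) (j * d + a * t) = ∑ i ∈ Finset.range κ,
      (BddMeas.piece (measurableSet_Ico (a := (i * d : ℝ)) (b := ((i + 1 : ℕ) * d : ℝ)))
        (a⁻¹ ^ 2) (-(i * d) * a⁻¹) a⁻¹ (ext ((d - a) / a) (u i, u (i + 1))).2.2 : ℝ → ℝ)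
          (j * d + a * t) := by
    simp [dd, glue, Finset.sum_apply]
  rw [hdd, Finset.sum_eq_single_of_mem j (Finset.mem_range.2 hj),
    BddMeas.piece_apply_of_mem _ _ _ _ _ hmem]
  · have e : (-(j * d) * a⁻¹ + a⁻¹ * (j * d + a * t) : ℝ) = t := by field_simp; ring
    rw [e, ← mul_assoc]
    have : a ^ 2 * a⁻¹ ^ 2 = 1 := by field_simp
    rw [this, one_mul]
    rfl
  · intro i _ hij
    refine BddMeas.piece_apply_of_notMem _ _ _ _ _ fun hi => ?_
    have h1 : (i : ℝ) < j + 1 := by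
      have := hi.1.trans_lt hmem.2
      push_cast at this
      exact lt_of_mul_lt_mul_right this hd.le
    have h2 : (j : ℝ) < i + 1 := by
      have := hmem.1.trans_lt hi.2
      push_cast at this
      exact lt_of_mul_lt_mul_right this hd.le
    have h3 : i < j + 1 := by exact_mod_cast h1
    have h4 : j < i + 1 := by exact_mod_cast h2
    omega

theorem dd_comp_glue (ha : 0 < a) (had : a < d) (u : ℕ → H2b) {j : ℕ} (hj : j < κ) {t : ℝ}
    (ht : t ∈ Ico 0 (1 + (d - a) / a)) :
    dd (comp (j * d) a (glue κ a d u)) t = dd (ext ((d - a) / a) (u j, u (j + 1))) t := by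
  rw [dd_comp, dd_glue ha had u hj ht]

theorem data_glue (ha : 0 < a) (had : a < d) (u : ℕ → H2b) {j : ℕ} (hj : j < κ) :
    (comp (j * d) a (glue κ a d u)).1 = (u j).1 ∧
      (comp (j * d) a (glue κ a d u)).2.1 = (u j).2.1 := by
  have hl : 0 < (d - a) / a := div_pos (sub_pos.2 had) ha
  induction j with
  | zero =>
    simp [comp_fst, comp_snd_fst, glue_fst, glue_snd_fst, ha.ne']
  | succ j ih =>
    obtain ⟨h1, h2⟩ := ih (by omega)
    have hc : 1 + (d - a) / a ∈ Icc 0 (1 + (d - a) / a) := ⟨by positivity, le_rfl⟩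
    have hv := val_congr (h1.trans (ext_fst _ _ (u (j + 1))).symm)
      (h2.trans (ext_snd_fst _ _ (u (j + 1))).symm)
      (fun t ht => dd_comp_glue ha had u (by omega : j < κ) ht) hc
    have hd := der_congr (h2.trans (ext_snd_fst _ _ (u (j + 1))).symm)
      (fun t ht => dd_comp_glue ha had u (by omega : j < κ) ht) hc
    have e : (j * d + a * (1 + (d - a) / a) : ℝ) = (j + 1 : ℕ) * d := by
      push_cast; field_simp; ring
    rw [val_comp, val_ext_right hl, e, val_zero] at hv
    rw [der_comp, der_ext_right hl, e, der_zero] at hd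
    exact ⟨hv, hd⟩

theorem val_glue (ha : 0 < a) (had : a < d) (u : ℕ → H2b) {j : ℕ} (hj : j < κ) {t : ℝ}
    (ht : t ∈ Icc (0 : ℝ) 1) : val (j * d + a * t) (glue κ a d u) = val t (u j) := by
  have hl : 0 < (d - a) / a := div_pos (sub_pos.2 had) ha
  rw [← val_comp]
  refine val_congr (T := 1) (data_glue ha had u hj).1 (data_glue ha had u hj).2 (fun s hs => ?_) ht
  rw [dd_comp_glue ha had u hj ⟨hs.1, by linarith [hs.2]⟩, dd_ext_of_le _ _ _ hs.2.le]

theorem der_glue (ha : 0 < a) (had : a < d) (u : ℕ → H2b) {j : ℕ} (hj : j < κ) {t : ℝ}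
    (ht : t ∈ Icc (0 : ℝ) 1) : a * der (j * d + a * t) (glue κ a d u) = der t (u j) := by
  have hl : 0 < (d - a) / a := div_pos (sub_pos.2 had) ha
  rw [← der_comp]
  refine der_congr (T := 1) (data_glue ha had u hj).2 (fun s hs => ?_) ht
  rw [dd_comp_glue ha had u hj ⟨hs.1, by linarith [hs.2]⟩, dd_ext_of_le _ _ _ hs.2.le]

theorem bend_ext {C : ℝ} (hC : ∀ u u' : H2b,
    ∫ t in (1 : ℝ)..(1 + (d - a) / a), dd (ext ((d - a) / a) (u, u')) t *
      dd (ext ((d - a) / a) (u, u')) t ≤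
      C * (val 1 u ^ 2 + der 1 u ^ 2 + (val 0 u' ^ 2 + der 0 u' ^ 2))) (u u' : H2b) :
    bend 0 (1 + (d - a) / a) (ext ((d - a) / a) (u, u')) ≤
      bend 0 1 u + C * (bdry 1 u + bdry 0 u') := by
  rw [← bend_add_bend 0 1,
    bend_congr zero_le_one fun t ht => dd_ext_of_le ((d - a) / a) u u' ht.2.le]
  exact add_le_add_right (hC u u') _

/-- The energy of a glued function is controlled by the energies and boundary data of the pieces. -/
theorem bend_glue_le (ha : 0 < a) (had : a < d) (hκ : 1 ≤ κ * d) {C : ℝ} (hC : ∀ u u' : H2b,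
    ∫ t in (1 : ℝ)..(1 + (d - a) / a), dd (ext ((d - a) / a) (u, u')) t *
      dd (ext ((d - a) / a) (u, u')) t ≤
      C * (val 1 u ^ 2 + der 1 u ^ 2 + (val 0 u' ^ 2 + der 0 u' ^ 2))) (u : ℕ → H2b) :
    a ^ 3 * bend 0 1 (glue κ a d u) ≤
      ∑ j ∈ Finset.range κ, (bend 0 1 (u j) + C * (bdry 1 (u j) + bdry 0 (u (j + 1)))) := by
  have hl : 0 < (d - a) / a := div_pos (sub_pos.2 had) ha
  have hsum : ∑ j ∈ Finset.range κ, bend (j * d) ((j + 1 : ℕ) * d) (glue κ a d u) =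
      bend ((0 : ℕ) * d) (κ * d) (glue κ a d u) :=
    intervalIntegral.sum_integral_adjacent_intervals (a := fun j : ℕ => (j * d : ℝ))
      fun j _ => dd_mul_intervalIntegrable _ _ _ _
  rw [Nat.cast_zero, zero_mul] at hsum
  have hle : bend 0 1 (glue κ a d u) ≤ bend 0 (κ * d) (glue κ a d u) := by
    rw [← bend_add_bend 0 1 (κ * d)]
    exact le_add_of_nonneg_right (bend_nonneg hκ _)
  calc a ^ 3 * bend 0 1 (glue κ a d u) ≤ a ^ 3 * bend 0 (κ * d) (glue κ a d u) := by gcongr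
    _ = ∑ j ∈ Finset.range κ, bend 0 (1 + (d - a) / a) (comp (j * d) a (glue κ a d u)) := by
        rw [← hsum, Finset.mul_sum]
        refine Finset.sum_congr rfl fun j _ => ?_
        rw [bend_comp]
        congr 2
        push_cast; field_simp; ring
    _ ≤ _ := by
        refine Finset.sum_le_sum fun j hj => ?_
        rw [bend_congr (by positivity) fun t ht =>
          dd_comp_glue ha had u (Finset.mem_range.1 hj) ht]
        exact bend_ext hC _ _

end H2b

end Glue

section Counting

open MeasureTheory

namespace H2b

/-- The quadratic form of the free problem shifted by `lam`, with boundary penalty `C`. -/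
noncomputable def quad (μ : Measure ℝ) (C lam : ℝ) (u : H2b) : ℝ :=
  bend 0 1 u + C * (bdry 0 u + bdry 1 u) - lam * msq μ u

theorem bend_eq_energy (u : H2b) : bend 0 1 u = H2.energy (toH2 u) (toH2 u) :=
  (energy_toH2 u u).symm

theorem bdry_add_bdry (u : H2b) : bdry 0 u + bdry 1 u = H2.trace (toH2 u) := by
  rw [trace_toH2, bdry, bdry]; ring

theorem quad_anti {μ : Measure ℝ} {C C' lam lam' : ℝ} (hC : C ≤ C') (hl : lam' ≤ lam) (u : H2b) :
    quad μ C lam u ≤ quad μ C' lam' u := by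
  have := mul_le_mul_of_nonneg_right hC (add_nonneg (bdry_nonneg 0 u) (bdry_nonneg 1 u))
  have := mul_le_mul_of_nonneg_right hl (msq_nonneg μ u)
  unfold quad
  linarith

theorem posCodim_add_four {μ : Measure ℝ} {C lam : ℝ} {n : ℕ} (hn : PosCodim (quad μ C lam) n) :
    PosCodim (quad μ 0 lam) (n + 4) := by
  obtain ⟨l, hl⟩ := hn
  refine PosCodim.of_finrank (E := (Fin n → ℝ) × ℝ × ℝ × ℝ × ℝ) (by simp)
    (l.prod ((val 0).prod ((der 0).prod ((val 1).prod (der 1))))) fun u hu => ?_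
  have h0 : l u = 0 := congrArg Prod.fst hu
  have h1 : val 0 u = 0 := congrArg (fun p => p.2.1) hu
  have h2 : der 0 u = 0 := congrArg (fun p => p.2.2.1) hu
  have h3 : val 1 u = 0 := congrArg (fun p => p.2.2.2.1) hu
  have h4 : der 1 u = 0 := congrArg (fun p => p.2.2.2.2) hu
  have := hl u h0
  simpa [quad, bdry, h1, h2, h3, h4] using this

variable {F : ℝ → ℝ} {κ : ℕ} {a d : ℝ} {μ : Measure ℝ} [IsProbabilityMeasure μ]

theorem sum_bend_comp_le (h : SelfSimilarCDF F κ a d) (u : H2b) :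
    ∑ j ∈ Finset.range κ, bend 0 1 (comp (j * d) a u) ≤ a ^ 3 * bend 0 1 u := by
  have key : ∀ n : ℕ, ∑ j ∈ Finset.range (n + 1), bend (j * d) (j * d + a) u ≤
      bend 0 (n * d + a) u := by
    intro n
    induction n with
    | zero => simp
    | succ n ih =>
      rw [Finset.sum_range_succ, ← bend_add_bend 0 ((n + 1 : ℕ) * d),
        ← bend_add_bend 0 (n * d + a)]
      have : 0 ≤ bend (n * d + a) ((n + 1 : ℕ) * d) u :=
        bend_nonneg (by push_cast; linarith [h.a_lt]) u
      linarith
  obtain ⟨n, rfl⟩ : ∃ n, κ = n + 1 := ⟨κ - 1, by have := h.two_le; omega⟩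
  have e : (n * d + a : ℝ) = 1 := by have := h.span_eq; push_cast at this; linarith
  simp only [bend_comp, mul_one]
  rw [← Finset.mul_sum, ← e]
  exact mul_le_mul_of_nonneg_left (key n) (pow_nonneg h.a_pos.le 3)

theorem msq_eq_sum (h : SelfSimilarCDF F κ a d) (hμ : ∀ x, μ (Iic x) = ENNReal.ofReal (F x))
    (u : H2b) : msq μ u = (κ : ℝ)⁻¹ * ∑ j ∈ Finset.range κ, msq μ (comp (j * d) a u) := by
  simp only [msq, val_comp]
  exact h.integral_eq_sum hμ ((continuous_val u).mul (continuous_val u))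

theorem msq_glue (h : SelfSimilarCDF F κ a d) (hμ : ∀ x, μ (Iic x) = ENNReal.ofReal (F x))
    (u : ℕ → H2b) :
    msq μ (glue κ a d u) = (κ : ℝ)⁻¹ * ∑ j ∈ Finset.range κ, msq μ (u j) := by
  rw [msq_eq_sum h hμ]
  congr 1
  refine Finset.sum_congr rfl fun j hj => integral_congr_ae ?_
  filter_upwards [h.ae_mem_Icc hμ] with x hx
  rw [val_comp, val_glue h.a_pos h.a_lt u (Finset.mem_range.1 hj) hx]

theorem msq_eq_mass (h : SelfSimilarCDF F κ a d) (hμ : ∀ x, μ (Iic x) = ENNReal.ofReal (F x))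
    (u : H2b) : msq μ u = H2.mass μ (toH2 u) (toH2 u) := by
  rw [mass_toH2, h.restrict_Icc hμ]; rfl

theorem exists_index (h : SelfSimilarCDF F κ a d) (hμ : ∀ x, μ (Iic x) = ENNReal.ofReal (F x))
    {C : ℝ} (hC : 0 ≤ C) (lam : ℝ) :
    ∃ n, NegDim (quad μ C lam) n ∧ PosCodim (quad μ C lam) n := by
  let B : LinearMap.BilinForm ℝ H2 :=
    H2.energy + C • (LinearMap.BilinForm.linMulLin H2.val0 H2.val0 +
    LinearMap.BilinForm.linMulLin H2.der0 H2.der0 +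
    LinearMap.BilinForm.linMulLin (H2.ev 1) (H2.ev 1) +
    LinearMap.BilinForm.linMulLin H2.der1 H2.der1) - lam • H2.mass μ
  have hB : ∀ v w, B v w = B w v := fun v w => by
    simp [B, LinearMap.BilinForm.linMulLin_apply, H2.energy_comm v w, H2.mass_comm μ v w, mul_comm]
  have hq : quad μ C lam = fun u => (B.compl₁₂ toH2 toH2) u u := by
    funext u
    rw [quad, bend_eq_energy, bdry_add_bdry, msq_eq_mass h hμ]
    simp [B, LinearMap.BilinForm.linMulLin_apply, H2.trace, sq]
    ring
  obtain ⟨m, l, hl⟩ := H2.exists_mass_le_energy μ (ε := (|lam| + 1)⁻¹) (by positivity)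
  rw [hq]
  refine exists_negDim_posCodim _ (fun u v => hB _ _) (m := m) ⟨l ∘ₗ toH2, fun u hu => ?_⟩
  refine le_of_le_of_eq ?_ (congrFun hq u)
  rw [quad, bend_eq_energy, bdry_add_bdry, msq_eq_mass h hμ]
  have h1 := hl (toH2 u) hu
  rw [← div_eq_inv_mul, le_div_iff₀ (by positivity)] at h1
  have h2 := H2.mass_self_nonneg μ (toH2 u)
  have h3 : lam * H2.mass μ (toH2 u) (toH2 u) ≤ |lam| * H2.mass μ (toH2 u) (toH2 u) :=
    mul_le_mul_of_nonneg_right (le_abs_self lam) h2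
  have h4 := mul_nonneg hC (H2.trace_nonneg (toH2 u))
  linarith

theorem posCodim_mul (h : SelfSimilarCDF F κ a d) (hμ : ∀ x, μ (Iic x) = ENNReal.ofReal (F x))
    {lam : ℝ} {n : ℕ} (hn : PosCodim (quad μ 0 lam) n) :
    PosCodim (quad μ 0 (lam * (κ / a ^ 3))) (κ * n) := by
  obtain ⟨l, hl⟩ := hn
  have ha := h.a_pos
  have hκ : (0 : ℝ) < κ := by linarith [h.cast_two_le]
  refine PosCodim.of_finrank (E := Fin κ → Fin n → ℝ)
    (by rw [Module.finrank_pi_fintype]; simp)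
    (LinearMap.pi fun j : Fin κ => l ∘ₗ comp (j * d) a) fun u hu => ?_
  have h1 : ∀ j ∈ Finset.range κ, 0 ≤ quad μ 0 lam (comp (j * d) a u) := fun j hj =>
    hl _ (congrFun hu ⟨j, Finset.mem_range.1 hj⟩)
  have h2 := Finset.sum_nonneg h1
  change 0 ≤ quad μ 0 (lam * (κ / a ^ 3)) u
  simp only [quad, zero_mul, add_zero] at h2 ⊢
  rw [Finset.sum_sub_distrib, ← Finset.mul_sum] at h2
  have h3 := sum_bend_comp_le h u
  have h4 : lam * (κ / a ^ 3) * msq μ u =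
      (lam * ∑ j ∈ Finset.range κ, msq μ (comp (j * d) a u)) / a ^ 3 := by
    rw [msq_eq_sum h hμ u]
    generalize ∑ j ∈ Finset.range κ, msq μ (comp (j * d) a u) = S
    field_simp
  rw [h4, sub_nonneg, div_le_iff₀ (by positivity)]
  linarith

theorem quad_glue_le (h : SelfSimilarCDF F κ a d) (hμ : ∀ x, μ (Iic x) = ENNReal.ofReal (F x))
    {C C₀ : ℝ} (hC : 2 * C₀ ≤ C) (hC₀ : 0 ≤ C₀) (hb : ∀ u u' : H2b,
    ∫ t in (1 : ℝ)..(1 + (d - a) / a), dd (ext ((d - a) / a) (u, u')) t *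
      dd (ext ((d - a) / a) (u, u')) t ≤
      C₀ * (val 1 u ^ 2 + der 1 u ^ 2 + (val 0 u' ^ 2 + der 0 u' ^ 2))) (lam : ℝ) (u : ℕ → H2b)
    (hu : u κ = 0) :
    a ^ 3 * quad μ C (lam * (κ / a ^ 3)) (glue κ a d u) ≤
      ∑ j ∈ Finset.range κ, quad μ C lam (u j) := by
  have ha := h.a_pos
  have hκ : (0 : ℝ) < κ := by linarith [h.cast_two_le]
  have hκ0 : 0 < κ := by exact_mod_cast hκ
  have h1 := bend_glue_le ha h.a_lt (by linarith [h.span_eq, h.a_lt]) hb u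
  have hshift : ∑ j ∈ Finset.range κ, bdry 0 (u (j + 1)) ≤ ∑ j ∈ Finset.range κ, bdry 0 (u j) := by
    have e := Finset.sum_range_succ (fun j => bdry 0 (u j)) κ
    rw [Finset.sum_range_succ', hu] at e
    have : bdry 0 (0 : H2b) = 0 := by simp [bdry]
    linarith [bdry_nonneg 0 (u 0)]
  have hend : ((κ - 1 : ℕ) * d + a * 1 : ℝ) = 1 := by
    rw [Nat.cast_pred hκ0]; linarith [h.span_eq]
  have hlast : κ - 1 < κ := by omega
  have ha2 : a ^ 2 ≤ 1 := by nlinarith [h.a_lt_half]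
  have b0 : a ^ 2 * bdry 0 (glue κ a d u) ≤ ∑ j ∈ Finset.range κ, bdry 0 (u j) := by
    refine le_trans ?_ (Finset.single_le_sum (fun j _ => bdry_nonneg 0 (u j))
      (Finset.mem_range.2 hκ0))
    have hv := val_glue ha h.a_lt u hκ0 (left_mem_Icc.2 zero_le_one)
    have hd := der_glue ha h.a_lt u hκ0 (left_mem_Icc.2 zero_le_one)
    simp only [Nat.cast_zero, zero_mul, mul_zero, add_zero] at hv hd
    rw [bdry, bdry, hv, ← hd]
    nlinarith [mul_le_mul_of_nonneg_right ha2 (sq_nonneg (val 0 (u 0)))]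
  have b1 : a ^ 2 * bdry 1 (glue κ a d u) ≤ ∑ j ∈ Finset.range κ, bdry 1 (u j) := by
    refine le_trans ?_ (Finset.single_le_sum (fun j _ => bdry_nonneg 1 (u j))
      (Finset.mem_range.2 hlast))
    have hv := val_glue ha h.a_lt u hlast (right_mem_Icc.2 zero_le_one)
    have hd := der_glue ha h.a_lt u hlast (right_mem_Icc.2 zero_le_one)
    rw [hend] at hv hd
    rw [bdry, bdry, hv, ← hd]
    nlinarith [mul_le_mul_of_nonneg_right ha2 (sq_nonneg (val 1 (u (κ - 1))))]
  have hm : a ^ 3 * (lam * (κ / a ^ 3) * msq μ (glue κ a d u)) =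
      lam * ∑ j ∈ Finset.range κ, msq μ (u j) := by
    rw [msq_glue h hμ u]; field_simp
  have hsum : ∑ j ∈ Finset.range κ, quad μ C lam (u j) = ∑ j ∈ Finset.range κ, bend 0 1 (u j) +
      C * (∑ j ∈ Finset.range κ, bdry 0 (u j) + ∑ j ∈ Finset.range κ, bdry 1 (u j)) -
      lam * ∑ j ∈ Finset.range κ, msq μ (u j) := by
    simp only [quad, Finset.sum_sub_distrib, Finset.sum_add_distrib, ← Finset.mul_sum]
  rw [Finset.sum_add_distrib, ← Finset.mul_sum, Finset.sum_add_distrib] at h1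
  rw [hsum, quad, mul_sub, hm, mul_add]
  set S0 := ∑ j ∈ Finset.range κ, bdry 0 (u j)
  set S1 := ∑ j ∈ Finset.range κ, bdry 1 (u j)
  have hS0 : 0 ≤ S0 := Finset.sum_nonneg fun j _ => bdry_nonneg 0 (u j)
  have hS1 : 0 ≤ S1 := Finset.sum_nonneg fun j _ => bdry_nonneg 1 (u j)
  have h2 : a ^ 3 * (C * (bdry 0 (glue κ a d u) + bdry 1 (glue κ a d u))) ≤
      C / 2 * (S0 + S1) := by
    have e : a ^ 3 * (C * (bdry 0 (glue κ a d u) + bdry 1 (glue κ a d u))) =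
      C * a * (a ^ 2 * bdry 0 (glue κ a d u) + a ^ 2 * bdry 1 (glue κ a d u)) := by ring
    rw [e]
    have h3 : C * a ≤ C / 2 := by nlinarith [h.a_lt_half]
    refine mul_le_mul h3 (add_le_add b0 b1) ?_ (by linarith)
    have := bdry_nonneg 0 (glue κ a d u)
    have := bdry_nonneg 1 (glue κ a d u)
    positivity
  have h4 : C₀ * (S1 + ∑ j ∈ Finset.range κ, bdry 0 (u (j + 1))) ≤ C / 2 * (S0 + S1) :=
    mul_le_mul (by linarith) (by linarith)
      (add_nonneg hS1 (Finset.sum_nonneg fun j _ => bdry_nonneg 0 _)) (by linarith)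
  linarith

theorem negDim_mul (h : SelfSimilarCDF F κ a d) (hμ : ∀ x, μ (Iic x) = ENNReal.ofReal (F x))
    {C C₀ : ℝ} (hC : 2 * C₀ ≤ C) (hC₀ : 0 ≤ C₀) (hb : ∀ u u' : H2b,
    ∫ t in (1 : ℝ)..(1 + (d - a) / a), dd (ext ((d - a) / a) (u, u')) t *
      dd (ext ((d - a) / a) (u, u')) t ≤
      C₀ * (val 1 u ^ 2 + der 1 u ^ 2 + (val 0 u' ^ 2 + der 0 u' ^ 2)))
    {lam : ℝ} {n : ℕ} (hn : NegDim (quad μ C lam) n) :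
    NegDim (quad μ C (lam * (κ / a ^ 3))) (κ * n) := by
  obtain ⟨φ, hφ⟩ := hn
  let ψ : (Fin κ → Fin n → ℝ) →ₗ[ℝ] (ℕ → H2b) := LinearMap.pi fun j =>
    if hj : j < κ then φ ∘ₗ LinearMap.proj ⟨j, hj⟩ else 0
  refine NegDim.of_finrank (E := Fin κ → Fin n → ℝ)
    (by rw [Module.finrank_pi_fintype]; simp) (glue κ a d ∘ₗ ψ) fun c hc => ?_
  have h1 := quad_glue_le h hμ hC hC₀ hb lam (ψ c) (by simp [ψ])
  have hψ : ∀ j (hj : j < κ), ψ c j = φ (c ⟨j, hj⟩) := fun j hj => by simp [ψ, hj]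
  have hz : quad μ C lam 0 = 0 := by simp [quad, bend, bdry, msq, dd]
  have hle : ∀ j ∈ Finset.range κ, quad μ C lam (ψ c j) ≤ 0 := fun j hj => by
    rw [hψ j (Finset.mem_range.1 hj)]
    by_cases h0 : c ⟨j, Finset.mem_range.1 hj⟩ = 0
    · rw [h0, map_zero, hz]
    · exact (hφ _ h0).le
  obtain ⟨j, hj⟩ := Function.ne_iff.1 hc
  have h2 : ∑ j ∈ Finset.range κ, quad μ C lam (ψ c j) < 0 :=
    Finset.sum_neg' hle ⟨j, Finset.mem_range.2 j.2, by rw [hψ j j.2]; exact hφ _ hj⟩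
  have h3 := h1.trans_lt h2
  have ha3 : 0 < a ^ 3 := pow_pos h.a_pos 3
  exact neg_of_mul_neg_right h3 ha3.le

/-- The boundary data are small compared to the form at the scale of the `k`-th generation. -/
theorem exists_bdry_le [NullSingletonClass μ] (h : SelfSimilarCDF F κ a d)
    (hμ : ∀ x, μ (Iic x) = ENNReal.ofReal (F x)) :
    ∃ C, 0 < C ∧ ∀ (k : ℕ) (u : H2b),
      bdry 0 u + bdry 1 u ≤ C * a ^ k * ((κ / a ^ 3) ^ k * msq μ u + bend 0 1 u) := by
  obtain ⟨C, hC, hcoer⟩ := H2.exists_coercive h hμ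
  have ha := h.a_pos
  have hκ : (0 : ℝ) < κ := by linarith [h.cast_two_le]
  have hκ0 : 0 < κ := by exact_mod_cast hκ
  refine ⟨6 * C, by positivity, fun k => ?_⟩
  induction k with
  | zero =>
    intro u
    rw [bdry_add_bdry, bend_eq_energy, msq_eq_mass h hμ]
    have h1 := H2.trace_le (toH2 u)
    have h2 := hcoer (toH2 u)
    simp only [pow_zero, mul_one, one_mul]
    linarith
  | succ k ih =>
    intro u
    have hlast : κ - 1 < κ := by omega
    have ha2 : a ^ 2 ≤ 1 := by nlinarith [h.a_lt_half]
    have hend : ((κ - 1 : ℕ) * d + a * 1 : ℝ) = 1 := by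
      rw [Nat.cast_pred hκ0]; linarith [h.span_eq]
    have pair : ∀ f : ℕ → ℝ, (∀ j, 0 ≤ f j) → f 0 + f (κ - 1) ≤ ∑ j ∈ Finset.range κ, f j := by
      intro f hf
      have hne : (0 : ℕ) ≠ κ - 1 := by have := h.two_le; omega
      rw [← Finset.sum_pair hne]
      refine Finset.sum_le_sum_of_subset_of_nonneg (fun i hi => ?_) fun j _ _ => hf j
      simp only [Finset.mem_insert, Finset.mem_singleton] at hi
      rcases hi with rfl | rfl <;> simp [hκ0]
    have hm := pair (fun j => msq μ (comp (j * d) a u)) fun j => msq_nonneg μ _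
    have he := pair (fun j => bend 0 1 (comp (j * d) a u)) fun j => bend_nonneg zero_le_one _
    have hm' : ∑ j ∈ Finset.range κ, msq μ (comp (j * d) a u) = κ * msq μ u := by
      rw [msq_eq_sum h hμ u, mul_inv_cancel_left₀ hκ.ne']
    have he' := sum_bend_comp_le h u
    have i0 := ih (comp ((0 : ℕ) * d) a u)
    have i1 := ih (comp ((κ - 1 : ℕ) * d) a u)
    have b0 : a ^ 2 * bdry 0 u ≤ bdry 0 (comp ((0 : ℕ) * d) a u) := by
      rw [bdry, bdry, val_comp, der_comp]
      simp only [Nat.cast_zero, zero_mul, mul_zero, add_zero]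
      nlinarith [mul_le_mul_of_nonneg_right ha2 (sq_nonneg (val 0 u))]
    have b1 : a ^ 2 * bdry 1 u ≤ bdry 1 (comp ((κ - 1 : ℕ) * d) a u) := by
      rw [bdry, bdry, val_comp, der_comp, hend]
      nlinarith [mul_le_mul_of_nonneg_right ha2 (sq_nonneg (val 1 u))]
    have c0 := bdry_nonneg 1 (comp ((0 : ℕ) * d) a u)
    have c1 := bdry_nonneg 0 (comp ((κ - 1 : ℕ) * d) a u)
    have hP : 0 ≤ 6 * C * a ^ k := by positivity
    have hρ : 0 ≤ (κ / a ^ 3) ^ k := by positivity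
    have h1 : a ^ 2 * (bdry 0 u + bdry 1 u) ≤
        6 * C * a ^ k * ((κ / a ^ 3) ^ k * (κ * msq μ u) + a ^ 3 * bend 0 1 u) := by
      calc a ^ 2 * (bdry 0 u + bdry 1 u) ≤
          6 * C * a ^ k * ((κ / a ^ 3) ^ k * (msq μ (comp ((0 : ℕ) * d) a u) +
              msq μ (comp ((κ - 1 : ℕ) * d) a u)) +
            (bend 0 1 (comp ((0 : ℕ) * d) a u) + bend 0 1 (comp ((κ - 1 : ℕ) * d) a u))) := by
            rw [mul_add (_ ^ k), add_add_add_comm, mul_add (6 * C * a ^ k), mul_add (a ^ 2)]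
            exact add_le_add (b0.trans ((le_add_of_nonneg_right c0).trans i0))
              (b1.trans ((le_add_of_nonneg_left c1).trans i1))
        _ ≤ _ := by
            refine mul_le_mul_of_nonneg_left (add_le_add ?_ (he.trans he')) hP
            exact mul_le_mul_of_nonneg_left (hm.trans hm'.le) hρ
    have h2 : a ^ 2 * (6 * C * a ^ (k + 1) * ((κ / a ^ 3) ^ (k + 1) * msq μ u + bend 0 1 u)) =
        6 * C * a ^ k * ((κ / a ^ 3) ^ k * (κ * msq μ u) + a ^ 3 * bend 0 1 u) := by
      rw [pow_succ (κ / a ^ 3 : ℝ), pow_succ a k]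
      field_simp
    rw [← h2] at h1
    exact le_of_mul_le_mul_left h1 (by positivity)

theorem exists_negDim_of_negDim [NullSingletonClass μ] (h : SelfSimilarCDF F κ a d)
    (hμ : ∀ x, μ (Iic x) = ENNReal.ofReal (F x)) {C : ℝ} (hC : 0 ≤ C) :
    ∃ C', 0 ≤ C' ∧ ∀ (k : ℕ) (lam : ℝ) (n : ℕ), (κ / a ^ 3) ^ k ≤ lam →
      NegDim (quad μ 0 lam) n → NegDim (quad μ C (lam * (1 + C' * a ^ k))) n := by
  obtain ⟨C₁, hC₁, hb⟩ := exists_bdry_le h hμ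
  have ha := h.a_pos
  refine ⟨2 * (C * C₁), by positivity, fun k lam n hlam hn => hn.map LinearMap.id fun u hu => ?_⟩
  have h1 := hb k u
  have hm := msq_nonneg μ u
  have h2 : C * (bdry 0 u + bdry 1 u) ≤ C * (C₁ * a ^ k * (2 * (lam * msq μ u))) := by
    refine mul_le_mul_of_nonneg_left (h1.trans (mul_le_mul_of_nonneg_left ?_ (by positivity))) hC
    have h3 := mul_le_mul_of_nonneg_right hlam hm
    simp only [quad, zero_mul, add_zero] at hu
    linarith
  simp only [quad, zero_mul, add_zero, LinearMap.id_apply] at hu ⊢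
  linarith

end H2b

end Counting

section Classical

/-- `y` is a solution of the boundary value problem `(α, β)` with derivatives `y₁, y₂, y₃`. -/
structure ClassicalSolution (F : ℝ → ℝ) (α β lam : ℝ) (y y₁ y₂ y₃ : ℝ → ℝ) : Prop where
  deriv_y : ∀ x ∈ Icc (0 : ℝ) 1, HasDerivWithinAt y (y₁ x) (Icc 0 1) x
  deriv_y₁ : ∀ x ∈ Icc (0 : ℝ) 1, HasDerivWithinAt y₁ (y₂ x) (Icc 0 1) x
  deriv_y₂ : ∀ x ∈ Icc (0 : ℝ) 1, HasDerivWithinAt y₂ (y₃ x) (Icc 0 1) x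
  cont_y₃ : ContinuousOn y₃ (Icc 0 1)
  deriv_y₃ : ∀ x ∈ Icc (0 : ℝ) 1,
    HasDerivWithinAt (fun t => y₃ t - lam * F t * y t) (-(lam * F x * y₁ x)) (Icc 0 1) x
  bc_zero : y₂ 0 + α * y 0 - β * y₁ 0 = 0
  bc_zero' : -β * y₃ 0 + α * y₂ 0 = 0
  bc_one : y₂ 1 + α * y 1 + β * y₁ 1 = 0
  bc_one' : -β * y₃ 1 - α * y₂ 1 = 0

theorem Eigenfunction.classicalSolution {P : ℝ → ℝ} {α β lam : ℝ} {y : ℝ → ℝ}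
    (h : Eigenfunction P α β lam y) :
    ClassicalSolution (clamp P) α β lam y (Y1 y) (Y2 y) (Y3 y) := by
  obtain ⟨-, ⟨hC, hq⟩, h0, h0', h1, h1'⟩ := h
  have hu : UniqueDiffOn ℝ (Icc (0 : ℝ) 1) := uniqueDiffOn_Icc zero_lt_one
  have hd : ∀ m : ℕ, m < 3 → ∀ x ∈ Icc (0 : ℝ) 1,
      HasDerivWithinAt (iteratedDerivWithin m y (Icc 0 1))
        (iteratedDerivWithin (m + 1) y (Icc 0 1) x) (Icc 0 1) x := fun m hm x hx => by
    rw [iteratedDerivWithin_succ]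
    exact (hC.differentiableOn_iteratedDerivWithin (by exact_mod_cast hm) hu x hx).hasDerivWithinAt
  refine ⟨fun x hx => ?_, fun x hx => ?_, fun x hx => hd 2 (by norm_num) x hx,
    hC.continuousOn_iteratedDerivWithin le_rfl hu, fun x hx => ?_, h0, h0', h1, h1'⟩
  · simpa [iteratedDerivWithin_one, Y1] using hd 0 (by norm_num) x hx
  · have := hd 1 (by norm_num) x hx
    exact this.congr (fun z hz => (congrFun iteratedDerivWithin_one z).symm)
      (congrFun iteratedDerivWithin_one x).symm
  · rw [clamp_eq P hx]
    exact (hq x hx).congr (fun z hz => by simp only [clamp_eq P hz]) (by simp only [clamp_eq P hx])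

theorem ClassicalSolution.eigenfunction {P : ℝ → ℝ} {α β lam : ℝ} {y y₁ y₂ y₃ : ℝ → ℝ}
    (h : ClassicalSolution (clamp P) α β lam y y₁ y₂ y₃) (hy : Nontrivial01 y) :
    Eigenfunction P α β lam y := by
  have hu : UniqueDiffOn ℝ (Icc (0 : ℝ) 1) := uniqueDiffOn_Icc zero_lt_one
  have e1 : ∀ x ∈ Icc (0 : ℝ) 1, derivWithin y (Icc 0 1) x = y₁ x := fun x hx =>
    (h.deriv_y x hx).derivWithin (hu x hx)
  have e2 : ∀ x ∈ Icc (0 : ℝ) 1, derivWithin y₁ (Icc 0 1) x = y₂ x := fun x hx =>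
    (h.deriv_y₁ x hx).derivWithin (hu x hx)
  have e3 : ∀ x ∈ Icc (0 : ℝ) 1, derivWithin y₂ (Icc 0 1) x = y₃ x := fun x hx =>
    (h.deriv_y₂ x hx).derivWithin (hu x hx)
  have E2 : ∀ x ∈ Icc (0 : ℝ) 1, Y2 y x = y₂ x := fun x hx => by
    rw [Y2, iteratedDerivWithin_succ, ← e2 x hx]
    exact derivWithin_congr (fun z hz => by rw [iteratedDerivWithin_one, e1 z hz])
      (by rw [iteratedDerivWithin_one, e1 x hx])
  have E3 : ∀ x ∈ Icc (0 : ℝ) 1, Y3 y x = y₃ x := fun x hx => by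
    rw [Y3, iteratedDerivWithin_succ, ← e3 x hx]
    exact derivWithin_congr E2 (E2 x hx)
  have z0 : (0 : ℝ) ∈ Icc (0 : ℝ) 1 := left_mem_Icc.2 zero_le_one
  have z1 : (1 : ℝ) ∈ Icc (0 : ℝ) 1 := right_mem_Icc.2 zero_le_one
  have hC2 : ContDiffOn ℝ 1 y₂ (Icc 0 1) := by
    rw [show (1 : WithTop ℕ∞) = 0 + 1 from rfl, contDiffOn_succ_iff_derivWithin hu]
    exact ⟨fun x hx => (h.deriv_y₂ x hx).differentiableWithinAt, by simp,
      contDiffOn_zero.2 (h.cont_y₃.congr e3)⟩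
  have hC1 : ContDiffOn ℝ 2 y₁ (Icc 0 1) := by
    rw [show (2 : WithTop ℕ∞) = 1 + 1 from rfl, contDiffOn_succ_iff_derivWithin hu]
    exact ⟨fun x hx => (h.deriv_y₁ x hx).differentiableWithinAt, by simp, hC2.congr e2⟩
  have hC : ContDiffOn ℝ 3 y (Icc 0 1) := by
    rw [show (3 : WithTop ℕ∞) = 2 + 1 from rfl, contDiffOn_succ_iff_derivWithin hu]
    exact ⟨fun x hx => (h.deriv_y x hx).differentiableWithinAt, by simp, hC1.congr e1⟩
  refine ⟨hy, ⟨hC, fun x hx => ?_⟩, ?_⟩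
  · rw [Y1, e1 x hx, ← clamp_eq P hx]
    exact (h.deriv_y₃ x hx).congr (fun z hz => by simp only [clamp_eq P hz, E3 z hz])
      (by simp only [clamp_eq P hx, E3 x hx])
  · rw [BC, Y1, e1 0 z0, e1 1 z1, E2 0 z0, E2 1 z1, E3 0 z0, E3 1 z1]
    exact ⟨h.bc_zero, h.bc_zero', h.bc_one, h.bc_one'⟩

theorem monotoneOn_Icc_of_hasDerivWithinAt_nonneg {f f' : ℝ → ℝ} {s t r : ℝ} (ht : t ≤ r)
    (hf : ∀ x ∈ Icc s r, HasDerivWithinAt f (f' x) (Icc s r) x)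
    (hf' : ∀ x ∈ Ico s t, 0 ≤ f' x) : MonotoneOn f (Icc s t) := by
  have hsub : Icc s t ⊆ Icc s r := Icc_subset_Icc_right ht
  refine monotoneOn_of_hasDerivWithinAt_nonneg (f' := f') (convex_Icc s t)
    (fun x hx => ((hf x (hsub hx)).continuousWithinAt.mono hsub)) (fun x hx => ?_) fun x hx => ?_
  · exact (hf x (hsub (interior_subset hx))).mono (interior_subset.trans hsub)
  · rw [interior_Icc] at hx
    exact hf' x ⟨hx.1.le, hx.2⟩

namespace ClassicalSolution

variable {F : ℝ → ℝ} {α β lam : ℝ} {y y₁ y₂ y₃ : ℝ → ℝ}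

theorem neg (h : ClassicalSolution F α β lam y y₁ y₂ y₃) :
    ClassicalSolution F α β lam (-y) (-y₁) (-y₂) (-y₃) where
  deriv_y x hx := (h.deriv_y x hx).neg
  deriv_y₁ x hx := (h.deriv_y₁ x hx).neg
  deriv_y₂ x hx := (h.deriv_y₂ x hx).neg
  cont_y₃ := h.cont_y₃.neg
  deriv_y₃ x hx := ((h.deriv_y₃ x hx).neg.congr_deriv (by simp)).congr
    (fun t _ => by simp; ring) (by simp; ring)
  bc_zero := by have := h.bc_zero; simp only [Pi.neg_apply]; linarith
  bc_zero' := by have := h.bc_zero'; simp only [Pi.neg_apply]; linarith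
  bc_one := by have := h.bc_one; simp only [Pi.neg_apply]; linarith
  bc_one' := by have := h.bc_one'; simp only [Pi.neg_apply]; linarith

theorem y₃_zero (hβ : 0 < β) (h : ClassicalSolution F α β lam y y₁ y₂ y₃) (h0 : y 0 = 0) :
    y₃ 0 = α * y₁ 0 := by
  have e1 := h.bc_zero
  have e2 := h.bc_zero'
  rw [h0] at e1
  have e3 : y₂ 0 = β * y₁ 0 := by linarith
  rw [e3] at e2
  exact mul_left_cancel₀ hβ.ne' (by linarith)

theorem y₁_zero_nonpos (hF : Monotone F) (hF0 : F 0 = 0) (hα : 0 ≤ α) (hβ : 0 < β)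
    (hlam : 0 ≤ lam) (h : ClassicalSolution F α β lam y y₁ y₂ y₃) (h0 : y 0 = 0) : y₁ 0 ≤ 0 := by
  by_contra! hc
  have hy3 := h.y₃_zero hβ h0
  have hy2 : y₂ 0 = β * y₁ 0 := by have := h.bc_zero; rw [h0] at this; linarith
  have hy2pos : 0 < y₂ 0 := by rw [hy2]; positivity
  have cont₂ : ContinuousOn y₂ (Icc 0 1) := fun x hx => (h.deriv_y₂ x hx).continuousWithinAt
  have step : ∀ t ≤ 1, (∀ x ∈ Ico 0 t, 0 < y₂ x) → ∀ x ∈ Icc 0 t,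
      y₁ 0 ≤ y₁ x ∧ 0 ≤ y x ∧ y₂ 0 ≤ y₂ x := by
    intro t ht hpos
    have m₁ := monotoneOn_Icc_of_hasDerivWithinAt_nonneg ht h.deriv_y₁ fun x hx => (hpos x hx).le
    have p₁ : ∀ x ∈ Icc 0 t, y₁ 0 ≤ y₁ x := fun x hx =>
      m₁ (left_mem_Icc.2 (hx.1.trans hx.2)) hx hx.1
    have m₀ := monotoneOn_Icc_of_hasDerivWithinAt_nonneg ht h.deriv_y fun x hx =>
      hc.le.trans (p₁ x (Ico_subset_Icc_self hx))
    have p₃ : ∀ x ∈ Icc 0 t, 0 ≤ y₃ x := by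
      intro x hx
      have hx1 : x ≤ 1 := hx.2.trans ht
      have m : MonotoneOn (fun s => y₃ s - lam * F s * y s + lam * F x * y s) (Icc 0 x) := by
        refine monotoneOn_Icc_of_hasDerivWithinAt_nonneg hx1
          (fun s hs => (h.deriv_y₃ s hs).add ((h.deriv_y s hs).const_mul (lam * F x)))
          fun s hs => ?_
        have h1 : 0 ≤ y₁ s := hc.le.trans (p₁ s ⟨hs.1, hs.2.le.trans hx.2⟩)
        have h2 := mul_nonneg (mul_nonneg hlam (sub_nonneg.2 (hF hs.2.le))) h1
        linarith
      have := m (left_mem_Icc.2 hx.1) (right_mem_Icc.2 hx.1) hx.1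
      simp only [h0, hF0, hy3] at this
      have := mul_nonneg hα hc.le
      linarith
    have m₂ := monotoneOn_Icc_of_hasDerivWithinAt_nonneg ht h.deriv_y₂ fun x hx =>
      p₃ x (Ico_subset_Icc_self hx)
    exact fun x hx => ⟨p₁ x hx,
      h0 ▸ m₀ (left_mem_Icc.2 (hx.1.trans hx.2)) hx hx.1,
      m₂ (left_mem_Icc.2 (hx.1.trans hx.2)) hx hx.1⟩
  have pos : ∀ x ∈ Icc (0 : ℝ) 1, 0 < y₂ x := by
    by_contra! hne
    have hcl : IsClosed (Icc (0 : ℝ) 1 ∩ y₂ ⁻¹' Iic 0) :=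
      cont₂.preimage_isClosed_of_isClosed isClosed_Icc isClosed_Iic
    have hK : IsCompact (Icc (0 : ℝ) 1 ∩ y₂ ⁻¹' Iic 0) :=
      isCompact_Icc.of_isClosed_subset hcl inter_subset_left
    obtain ⟨x, hx, hx'⟩ := hne
    obtain ⟨t, ⟨ht, ht'⟩, hmin⟩ := hK.exists_isLeast ⟨x, hx, hx'⟩
    have := (step t ht.2 (fun x hx => ?_) t (right_mem_Icc.2 ht.1)).2.2
    · exact absurd (hy2pos.trans_le this) (not_lt.2 ht')
    · by_contra! hx0
      exact absurd (hmin ⟨⟨hx.1, hx.2.le.trans ht.2⟩, hx0⟩) (not_le.2 hx.2)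
  have z1 : (1 : ℝ) ∈ Icc (0 : ℝ) 1 := right_mem_Icc.2 zero_le_one
  obtain ⟨h1, h2, -⟩ := step 1 le_rfl (fun x hx => pos x (Ico_subset_Icc_self hx)) 1 z1
  have := pos 1 z1
  have := mul_nonneg hα h2
  have := mul_pos hβ (hc.trans_le h1)
  linarith [h.bc_one]

/-- A solution with nonnegative parameter that vanishes at `0` vanishes identically. -/
theorem eq_zero (hF : Monotone F) (hF0 : F 0 = 0) (hF1 : F 1 = 1) (hα : 0 ≤ α) (hβ : 0 < β)
    (hlam : 0 ≤ lam) (h : ClassicalSolution F α β lam y y₁ y₂ y₃) (h0 : y 0 = 0) :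
    ∀ x ∈ Icc (0 : ℝ) 1, y x = 0 := by
  have hy1 : y₁ 0 = 0 := by
    refine le_antisymm (h.y₁_zero_nonpos hF hF0 hα hβ hlam h0) ?_
    have := h.neg.y₁_zero_nonpos hF hF0 hα hβ hlam (by simp [h0])
    simpa using this
  have hy2 : y₂ 0 = 0 := by have := h.bc_zero; rw [h0, hy1] at this; linarith
  have hy3 : y₃ 0 = 0 := by rw [h.y₃_zero hβ h0, hy1, mul_zero]
  let f : ℝ → ℝ × ℝ × ℝ × ℝ := fun x => (y x, y₁ x, y₂ x, y₃ x - lam * F x * y x)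
  let f' : ℝ → ℝ × ℝ × ℝ × ℝ := fun x => (y₁ x, y₂ x, y₃ x, -(lam * F x * y₁ x))
  have hf : ∀ x ∈ Icc (0 : ℝ) 1, HasDerivWithinAt f (f' x) (Icc 0 1) x := fun x hx =>
    (h.deriv_y x hx).prodMk ((h.deriv_y₁ x hx).prodMk ((h.deriv_y₂ x hx).prodMk (h.deriv_y₃ x hx)))
  have key := norm_le_gronwallBound_of_norm_deriv_right_le (f := f) (f' := f') (δ := 0)
    (K := 1 + lam) (ε := 0) (a := 0) (b := 1) (fun x hx => (hf x hx).continuousWithinAt)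
    (fun x hx => (hf x (Ico_subset_Icc_self hx)).mono_of_mem_nhdsWithin
      (Icc_mem_nhdsGE_of_mem hx)) (by simp [f, h0, hy1, hy2, hy3]) fun x hx => by
      have n0 : |y x| ≤ ‖f x‖ := norm_fst_le (f x)
      have n1 : |y₁ x| ≤ ‖f x‖ := (norm_fst_le (f x).2).trans (norm_snd_le _)
      have n2 : |y₂ x| ≤ ‖f x‖ :=
        (norm_fst_le (f x).2.2).trans ((norm_snd_le (f x).2).trans (norm_snd_le _))
      have n3 : |y₃ x - lam * F x * y x| ≤ ‖f x‖ :=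
        (norm_snd_le (f x).2.2).trans ((norm_snd_le (f x).2).trans (norm_snd_le _))
      have hF' : |lam * F x| ≤ lam := by
        have := hF0 ▸ hF hx.1
        have := hF1 ▸ hF hx.2.le
        rw [abs_of_nonneg (by positivity)]
        exact mul_le_of_le_one_right hlam this
      have hn := norm_nonneg (f x)
      have hl := mul_nonneg hlam hn
      have n4 : |lam * F x * y x| ≤ lam * ‖f x‖ := by
        rw [abs_mul]; exact mul_le_mul hF' n0 (abs_nonneg _) hlam
      have n5 : |lam * F x * y₁ x| ≤ lam * ‖f x‖ := by
        rw [abs_mul]; exact mul_le_mul hF' n1 (abs_nonneg _) hlam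
      have n6 : |y₃ x| ≤ (1 + lam) * ‖f x‖ := by
        have := abs_add_le (y₃ x - lam * F x * y x) (lam * F x * y x)
        rw [sub_add_cancel] at this
        linarith
      rw [add_zero]
      refine norm_prod_le_iff.2 ⟨?_, norm_prod_le_iff.2 ⟨?_, norm_prod_le_iff.2 ⟨n6, ?_⟩⟩⟩
      · exact n1.trans (by linarith)
      · exact n2.trans (by linarith)
      · rw [norm_neg]; exact n5.trans (by linarith)
  intro x hx
  have := key x hx
  rw [gronwallBound_ε0_δ0] at this
  simpa using (norm_fst_le (f x)).trans this

end ClassicalSolution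

end Classical

section WeakForm

open MeasureTheory

open scoped InnerProductSpace

theorem continuous_clamp {f : ℝ → ℝ} (hf : ContinuousOn f (Icc 0 1)) : Continuous (clamp f) :=
  hf.comp_continuous (by fun_prop) fun x =>
    ⟨le_max_left _ _, max_le zero_le_one (min_le_right _ _)⟩

theorem clamp_mem_bddMeas {f : ℝ → ℝ} (hf : ContinuousOn f (Icc 0 1)) : clamp f ∈ BddMeas := by
  obtain ⟨C, hC⟩ := isCompact_Icc.exists_bound_of_continuousOn hf
  exact ⟨(continuous_clamp hf).measurable, C, fun x =>
    hC _ ⟨le_max_left _ _, max_le zero_le_one (min_le_right _ _)⟩⟩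

theorem integral_eq_sub_of_hasDerivWithinAt_Icc {f f' : ℝ → ℝ}
    (hf : ∀ x ∈ Icc (0 : ℝ) 1, HasDerivWithinAt f (f' x) (Icc 0 1) x)
    (hf' : ContinuousOn f' (Icc 0 1)) {x : ℝ} (hx : x ∈ Icc (0 : ℝ) 1) :
    ∫ t in (0 : ℝ)..x, f' t = f x - f 0 := by
  have hsub : Icc 0 x ⊆ Icc 0 1 := Icc_subset_Icc_right hx.2
  refine intervalIntegral.integral_eq_sub_of_hasDerivAt_of_le hx.1
    (fun t ht => (hf t (hsub ht)).continuousWithinAt.mono hsub) (fun t ht => ?_)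
    ((hf'.mono hsub).intervalIntegrable_of_Icc hx.1)
  exact (hf t (hsub (Ioo_subset_Icc_self ht))).hasDerivAt
    (Icc_mem_nhds ht.1 (ht.2.trans_le hx.2))

namespace ClassicalSolution

variable {F : ℝ → ℝ} {α β lam lam' : ℝ} {y y₁ y₂ y₃ z z₁ z₂ z₃ : ℝ → ℝ}

theorem cont_y (h : ClassicalSolution F α β lam y y₁ y₂ y₃) : ContinuousOn y (Icc 0 1) :=
  fun x hx => (h.deriv_y x hx).continuousWithinAt

theorem cont_y₁ (h : ClassicalSolution F α β lam y y₁ y₂ y₃) : ContinuousOn y₁ (Icc 0 1) :=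
  fun x hx => (h.deriv_y₁ x hx).continuousWithinAt

theorem cont_y₂ (h : ClassicalSolution F α β lam y y₁ y₂ y₃) : ContinuousOn y₂ (Icc 0 1) :=
  fun x hx => (h.deriv_y₂ x hx).continuousWithinAt

theorem exists_H2b (h : ClassicalSolution F α β lam y y₁ y₂ y₃) :
    ∃ u : H2b, ∀ x ∈ Icc (0 : ℝ) 1, H2b.val x u = y x ∧ H2b.der x u = y₁ x ∧ H2b.dd u x = y₂ x := by
  let u : H2b := (y 0, y₁ 0, ⟨clamp y₂, clamp_mem_bddMeas h.cont_y₂⟩)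
  have e2 : ∀ x ∈ Icc (0 : ℝ) 1, H2b.dd u x = y₂ x := fun x hx => clamp_eq y₂ hx
  have e1 : ∀ x ∈ Icc (0 : ℝ) 1, H2b.der x u = y₁ x := fun x hx => by
    have := integral_eq_sub_of_hasDerivWithinAt_Icc h.deriv_y₁ h.cont_y₂ hx
    rw [H2b.der_apply, intervalIntegral.integral_congr (g := y₂) fun t ht => ?_, this]
    · simp [u]
    · rw [uIcc_of_le hx.1] at ht
      exact e2 t ⟨ht.1, ht.2.trans hx.2⟩
  refine ⟨u, fun x hx => ⟨?_, e1 x hx, e2 x hx⟩⟩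
  have h1 := integral_eq_sub_of_hasDerivWithinAt_Icc h.deriv_y h.cont_y₁ hx
  have h2 := integral_eq_sub_of_hasDerivWithinAt_Icc
    (fun x _ => (H2b.hasDerivAt_val u x).hasDerivWithinAt) (H2b.continuous_der u).continuousOn hx
  rw [intervalIntegral.integral_congr (g := y₁) fun t ht => ?_, h1] at h2
  · have e0 : H2b.val 0 u = y 0 := H2b.val_zero u
    linarith
  · rw [uIcc_of_le hx.1] at ht
    exact e1 t ⟨ht.1, ht.2.trans hx.2⟩

theorem fullEnergy_eq {κ : ℕ} {a d : ℝ} {μ : Measure ℝ} [IsProbabilityMeasure μ]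
    [NullSingletonClass μ] (hF : SelfSimilarCDF F κ a d)
    (hμ : ∀ x, μ (Iic x) = ENNReal.ofReal (F x)) (hβ : 0 < β)
    (h : ClassicalSolution F α β lam y y₁ y₂ y₃) (h' : ClassicalSolution F α β lam' z z₁ z₂ z₃)
    {u v : H2b}
    (hu : ∀ x ∈ Icc (0 : ℝ) 1, H2b.val x u = y x ∧ H2b.der x u = y₁ x ∧ H2b.dd u x = y₂ x)
    (hv : ∀ x ∈ Icc (0 : ℝ) 1, H2b.val x v = z x ∧ H2b.der x v = z₁ x ∧ H2b.dd v x = z₂ x) :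
    H2.fullEnergy α β (H2b.toH2 u) (H2b.toH2 v) =
      lam * H2.mass μ (H2b.toH2 u) (H2b.toH2 v) := by
  have m0 : (0 : ℝ) ∈ Icc (0 : ℝ) 1 := left_mem_Icc.2 zero_le_one
  have m1 : (1 : ℝ) ∈ Icc (0 : ℝ) 1 := right_mem_Icc.2 zero_le_one
  have hFc := hF.cont.continuousOn (s := Icc (0 : ℝ) 1)
  have F0 : F 0 = 0 := hF.of_nonpos 0 le_rfl
  have F1 : F 1 = 1 := hF.of_one_le 1 le_rfl
  have hmass : H2.mass μ (H2b.toH2 u) (H2b.toH2 v) =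
      y 1 * z 1 - ∫ x in (0 : ℝ)..1, (y₁ x * z x + y x * z₁ x) * F x := by
    rw [H2b.mass_toH2, integral_Icc_eq_integral_Ioc, hF.setIntegral_Ioc hμ
      (f := fun x => H2b.val x u * H2b.val x v)
      (fun x => (H2b.hasDerivAt_val u x).mul (H2b.hasDerivAt_val v x))
      (((H2b.continuous_der u).mul (H2b.continuous_val v)).add
        ((H2b.continuous_val u).mul (H2b.continuous_der v))) zero_le_one, F1, mul_one,
      (hu 1 m1).1, (hv 1 m1).1]
    congr 1
    refine intervalIntegral.integral_congr fun x hx => ?_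
    rw [uIcc_of_le zero_le_one] at hx
    simp only [(hu x hx).1, (hu x hx).2.1, (hv x hx).1, (hv x hx).2.1]
  have henergy : H2.energy (H2b.toH2 u) (H2b.toH2 v) = ∫ x in (0 : ℝ)..1, y₂ x * z₂ x := by
    rw [H2b.energy_toH2]
    refine intervalIntegral.integral_congr fun x hx => ?_
    rw [uIcc_of_le zero_le_one] at hx
    simp only [(hu x hx).2.2, (hv x hx).2.2]
  have c1 : ContinuousOn (fun x => y₂ x * z₂ x) (Icc 0 1) := h.cont_y₂.mul h'.cont_y₂
  have c2 : ContinuousOn (fun x => (y₁ x * z x + y x * z₁ x) * F x) (Icc 0 1) :=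
    ((h.cont_y₁.mul h'.cont_y).add (h.cont_y.mul h'.cont_y₁)).mul hFc
  have c3 : ContinuousOn (fun x => lam * ((y₁ x * z x + y x * z₁ x) * F x)) (Icc 0 1) :=
    continuousOn_const.mul c2
  have hparts := integral_eq_sub_of_hasDerivWithinAt_Icc
    (f := fun x => y₂ x * z₁ x - (y₃ x - lam * F x * y x) * z x)
    (f' := fun x => y₂ x * z₂ x + lam * ((y₁ x * z x + y x * z₁ x) * F x))
    (fun x hx => (((h.deriv_y₂ x hx).mul (h'.deriv_y₁ x hx)).sub
      ((h.deriv_y₃ x hx).mul (h'.deriv_y x hx))).congr_deriv (by ring))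
    (c1.add c3) m1
  rw [intervalIntegral.integral_add (c1.intervalIntegrable_of_Icc zero_le_one)
    (c3.intervalIntegrable_of_Icc zero_le_one),
    intervalIntegral.integral_const_mul, ← henergy] at hparts
  have b1 : y₂ 1 = -(α * y 1 + β * y₁ 1) := by linarith [h.bc_one]
  have b0 : y₂ 0 = β * y₁ 0 - α * y 0 := by linarith [h.bc_zero]
  have b1' : y₃ 1 = β⁻¹ * (α * (α * y 1 + β * y₁ 1)) := by
    rw [inv_mul_eq_div, eq_div_iff hβ.ne']
    have := h.bc_one'
    rw [b1] at this
    linarith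
  have b0' : y₃ 0 = β⁻¹ * (α * (β * y₁ 0 - α * y 0)) := by
    rw [inv_mul_eq_div, eq_div_iff hβ.ne']
    have := h.bc_zero'
    rw [b0] at this
    linarith
  rw [H2.fullEnergy_apply, hmass, H2b.val0_toH2, H2b.val0_toH2, H2b.der0_toH2, H2b.der0_toH2,
    H2b.ev_toH2 u m1, H2b.ev_toH2 v m1, H2b.der1_toH2, H2b.der1_toH2, ← H2b.val_zero u,
    ← H2b.val_zero v, ← H2b.der_zero u, ← H2b.der_zero v, (hu 0 m0).1, (hu 0 m0).2.1,
    (hv 0 m0).1, (hv 0 m0).2.1, (hu 1 m1).1, (hu 1 m1).2.1, (hv 1 m1).1, (hv 1 m1).2.1]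
  simp only [F0, F1, b0, b1, b0', b1'] at hparts
  have hβ' : β⁻¹ * β = 1 := inv_mul_cancel₀ hβ.ne'
  linear_combination hparts + ((α * y 1 + β * y₁ 1) * z₁ 1 + (β * y₁ 0 - α * y 0) * z₁ 0) * hβ'

end ClassicalSolution

end WeakForm

section Regularity

open MeasureTheory

open scoped InnerProductSpace

theorem L2I.inner_toLp_left {f : ℝ → ℝ} (hf : MemLp f 2 (volume.restrict (Icc (0 : ℝ) 1)))
    (w : L2I) : ⟪hf.toLp f, w⟫_ℝ = ∫ t in Icc (0 : ℝ) 1, f t * w t := by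
  rw [L2.inner_def]
  refine integral_congr_ae ?_
  filter_upwards [hf.coeFn_toLp] with t h1
  rw [h1]
  simp [mul_comm]

/-- The load potential `∫ Y(x) (x - t)⁺ dμ(x)`. -/
noncomputable def potential (μ : Measure ℝ) (Y : ℝ → ℝ) (t : ℝ) : ℝ :=
  ∫ x in Icc 0 1, Y x * max (x - t) 0 ∂μ

theorem continuous_potential (μ : Measure ℝ) [IsFiniteMeasure μ] {Y : ℝ → ℝ} (hY : Continuous Y) :
    Continuous (potential μ Y) :=
  continuous_parametric_integral_of_continuous (f := fun t x => Y x * max (x - t) 0)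
    (by fun_prop) isCompact_Icc

theorem integral_mul_inner_rampL2 (μ : Measure ℝ) [IsFiniteMeasure μ] {Y : ℝ → ℝ}
    (hY : Continuous Y) (w : L2I) :
    ∫ x in Icc 0 1, Y x * ⟪rampL2 x, w⟫_ℝ ∂μ = ∫ t in Icc 0 1, potential μ Y t * w t := by
  have hint : Integrable (Function.uncurry fun x t : ℝ => Y x * max (x - t) 0 * w t)
      ((μ.restrict (Icc 0 1)).prod (volume.restrict (Icc 0 1))) := by
    have hg : Continuous fun p : ℝ × ℝ => Y p.1 * max (p.1 - p.2) 0 := by fun_prop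
    obtain ⟨C, hC⟩ := (isCompact_Icc.prod isCompact_Icc).exists_bound_of_continuousOn
      (hg.continuousOn (s := Icc (0 : ℝ) 1 ×ˢ Icc (0 : ℝ) 1))
    refine (((Lp.memLp w).integrable one_le_two).comp_snd (μ.restrict (Icc 0 1))).bdd_mul
      (c := C) hg.aestronglyMeasurable ?_
    rw [Measure.prod_restrict]
    exact (ae_restrict_iff' (measurableSet_Icc.prod measurableSet_Icc)).2
      (Eventually.of_forall hC)
  calc ∫ x in Icc 0 1, Y x * ⟪rampL2 x, w⟫_ℝ ∂μ
      = ∫ x in Icc 0 1, (∫ t in Icc 0 1, Y x * max (x - t) 0 * w t) ∂μ := by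
        simp only [rampL2, L2I.inner_toLp_left, mul_assoc, integral_const_mul]
    _ = ∫ t in Icc 0 1, (∫ x in Icc 0 1, Y x * max (x - t) 0 * w t ∂μ) :=
        integral_integral_swap hint
    _ = _ := by simp only [potential, integral_mul_const]

namespace H2

variable {F : ℝ → ℝ} {κ : ℕ} {a d α β lam : ℝ} {μ : Measure ℝ} [IsProbabilityMeasure μ]

theorem exists_toH2_of_weak {v : H2}
    (hv : ∀ z, fullEnergy α β v z = lam * mass μ v z) :
    ∃ u : H2b, H2b.toH2 u = v ∧ ∀ t ∈ Icc (0 : ℝ) 1, u.dd t =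
      lam * potential μ (fun x => ev x v) t -
        β⁻¹ * (α * ev 1 v + β * der1 v) * (α * (1 - t) + β) := by
  set A := α * ev 1 v + β * der1 v
  set p := potential μ fun x => ev x v
  have hp : Continuous p := continuous_potential μ (continuous_ev v)
  let f : ℝ → ℝ := fun t => lam * p t - β⁻¹ * A * (α * max (1 - t) 0 + β)
  have hf : Continuous f := by fun_prop
  let W : BddMeas := ⟨clamp f, clamp_mem_bddMeas hf.continuousOn⟩
  refine ⟨(val0 v, der0 v, W), ?_, fun t ht => ?_⟩
  · change (val0 v, der0 v, BddMeas.toL2 W) = v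
    suffices BddMeas.toL2 W = dd v by rw [this]; rfl
    refine ext_inner_right ℝ fun w => ?_
    have h1 := hv (0, 0, w)
    have e0 : val0 ((0, 0, w) : H2) = 0 := rfl
    have e1 : der0 ((0, 0, w) : H2) = 0 := rfl
    have e2 : dd ((0, 0, w) : H2) = w := rfl
    have hI : ∀ g : ℝ → ℝ, Continuous g → Integrable (fun t => g t * w t)
        (volume.restrict (Icc (0 : ℝ) 1)) := fun g hg => by
      obtain ⟨C, hC⟩ := isCompact_Icc.exists_bound_of_continuousOn
        (hg.continuousOn (s := Icc (0 : ℝ) 1))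
      exact ((Lp.memLp w).integrable one_le_two).bdd_mul (c := C) hg.aestronglyMeasurable
        ((ae_restrict_iff' measurableSet_Icc).2 (Eventually.of_forall hC))
    simp only [fullEnergy_apply, energy_apply, mass_apply, ev_apply _ (0, 0, w),
      der1_apply (0, 0, w),
      e0, e1, e2, mul_zero, zero_add, sub_zero, add_zero] at h1
    rw [integral_mul_inner_rampL2 μ (continuous_ev v), rampL2, oneL2, L2I.inner_toLp_left,
      L2I.inner_toLp_left] at h1
    have i1 := hI (fun t => max (1 - t) 0) (by fun_prop)
    have i2 := hI (fun _ => 1) continuous_const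
    have i3 : Integrable (fun t => α * (max (1 - t) 0 * w t) + β * (1 * w t))
        (volume.restrict (Icc (0 : ℝ) 1)) := (i1.const_mul α).add (i2.const_mul β)
    rw [BddMeas.toL2_eq, L2I.inner_toLp_left, setIntegral_congr_fun measurableSet_Icc
      (g := fun t => lam * (p t * w t) - β⁻¹ * A * (α * (max (1 - t) 0 * w t) + β * (1 * w t)))
      fun t ht => ?_, integral_sub ((hI p hp).const_mul _) (i3.const_mul _),
      integral_const_mul, integral_const_mul, integral_add (i1.const_mul α) (i2.const_mul β),
      integral_const_mul, integral_const_mul]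
    · linarith
    · simp only [W, clamp_eq f ht, f]; ring
  · change clamp f t = _
    rw [clamp_eq f ht]
    simp only [f, max_eq_left (sub_nonneg.2 ht.2)]

theorem exists_classicalSolution_of_weak (h : SelfSimilarCDF F κ a d) [NullSingletonClass μ]
    (hμ : ∀ x, μ (Iic x) = ENNReal.ofReal (F x)) (hβ : β ≠ 0) {v : H2}
    (hv : ∀ z, fullEnergy α β v z = lam * mass μ v z) :
    ∃ u : H2b, H2b.toH2 u = v ∧ ∃ y₂ y₃, ClassicalSolution F α β lam
      (fun x => H2b.val x u) (fun x => H2b.der x u) y₂ y₃ := by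
  obtain ⟨u, rfl, hu⟩ := exists_toH2_of_weak hv
  refine ⟨u, rfl, ?_⟩
  have m1 : (1 : ℝ) ∈ Icc (0 : ℝ) 1 := right_mem_Icc.2 zero_le_one
  have F0 : F 0 = 0 := h.of_nonpos 0 le_rfl
  have F1 : F 1 = 1 := h.of_one_le 1 le_rfl
  have hFc := h.cont
  have cy := H2b.continuous_val u
  have cy' := H2b.continuous_der u
  set y : ℝ → ℝ := fun x => H2b.val x u with hy
  set y' : ℝ → ℝ := fun x => H2b.der x u with hy'
  have dy : ∀ x, HasDerivAt y (y' x) x := H2b.hasDerivAt_val u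
  rw [H2b.ev_toH2 u m1, H2b.der1_toH2] at hu
  change ∀ t ∈ Icc (0 : ℝ) 1, u.dd t = lam * potential μ (fun x => H2.ev x (H2b.toH2 u)) t -
    β⁻¹ * (α * y 1 + β * y' 1) * (α * (1 - t) + β) at hu
  set A := α * y 1 + β * y' 1 with hA
  let J : ℝ → ℝ := fun t => ∫ x in (0 : ℝ)..t, y' x * F x
  let K : ℝ → ℝ := fun t => ∫ x in (0 : ℝ)..t, (y' x * x + y x) * F x
  have cJ : Continuous fun x => y' x * F x := cy'.mul hFc
  have cK : Continuous fun x => (y' x * x + y x) * F x := by fun_prop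
  have dJ : ∀ t, HasDerivAt J (y' t * F t) t := fun t =>
    (cJ.integral_hasStrictDerivAt 0 t).hasDerivAt
  have dK : ∀ t, HasDerivAt K ((y' t * t + y t) * F t) t := fun t =>
    (cK.integral_hasStrictDerivAt 0 t).hasDerivAt
  have moment : ∀ t s, 0 ≤ s → ∫ x in Ioc 0 s, y x * (x - t) ∂μ =
      y s * (s - t) * F s - (K s - t * J s) := by
    intro t s hs
    have ctJ : Continuous fun x => t * (y' x * F x) := continuous_const.mul cJ
    rw [h.setIntegral_Ioc hμ (f := fun x => y x * (x - t)) (f' := fun x => y' x * (x - t) + y x)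
      (fun x => ((dy x).mul ((hasDerivAt_id x).sub_const t)).congr_deriv (by simp))
      (by fun_prop) hs]
    congr 1
    rw [← intervalIntegral.integral_const_mul, ← intervalIntegral.integral_sub
      (cK.intervalIntegrable _ _) (ctJ.intervalIntegrable _ _)]
    exact intervalIntegral.integral_congr fun x _ => by ring
  have hpot : ∀ t ∈ Icc (0 : ℝ) 1, potential μ (fun x => H2.ev x (H2b.toH2 u)) t =
      y 1 * (1 - t) - (K 1 - K t) + t * (J 1 - J t) := by
    intro t ht
    have cg : Continuous fun x => y x * max (x - t) 0 := by fun_prop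
    have cg' : Continuous fun x => y x * (x - t) := by fun_prop
    have e1 : potential μ (fun x => H2.ev x (H2b.toH2 u)) t =
        ∫ x in Ioc 0 1, y x * max (x - t) 0 ∂μ := by
      rw [← integral_Icc_eq_integral_Ioc]
      exact setIntegral_congr_fun measurableSet_Icc fun x hx => by
        simp only [H2b.ev_toH2 u hx, hy]
    have hdisj : Disjoint (Ioc 0 t) (Ioc t 1) := Ioc_disjoint_Ioc_of_le le_rfl
    have hun : Ioc 0 t ∪ Ioc t 1 = Ioc 0 1 := Ioc_union_Ioc_eq_Ioc ht.1 ht.2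
    have e2 := setIntegral_union (μ := μ) hdisj measurableSet_Ioc (h.integrable hμ cg).integrableOn
      (h.integrable hμ cg).integrableOn
    have e3 := setIntegral_union (μ := μ) hdisj measurableSet_Ioc (h.integrable hμ cg').integrableOn
      (h.integrable hμ cg').integrableOn
    have e4 : ∫ x in Ioc 0 t, y x * max (x - t) 0 ∂μ = 0 :=
      setIntegral_eq_zero_of_forall_eq_zero fun x hx => by
        rw [max_eq_right (sub_nonpos.2 hx.2), mul_zero]
    have e5 : ∫ x in Ioc t 1, y x * max (x - t) 0 ∂μ = ∫ x in Ioc t 1, y x * (x - t) ∂μ :=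
      setIntegral_congr_fun measurableSet_Ioc fun x hx => by
        simp only [max_eq_left (sub_nonneg.2 hx.1.le)]
    rw [hun] at e2 e3
    rw [moment t 1 zero_le_one, moment t t ht.1, F1] at e3
    rw [e1, e2, e4, e5]
    linarith
  let y₂ : ℝ → ℝ := fun t => lam * (y 1 * (1 - t) - (K 1 - K t) + t * (J 1 - J t)) -
    β⁻¹ * A * (α * (1 - t) + β)
  let y₃ : ℝ → ℝ := fun t => lam * (-y 1 + y t * F t + J 1 - J t) + β⁻¹ * A * α
  have dy₂ : ∀ t, HasDerivAt y₂ (y₃ t) t := fun t => by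
    have i := hasDerivAt_id t
    refine (((((i.const_sub 1).const_mul (y 1)).sub ((dK t).const_sub (K 1))).add
      (i.mul ((dJ t).const_sub (J 1)))).const_mul lam |>.sub
      ((((i.const_sub 1).const_mul α).add_const β).const_mul (β⁻¹ * A))).congr_deriv ?_
    simp only [y₃, id]
    ring
  have cy₂ : Continuous y₂ := continuous_iff_continuousAt.2 fun t => (dy₂ t).continuousAt
  have hdd : ∀ t ∈ Icc (0 : ℝ) 1, u.dd t = y₂ t := fun t ht => by rw [hu t ht, hpot t ht]
  have hK0 : K 0 = 0 := intervalIntegral.integral_same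
  have hJ0 : J 0 = 0 := intervalIntegral.integral_same
  have hmass : ∀ z : H2, mass μ (H2b.toH2 u) z = ∫ x in Ioc 0 1, y x * ev x z ∂μ := fun z => by
    rw [mass_apply, ← integral_Icc_eq_integral_Ioc]
    exact setIntegral_congr_fun measurableSet_Icc fun x hx => by simp only [H2b.ev_toH2 u hx, hy]
  have m := moment 0 1 zero_le_one
  have m' : ∫ x in Ioc 0 1, y x ∂μ = y 1 - J 1 := by
    rw [h.setIntegral_Ioc hμ dy cy' zero_le_one, F1, mul_one]
  have w0 := hv (1, 0, 0)
  have w1 := hv (0, 1, 0)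
  rw [fullEnergy_apply, hmass, energy_apply] at w0 w1
  have ev0 : ∀ x, ev x ((1, 0, 0) : H2) = 1 := fun x => by simp [ev_apply, val0, der0, dd]
  have ev1 : ∀ x, ev x ((0, 1, 0) : H2) = x := fun x => by simp [ev_apply, val0, der0, dd]
  have der10 : der1 ((1, 0, 0) : H2) = 0 := by simp [der1_apply, der0, dd]
  have der11 : der1 ((0, 1, 0) : H2) = 1 := by simp [der1_apply, der0, dd]
  have v00 : val0 ((1, 0, 0) : H2) = 1 := rfl
  have v01 : val0 ((0, 1, 0) : H2) = 0 := rfl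
  have d00 : der0 ((1, 0, 0) : H2) = 0 := rfl
  have d01 : der0 ((0, 1, 0) : H2) = 1 := rfl
  have dd0 : dd ((1, 0, 0) : H2) = 0 := rfl
  have dd1 : dd ((0, 1, 0) : H2) = 0 := rfl
  have hval : val0 (H2b.toH2 u) = y 0 := (H2b.val_zero u).symm
  have hder : der0 (H2b.toH2 u) = y' 0 := (H2b.der_zero u).symm
  have hAA : α * ev 1 (H2b.toH2 u) + β * der1 (H2b.toH2 u) = A := by
    rw [H2b.ev_toH2 u m1, H2b.der1_toH2]
  simp only [ev0, der10, v00, d00, dd0, inner_zero_right, mul_one, mul_zero, m', hval, hder, hAA,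
    zero_add, add_zero, zero_sub] at w0
  simp only [ev1, der11, v01, d01, dd1, inner_zero_right, mul_one, mul_zero, hval, hder, hAA,
    zero_add, sub_zero] at w1
  simp only [sub_zero, zero_mul, mul_one, F1] at m
  rw [m] at w1
  have hβ' : β * β⁻¹ = 1 := mul_inv_cancel₀ hβ
  refine ⟨y₂, y₃, fun x _ => (dy x).hasDerivWithinAt, fun x hx => ?_,
    fun x _ => (dy₂ x).hasDerivWithinAt, ?_, fun x _ => ?_, ?_, ?_, ?_, ?_⟩
  · have : HasDerivAt (fun x => u.2.1 + ∫ t in (0 : ℝ)..x, y₂ t) (y₂ x) x :=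
      ((cy₂.integral_hasStrictDerivAt 0 x).hasDerivAt).const_add _
    have e : ∀ s ∈ Icc (0 : ℝ) 1, y' s = u.2.1 + ∫ t in (0 : ℝ)..s, y₂ t := fun s hs => by
      simp only [hy', H2b.der_apply]
      congr 1
      refine intervalIntegral.integral_congr fun t ht => ?_
      rw [uIcc_of_le hs.1] at ht
      exact hdd t ⟨ht.1, ht.2.trans hs.2⟩
    exact this.hasDerivWithinAt.congr e (e x hx)
  · have cJ' : Continuous J := continuous_iff_continuousAt.2 fun t => (dJ t).continuousAt
    exact Continuous.continuousOn (by fun_prop)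
  · have : HasDerivAt (fun t => lam * (-y 1 + J 1 - J t) + β⁻¹ * A * α) (-(lam * F x * y' x)) x :=
      ((((dJ x).const_sub (-y 1 + J 1)).const_mul lam).add_const _).congr_deriv (by ring)
    refine this.hasDerivWithinAt.congr (fun t _ => ?_) ?_ <;> simp only [y₃] <;> ring
  · simp only [y₂, hK0, hJ0]
    linear_combination -w1 + (β * y' 0 - α * y 0) * hβ'
  · simp only [y₂, y₃, hK0, hJ0, F0]
    linear_combination -β * w0 - α * w1
  · simp only [y₂, hA]
    linear_combination -(α * y 1 + β * y' 1) * hβ'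
  · simp only [y₂, y₃, F1]
    ring

end H2

end Regularity

section Counting

open MeasureTheory

namespace H2

variable {F : ℝ → ℝ} {κ : ℕ} {a d α β lam : ℝ} {μ : Measure ℝ} [IsProbabilityMeasure μ]
  [NullSingletonClass μ]

theorem eq_zero_of_mass_eq_zero (h : SelfSimilarCDF F κ a d)
    (hμ : ∀ x, μ (Iic x) = ENNReal.ofReal (F x)) (hβ : 0 < β) {v : H2}
    (hv : fullEnergy α β v v = lam * mass μ v v) (hm : mass μ v v = 0) : v = 0 := by
  obtain ⟨C, hC, hb⟩ := exists_coercive h hμ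
  have h1 := hb v
  have h2 := energy_le_fullEnergy α hβ v
  rw [hv, hm, mul_zero] at h2
  have h3 : C * (energy v v + mass μ v v) ≤ 0 := by
    rw [hm, add_zero]; exact mul_nonpos_of_nonneg_of_nonpos hC.le h2
  have h4 : ‖v‖ ^ 2 ≤ 0 := (norm_le v).trans (h1.trans h3)
  simpa using h4

theorem le_norm (v : H2) : val0 v ^ 2 + der0 v ^ 2 + ‖dd v‖ ^ 2 ≤ 3 * ‖v‖ ^ 2 := by
  have h1 := sq_le_sq.2 ((abs_val0_le v).trans_eq (abs_norm v).symm)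
  have h2 := sq_le_sq.2 ((abs_der0_le v).trans_eq (abs_norm v).symm)
  have h3 := pow_le_pow_left₀ (norm_nonneg _) (norm_dd_le v) 2
  linarith

theorem mass_eq_zero_of_ev (μ : Measure ℝ) [IsFiniteMeasure μ] {v : H2}
    (hv : ∀ x ∈ Icc (0 : ℝ) 1, ev x v = 0) : mass μ v v = 0 := by
  rw [mass_apply]
  exact setIntegral_eq_zero_of_forall_eq_zero fun x hx => by rw [hv x hx, zero_mul]

theorem eq_zero_of_weak (h : SelfSimilarCDF F κ a d)
    (hμ : ∀ x, μ (Iic x) = ENNReal.ofReal (F x)) (hα : 0 ≤ α) (hβ : 0 < β) (hlam : 0 ≤ lam) {v : H2}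
    (hv : ∀ z, fullEnergy α β v z = lam * mass μ v z) (h0 : val0 v = 0) : v = 0 := by
  obtain ⟨u, rfl, y₂, y₃, hu⟩ := exists_classicalSolution_of_weak h hμ hβ.ne' hv
  have := hu.eq_zero h.mono (h.of_nonpos 0 le_rfl) (h.of_one_le 1 le_rfl) hα hβ hlam
    ((H2b.val_zero u).trans h0)
  exact eq_zero_of_mass_eq_zero h hμ hβ (hv _) (mass_eq_zero_of_ev μ fun x hx => by
    rw [H2b.ev_toH2 u hx, this x hx])

theorem exists_span_weak (h : SelfSimilarCDF F κ a d)
    (hμ : ∀ x, μ (Iic x) = ENNReal.ofReal (F x)) (hα : 0 ≤ α) (hβ : 0 < β) (lam : ℝ) :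
    ∃ e : H2, 0 ≤ lam → ∀ v, (∀ z, fullEnergy α β v z = lam * mass μ v z) → ∃ t : ℝ, v = t • e := by
  by_cases hex : ∃ e : H2, e ≠ 0 ∧ ∀ z, fullEnergy α β e z = lam * mass μ e z
  · obtain ⟨e, he0, he⟩ := hex
    refine ⟨e, fun hlam v hv => ⟨val0 v / val0 e, ?_⟩⟩
    have hve : val0 e ≠ 0 := fun hc => he0 (eq_zero_of_weak h hμ hα hβ hlam he hc)
    refine sub_eq_zero.1 (eq_zero_of_weak h hμ hα hβ hlam (fun z => ?_) ?_)
    · simp only [map_sub, map_smul, LinearMap.sub_apply, LinearMap.smul_apply, smul_eq_mul, hv, he]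
      ring
    · simp only [map_sub, map_smul, smul_eq_mul]
      field_simp
      ring
  · push Not at hex
    refine ⟨0, fun _ v hv => ⟨0, ?_⟩⟩
    by_contra hc
    obtain ⟨z, hz⟩ := hex v (by simpa using hc)
    exact hz (hv z)

end H2

variable {P : ℝ → ℝ} {κ : ℕ} {a d α β lam : ℝ} {μ : Measure ℝ} [IsProbabilityMeasure μ]
  [NullSingletonClass μ]

theorem negDim_quad_of_isEigenvalue (h : SelfSimilarCDF (clamp P) κ a d)
    (hμ : ∀ x, μ (Iic x) = ENNReal.ofReal (clamp P x)) (hβ : 0 < β) {n : ℕ} {e : Fin n → ℝ}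
    (he : Function.Injective e) (hev : ∀ i, IsEigenvalue P α β (e i)) (hlt : ∀ i, e i < lam) :
    NegDim (H2b.quad μ 0 lam) n := by
  choose y hy using hev
  have sol := fun i => (hy i).classicalSolution
  choose u hu using fun i => (sol i).exists_H2b
  let w := fun i => H2b.toH2 (u i)
  have hQ : ∀ i j, H2.fullEnergy α β (w i) (w j) = e i * H2.mass μ (w i) (w j) := fun i j =>
    ClassicalSolution.fullEnergy_eq h hμ hβ (sol i) (sol j) (hu i) (hu j)
  have horth : ∀ i j, i ≠ j → H2.mass μ (w i) (w j) = 0 := fun i j hij => by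
    have h1 := hQ i j
    rw [H2.fullEnergy_comm, hQ j i, H2.mass_comm] at h1
    have h2 : (e j - e i) * H2.mass μ (w i) (w j) = 0 := by linarith
    exact (mul_eq_zero.1 h2).resolve_left (sub_ne_zero.2 (he.ne hij.symm))
  have hpos : ∀ i, 0 < H2.mass μ (w i) (w i) := fun i => by
    refine lt_of_le_of_ne (H2.mass_self_nonneg μ _) fun hc => ?_
    have h0 : w i = 0 := H2.eq_zero_of_mass_eq_zero h hμ hβ (hQ i i) hc.symm
    obtain ⟨x, hx, hne⟩ := (hy i).1
    rw [← (hu i x hx).1, ← H2b.ev_toH2 (u i) hx] at hne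
    exact hne (by change H2.ev x (w i) = 0; rw [h0, map_zero])
  refine ⟨Fintype.linearCombination ℝ u, fun c hc => ?_⟩
  set v := Fintype.linearCombination ℝ u c
  have hv : H2b.toH2 v = ∑ i, c i • w i := by simp [v, w, Fintype.linearCombination_apply]
  have hle : H2b.quad μ 0 lam v ≤ H2.fullEnergy α β (H2b.toH2 v) (H2b.toH2 v) -
      lam * H2.mass μ (H2b.toH2 v) (H2b.toH2 v) := by
    rw [H2b.quad, H2b.bend_eq_energy, H2b.msq_eq_mass h hμ, zero_mul, add_zero]
    exact sub_le_sub_right (H2.energy_le_fullEnergy α hβ _) _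
  refine hle.trans_lt ?_
  have hsum : H2.fullEnergy α β (H2b.toH2 v) (H2b.toH2 v) -
      lam * H2.mass μ (H2b.toH2 v) (H2b.toH2 v) =
      ∑ i, c i ^ 2 * ((e i - lam) * H2.mass μ (w i) (w i)) := by
    rw [hv]
    simp only [map_sum, map_smul, LinearMap.sum_apply, LinearMap.smul_apply, smul_eq_mul,
      Finset.mul_sum, ← Finset.sum_sub_distrib, hQ]
    refine Finset.sum_congr rfl fun i _ => ?_
    rw [Finset.sum_eq_single i]
    · ring
    · intro j _ hj
      rw [horth j i hj]
      ring
    · simp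
  rw [hsum]
  obtain ⟨i, hi⟩ := Function.ne_iff.1 hc
  refine Finset.sum_neg' (fun j _ => ?_) ⟨i, Finset.mem_univ _, ?_⟩
  · exact mul_nonpos_of_nonneg_of_nonpos (sq_nonneg _)
      (mul_nonpos_of_nonpos_of_nonneg (sub_nonpos.2 (hlt j).le) (hpos j).le)
  · exact mul_neg_of_pos_of_neg (sq_pos_of_ne_zero hi)
      (mul_neg_of_neg_of_pos (sub_neg.2 (hlt i)) (hpos i))

theorem posCodim_fullEnergy (h : SelfSimilarCDF (clamp P) κ a d)
    (hμ : ∀ x, μ (Iic x) = ENNReal.ofReal (clamp P x)) (hα : 0 ≤ α) (hβ : 0 < β) (hlam : 0 < lam)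
    {S : Finset ℝ} (hS : ∀ θ, IsEigenvalue P α β θ → θ < lam → θ ∈ S) :
    PosCodim (fun v => H2.fullEnergy α β v v - lam * H2.mass μ v v) S.card := by
  choose e he using H2.exists_span_weak (α := α) (β := β) h hμ hα hβ
  let B : LinearMap.BilinForm ℝ H2 := H2.fullEnergy α β + H2.mass μ
  have hB : ∀ v z, B v z = H2.fullEnergy α β v z + H2.mass μ v z := fun v z => rfl
  refine PosCodim.of_finrank (E := S → ℝ) (by simp) (LinearMap.pi fun s : S => B (e s))
    fun v hv => ?_
  have hQ0 : ∀ z, 0 ≤ H2.fullEnergy α β z z := fun z =>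
    (H2.energy_self_nonneg z).trans (H2.energy_le_fullEnergy α hβ z)
  obtain ⟨C, hC, hb⟩ := H2.exists_coercive h hμ
  have key : H2.mass μ v v ≤ (1 + lam)⁻¹ * B v v := by
    have hK : 0 ≤ β⁻¹ * (2 * (α ^ 2 + β ^ 2)) := by positivity
    refine form_le_of_orthogonal_eigenvectors (LinearEquiv.refl ℝ H2) B (H2.mass μ)
      (fun v z => by rw [hB, hB, H2.fullEnergy_comm, H2.mass_comm]) (H2.mass_comm μ)
      (H2.mass_self_nonneg μ) (fun z => by rw [hB]; linarith [hQ0 z])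
      (c := C⁻¹) (C := 3 * (1 + β⁻¹ * (2 * (α ^ 2 + β ^ 2)) * 6 + 3))
      (inv_pos.2 hC) (fun z => ?_) (fun z => ?_) (fun ε hε => ?_) (by positivity)
      fun u θ hθ hu => ?_
    · rw [inv_mul_le_iff₀ hC, LinearEquiv.refl_apply]
      refine (H2.norm_le z).trans ((hb z).trans (mul_le_mul_of_nonneg_left ?_ hC.le))
      rw [hB]
      exact add_le_add_left (H2.energy_le_fullEnergy α hβ z) _
    · have h1 := H2.fullEnergy_le α hβ z
      have h2 := mul_le_mul_of_nonneg_left (H2.trace_le z) hK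
      have h3 := H2.mass_self_le μ z
      have h4 : H2.val0 z ^ 2 + H2.der0 z ^ 2 + ‖H2.dd z‖ ^ 2 ≤ 3 * ‖z‖ ^ 2 := H2.le_norm z
      rw [H2.energy_self] at h1
      have h5 := mul_le_mul_of_nonneg_left h4
        (show 0 ≤ 1 + β⁻¹ * (2 * (α ^ 2 + β ^ 2)) * 6 + 3 by positivity)
      rw [hB, LinearEquiv.refl_apply]
      nlinarith [sq_nonneg (H2.val0 z), sq_nonneg (H2.der0 z)]
    · obtain ⟨n, l, hl⟩ := H2.exists_mass_le_energy μ hε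
      refine ⟨n, l, fun z hz => (hl z hz).trans (mul_le_mul_of_nonneg_left ?_ hε.le)⟩
      rw [hB]
      linarith [H2.energy_le_fullEnergy α hβ z, H2.mass_self_nonneg μ z]
    · by_cases hu0 : u = 0
      · simp [hu0]
      have hθ0 : 0 < θ := lt_trans (by positivity) hθ
      have hw : ∀ z, H2.fullEnergy α β u z = (θ⁻¹ - 1) * H2.mass μ u z := fun z => by
        have := hu z
        rw [hB] at this
        rw [sub_mul, this, inv_mul_cancel_left₀ hθ0.ne']
        linarith
      have hmu : 0 < H2.mass μ u u := lt_of_le_of_ne (H2.mass_self_nonneg μ u) fun hc =>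
        hu0 (H2.eq_zero_of_mass_eq_zero h hμ hβ (hw u) hc.symm)
      have h0 : 0 ≤ θ⁻¹ - 1 := by
        have := hQ0 u
        rw [hw u] at this
        exact nonneg_of_mul_nonneg_left this hmu
      have hlt : θ⁻¹ - 1 < lam := by
        have := inv_lt_of_inv_lt₀ (by positivity) hθ
        linarith
      obtain ⟨u', hu', y₂, y₃, hsol⟩ := H2.exists_classicalSolution_of_weak h hμ hβ.ne' hw
      have hmem : θ⁻¹ - 1 ∈ S := by
        refine hS _ ⟨_, hsol.eigenfunction ?_⟩ hlt
        by_contra hc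
        unfold Nontrivial01 at hc
        push Not at hc
        refine hmu.ne' (H2.mass_eq_zero_of_ev μ fun x hx => ?_)
        rw [← hu', H2b.ev_toH2 u' hx]
        exact hc x hx
      obtain ⟨t, ht⟩ := he _ h0 u hw
      have hv' : B (e (θ⁻¹ - 1)) v = 0 := congrFun hv ⟨_, hmem⟩
      rw [ht, map_smul, LinearMap.smul_apply, hv', smul_zero]
  rw [inv_mul_eq_div, le_div_iff₀ (by positivity), hB] at key
  linarith

theorem finite_isEigenvalue_lt (h : SelfSimilarCDF (clamp P) κ a d)
    (hμ : ∀ x, μ (Iic x) = ENNReal.ofReal (clamp P x)) (hβ : 0 < β) {n : ℕ}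
    (hn : PosCodim (H2b.quad μ 0 lam) n) :
    {θ | IsEigenvalue P α β θ ∧ θ < lam}.Finite ∧
      {θ | IsEigenvalue P α β θ ∧ θ < lam}.ncard ≤ n := by
  have key : ∀ T : Finset ℝ, (T : Set ℝ) ⊆ {θ | IsEigenvalue P α β θ ∧ θ < lam} → T.card ≤ n :=
    fun T hT => (negDim_quad_of_isEigenvalue h hμ hβ (e := fun i => (T.equivFin.symm i : ℝ))
      (Subtype.val_injective.comp T.equivFin.symm.injective)
      (fun i => (hT (T.equivFin.symm i).2).1) fun i => (hT (T.equivFin.symm i).2).2).le hn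
  have hfin : {θ | IsEigenvalue P α β θ ∧ θ < lam}.Finite := by
    by_contra hinf
    obtain ⟨T, hT, hc⟩ := Set.Infinite.exists_subset_card_eq hinf (n + 1)
    have := key T hT
    omega
  refine ⟨hfin, ?_⟩
  rw [ncard_eq_toFinset_card _ hfin]
  exact key _ (by simp)

/-- Bounds for the counting function of the eigenvalues by indices of quadratic forms. -/
theorem le_ncard_isEigenvalue_le (h : SelfSimilarCDF (clamp P) κ a d)
    (hμ : ∀ x, μ (Iic x) = ENNReal.ofReal (clamp P x)) (hα : 0 ≤ α) (hβ : 0 < β) (hlam : 0 < lam)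
    {C : ℝ} (hC : β⁻¹ * (2 * (α ^ 2 + β ^ 2)) ≤ C) {n m : ℕ}
    (hn : NegDim (H2b.quad μ C lam) n) (hm : PosCodim (H2b.quad μ 0 lam) m) :
    n ≤ {θ | IsEigenvalue P α β θ ∧ θ ≤ lam}.ncard ∧
      {θ | IsEigenvalue P α β θ ∧ θ ≤ lam}.ncard ≤ m + 1 := by
  obtain ⟨hfin, hcard⟩ := finite_isEigenvalue_lt (α := α) h hμ hβ hm
  set E := {θ | IsEigenvalue P α β θ ∧ θ < lam}
  have hsub : {θ | IsEigenvalue P α β θ ∧ θ ≤ lam} ⊆ insert lam E := fun θ hθ =>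
    hθ.2.eq_or_lt.imp id fun hlt => ⟨hθ.1, hlt⟩
  have hfin' : {θ | IsEigenvalue P α β θ ∧ θ ≤ lam}.Finite := (hfin.insert lam).subset hsub
  constructor
  · have h1 := posCodim_fullEnergy (lam := lam) (S := hfin.toFinset) h hμ hα hβ hlam
      fun θ h1 h2 => hfin.mem_toFinset.2 ⟨h1, h2⟩
    have h2 : NegDim (fun v => H2.fullEnergy α β v v - lam * H2.mass μ v v) n :=
      hn.map H2b.toH2 fun v hv => by
        rw [H2b.quad, H2b.bend_eq_energy, H2b.bdry_add_bdry, H2b.msq_eq_mass h hμ] at hv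
        have h3 := H2.fullEnergy_le α hβ (H2b.toH2 v)
        have h4 := mul_le_mul_of_nonneg_right hC (H2.trace_nonneg (H2b.toH2 v))
        linarith
    have h3 := h2.le h1
    rw [← ncard_eq_toFinset_card _ hfin] at h3
    exact h3.trans (ncard_le_ncard (fun θ hθ => ⟨hθ.1, hθ.2.le⟩) hfin')
  · exact (ncard_le_ncard hsub (hfin.insert lam)).trans
      ((ncard_insert_le _ _).trans (Nat.succ_le_succ hcard))

end Counting

section Singular

open MeasureTheory

open scoped Topology

/-- The data of the renewal argument: integer-valued functions `q ≤ p` of logarithmic argument,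
sub- and superadditive up to a bounded defect under the shift by `ν`. -/
structure RenewalPair (κ : ℕ) (ν C r : ℝ) (p q : ℝ → ℕ) : Prop where
  two_le : 2 ≤ κ
  ν_pos : 0 < ν
  C_pos : 0 < C
  r_pos : 0 < r
  r_mul_lt : r * κ < 1
  mono : Monotone p
  le : ∀ t, q t ≤ p t
  le_add : ∀ t, p t ≤ q t + 4
  shift_le : ∀ t, p (t + ν) ≤ κ * p t
  le_shift : ∀ t, κ * q t ≤ q (t + ν)
  le_perturb : ∀ (k : ℕ) t, k * ν ≤ t → p t ≤ q (t + C * r ^ k)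

namespace RenewalPair

variable {κ : ℕ} {ν C r : ℝ} {p q : ℝ → ℕ}

/-- The limit of the rescaled functions `p`. -/
noncomputable def limit (κ : ℕ) (ν : ℝ) (p : ℝ → ℕ) (t : ℝ) : ℝ :=
  ⨅ k : ℕ, (p (t + k * ν) : ℝ) / κ ^ k

variable (h : RenewalPair κ ν C r p q)

include h

theorem one_lt : (1 : ℝ) < κ := by exact_mod_cast h.two_le

theorem kappa_pos : (0 : ℝ) < κ := zero_lt_one.trans h.one_lt

theorem antitone (t : ℝ) : Antitone fun k : ℕ => (p (t + k * ν) : ℝ) / κ ^ k := by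
  refine antitone_nat_of_succ_le fun k => ?_
  have hκ := h.kappa_pos
  have h1 : (p (t + k * ν + ν) : ℝ) ≤ κ * p (t + k * ν) := by exact_mod_cast h.shift_le _
  rw [pow_succ', ← div_div, Nat.cast_succ, add_mul, one_mul, ← add_assoc]
  gcongr
  rwa [div_le_iff₀' hκ]

theorem monotone_div (t : ℝ) : Monotone fun k : ℕ => (q (t + k * ν) : ℝ) / κ ^ k := by
  refine monotone_nat_of_le_succ fun k => ?_
  have hκ := h.kappa_pos
  have h1 : κ * q (t + k * ν) ≤ (q (t + k * ν + ν) : ℝ) := by exact_mod_cast h.le_shift _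
  rw [pow_succ', ← div_div, Nat.cast_succ, add_mul, one_mul, ← add_assoc]
  gcongr
  rwa [le_div_iff₀' hκ]

theorem tendsto_limit (t : ℝ) :
    Tendsto (fun k : ℕ => (p (t + k * ν) : ℝ) / κ ^ k) atTop (𝓝 (limit κ ν p t)) :=
  tendsto_atTop_ciInf (h.antitone t) ⟨0, by rintro _ ⟨k, rfl⟩; positivity⟩

theorem limit_le (t : ℝ) (k : ℕ) : limit κ ν p t ≤ p (t + k * ν) / κ ^ k :=
  (h.antitone t).le_of_tendsto (h.tendsto_limit t) k

theorem le_limit (t : ℝ) (k : ℕ) : q (t + k * ν) / κ ^ k ≤ limit κ ν p t := by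
  have hκ := h.kappa_pos
  refine ge_of_tendsto (h.tendsto_limit t) ((eventually_ge_atTop k).mono fun m hm => ?_)
  refine (h.monotone_div t hm).trans ?_
  have := h.le (t + m * ν)
  beta_reduce
  gcongr

theorem monotone_limit : Monotone (limit κ ν p) := fun s t hst => by
  have hκ := h.kappa_pos
  refine le_of_tendsto_of_tendsto' (h.tendsto_limit s) (h.tendsto_limit t) fun k => ?_
  have := h.mono (add_le_add_left hst (k * ν))
  gcongr

theorem limit_shift (t : ℝ) : limit κ ν p (t + ν) = κ * limit κ ν p t := by
  have hκ := h.kappa_pos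
  refine tendsto_nhds_unique (h.tendsto_limit (t + ν))
    ((((tendsto_add_atTop_iff_nat 1).2 (h.tendsto_limit t)).const_mul (κ : ℝ)).congr fun k => ?_)
  rw [pow_succ', Nat.cast_succ, show t + (k + 1) * ν = t + ν + k * ν by ring]
  field_simp

theorem hasDerivAt_limit_of_eq {k : ℕ} {t : ℝ} (ht : 2 * (C * r ^ k) < t)
    (heq : p (t - 2 * (C * r ^ k) + k * ν) = p (t + C * r ^ k + k * ν)) :
    HasDerivAt (limit κ ν p) 0 t := by
  have hκ := h.kappa_pos
  have hδ : 0 < C * r ^ k := mul_pos h.C_pos (pow_pos h.r_pos k)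
  set δ := C * r ^ k with hδd
  have key : ∀ s ∈ Ioo (t - δ) (t + δ), limit κ ν p s = p (t + δ + k * ν) / κ ^ k := by
    intro s hs
    refine le_antisymm ((h.limit_le s k).trans ?_) (le_trans ?_ (h.le_limit s k))
    · have := h.mono (add_le_add_left hs.2.le (k * ν))
      gcongr
    · have h1 := h.mono (add_le_add_left (show t - 2 * δ ≤ s - δ by linarith [hs.1]) (k * ν))
      have h2 := h.le_perturb k (s - δ + k * ν) (by linarith [hs.1])
      rw [← hδd, show s - δ + k * ν + δ = s + k * ν by ring] at h2
      have h3 := heq.symm.le.trans (h1.trans h2)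
      gcongr
  refine (hasDerivAt_const t (p (t + δ + k * ν) / κ ^ k : ℝ)).congr_of_eventuallyEq ?_
  filter_upwards [Ioo_mem_nhds (show t - δ < t by linarith) (show t < t + δ by linarith)] with s hs
  exact key s hs

theorem shift_mul_le (k : ℕ) : p (k * ν) ≤ κ ^ k * p 0 := by
  induction k with
  | zero => simp
  | succ k ih =>
    rw [Nat.cast_succ, add_mul, one_mul, pow_succ', mul_assoc]
    exact (h.shift_le _).trans (Nat.mul_le_mul_left κ ih)

theorem volume_not_hasDerivAt_le {k : ℕ} {τ : ℝ} (hτ : 2 * (C * r ^ k) < τ) (hν : C * r ^ k ≤ ν) :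
    volume {t | t ∈ Ioo τ ν ∧ ¬HasDerivAt (limit κ ν p) 0 t} ≤
      ENNReal.ofReal (3 * C * κ ^ 2 * p 0 * (r * κ) ^ k) := by
  set δ := C * r ^ k with hδd
  have hδ : 0 < δ := mul_pos h.C_pos (pow_pos h.r_pos k)
  set M := κ ^ (k + 2) * p 0 with hM
  let T : ℕ → Set ℝ := fun j => {t | p (t - 2 * δ + k * ν) ≤ j ∧ j < p (t + δ + k * ν)}
  have hT : ∀ j, volume (T j) ≤ ENNReal.ofReal (3 * δ) := fun j => by
    refine (Real.volume_le_diam _).trans (Metric.ediam_le fun x hx y hy => ?_)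
    have key : ∀ x ∈ T j, ∀ y ∈ T j, x - y ≤ 3 * δ := fun x hx y hy => by
      by_contra! hc
      have := h.mono (show y + δ + k * ν ≤ x - 2 * δ + k * ν by linarith)
      have h1 : p (x - 2 * δ + k * ν) ≤ j := hx.1
      have h2 : j < p (y + δ + k * ν) := hy.2
      omega
    rw [edist_dist, Real.dist_eq]
    exact ENNReal.ofReal_le_ofReal (abs_sub_le_iff.2 ⟨key x hx y hy, key y hy x hx⟩)
  have hsub : {t | t ∈ Ioo τ ν ∧ ¬HasDerivAt (limit κ ν p) 0 t} ⊆ ⋃ j ∈ Finset.range M, T j := by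
    rintro t ⟨ht, hd⟩
    have hne : p (t - 2 * δ + k * ν) ≠ p (t + δ + k * ν) := fun hc =>
      hd (h.hasDerivAt_limit_of_eq (hτ.trans ht.1) hc)
    have hle : p (t - 2 * δ + k * ν) ≤ p (t + δ + k * ν) := h.mono (by linarith)
    have hlt := lt_of_le_of_ne hle hne
    have hMle : p (t + δ + k * ν) ≤ M := by
      refine (h.mono ?_).trans (h.shift_mul_le (k + 2))
      push_cast
      linarith [ht.2]
    exact mem_biUnion (Finset.mem_coe.2 (Finset.mem_range.2 (hlt.trans_le hMle))) ⟨le_rfl, hlt⟩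
  calc _ ≤ volume (⋃ j ∈ Finset.range M, T j) := measure_mono hsub
    _ ≤ ∑ j ∈ Finset.range M, volume (T j) := measure_biUnion_finset_le _ _
    _ ≤ M * ENNReal.ofReal (3 * δ) := by
      refine (Finset.sum_le_sum fun j _ => hT j).trans ?_
      simp
    _ = _ := by
      rw [← ENNReal.ofReal_natCast, ← ENNReal.ofReal_mul (Nat.cast_nonneg _), hM, hδd]
      congr 1
      push_cast
      ring

theorem ae_hasDerivAt_limit : ∀ᵐ t ∂volume.restrict (Icc 0 ν), HasDerivAt (limit κ ν p) 0 t := by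
  have hr1 : r < 1 := by nlinarith [h.r_mul_lt, h.one_lt, h.r_pos]
  have hδ : Tendsto (fun k : ℕ => C * r ^ k) atTop (𝓝 0) := by
    simpa using (tendsto_pow_atTop_nhds_zero_of_lt_one h.r_pos.le hr1).const_mul C
  have hb : Tendsto (fun k : ℕ => ENNReal.ofReal (3 * C * κ ^ 2 * p 0 * (r * κ) ^ k))
      atTop (𝓝 0) := by
    have := (tendsto_pow_atTop_nhds_zero_of_lt_one (mul_pos h.r_pos h.kappa_pos).le
      h.r_mul_lt).const_mul (3 * C * κ ^ 2 * p 0)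
    rw [mul_zero] at this
    simpa using ENNReal.tendsto_ofReal this
  have hnull : ∀ τ : ℝ, 0 < τ → volume {t | t ∈ Ioo τ ν ∧ ¬HasDerivAt (limit κ ν p) 0 t} = 0 := by
    intro τ hτ
    refine le_antisymm (ge_of_tendsto hb ?_) zero_le
    filter_upwards [hδ.eventually_lt_const (half_pos hτ), hδ.eventually_lt_const h.ν_pos]
      with k hk hk'
    exact h.volume_not_hasDerivAt_le (by linarith) hk'.le
  rw [← restrict_Ioo_eq_restrict_Icc, ae_restrict_iff' measurableSet_Ioo, ae_iff]
  refine measure_mono_null (fun t ht => ?_)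
    (measure_iUnion_null fun n : ℕ => hnull (1 / (n + 1)) Nat.one_div_pos_of_nat)
  simp only [mem_ofPred_eq, Classical.not_imp] at ht
  obtain ⟨n, hn⟩ := exists_nat_one_div_lt ht.1.1
  exact mem_iUnion.2 ⟨n, ⟨hn, ht.1.2⟩, ht.2⟩

theorem periodic {D : ℝ} (hD : D = Real.log κ / ν) :
    Function.Periodic (fun t => Real.exp (-(D * t)) * limit κ ν p t) ν := fun t => by
  have hDν : D * ν = Real.log κ := by rw [hD, div_mul_cancel₀ _ h.ν_pos.ne']
  simp only [h.limit_shift, mul_add, neg_add, Real.exp_add, hDν, Real.exp_neg (Real.log κ),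
    Real.exp_log h.kappa_pos]
  field_simp [h.kappa_pos.ne']

theorem tendsto_sub {D : ℝ} (hD : 0 < D) {N : ℝ → ℕ} (hN : ∀ t, q t ≤ N t ∧ N t ≤ p t + 1) :
    Tendsto (fun t => N t * Real.exp (-(D * t)) - Real.exp (-(D * t)) * limit κ ν p t)
      atTop (𝓝 0) := by
  have hb : ∀ t, |(N t : ℝ) - limit κ ν p t| ≤ 5 := fun t => by
    have h1 := h.limit_le t 0
    have h2 := h.le_limit t 0
    simp only [Nat.cast_zero, zero_mul, add_zero, pow_zero, div_one] at h1 h2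
    have h3 : (q t : ℝ) ≤ N t := by exact_mod_cast (hN t).1
    have h4 : (N t : ℝ) ≤ p t + 1 := by exact_mod_cast (hN t).2
    have h5 : (p t : ℝ) ≤ q t + 4 := by exact_mod_cast h.le_add t
    rw [abs_le]
    constructor <;> linarith
  have hexp : Tendsto (fun t => 5 * Real.exp (-(D * t))) atTop (𝓝 0) := by
    simpa using (Real.tendsto_exp_neg_atTop_nhds_zero.comp
      (tendsto_id.const_mul_atTop hD)).const_mul 5
  refine squeeze_zero_norm (fun t => ?_) hexp
  rw [mul_comm, ← mul_sub, Real.norm_eq_abs, abs_mul, Real.abs_exp, mul_comm]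
  exact mul_le_mul_of_nonneg_right (hb t) (Real.exp_pos _).le

end RenewalPair

end Singular

open MeasureTheory in
theorem SelfSimilarCDF.exists_renewalPair {F : ℝ → ℝ} {κ : ℕ} {a d : ℝ}
    (h : SelfSimilarCDF F κ a d) {μ : Measure ℝ} [IsProbabilityMeasure μ] [NullSingletonClass μ]
    (hμ : ∀ x, μ (Iic x) = ENNReal.ofReal (F x)) (C₁ : ℝ) :
    ∃ (C C' : ℝ) (p q : ℝ → ℕ), C₁ ≤ C ∧
      RenewalPair κ (Real.log κ - 3 * Real.log a) C' a p q ∧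
      (∀ t, PosCodim (H2b.quad μ 0 (Real.exp t)) (p t)) ∧
      ∀ t, NegDim (H2b.quad μ C (Real.exp t)) (q t) := by
  have ha := h.a_pos
  have hκ2 := h.cast_two_le
  have hκ : (0 : ℝ) < κ := by linarith
  have hκa : a * κ < 1 := by rw [mul_comm]; exact h.kappa_mul_lt
  have hl : 0 < (d - a) / a := div_pos (sub_pos.2 h.a_lt) ha
  obtain ⟨C₀, hC₀, hb⟩ := H2b.exists_integral_sq_ext_le hl
  set C := max C₁ (2 * C₀)
  have hC : 0 ≤ C := le_max_of_le_right (by linarith)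
  obtain ⟨C', hC', hpert⟩ := H2b.exists_negDim_of_negDim h hμ hC
  choose f hfn hfp using fun t => H2b.exists_index h hμ (le_refl (0 : ℝ)) (Real.exp t)
  choose g hgn hgp using fun t => H2b.exists_index h hμ hC (Real.exp t)
  have hρ : ∀ k : ℕ, Real.exp (k * (Real.log κ - 3 * Real.log a)) = (κ / a ^ 3) ^ k := fun k => by
    rw [Real.exp_nat_mul, Real.exp_sub, Real.exp_log hκ, mul_comm, Real.exp_mul, Real.exp_log ha]
    norm_cast
  have hρ1 : ∀ t, Real.exp (t + (Real.log κ - 3 * Real.log a)) = Real.exp t * (κ / a ^ 3) := by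
    intro t
    rw [Real.exp_add, ← pow_one (κ / a ^ 3 : ℝ), ← hρ 1, Nat.cast_one, one_mul]
  refine ⟨C, C' + 1, f, g, le_max_left _ _, ?_, hfp, hgn⟩
  refine
    { two_le := h.two_le
      ν_pos := ?_
      C_pos := by linarith
      r_pos := ha
      r_mul_lt := hκa
      mono := fun s t hst => ((hfn s).map LinearMap.id fun u hu =>
        (H2b.quad_anti le_rfl (Real.exp_le_exp.2 hst) u).trans_lt hu).le (hfp t)
      le := fun t => ((hgn t).map LinearMap.id fun u hu =>
        (H2b.quad_anti hC le_rfl u).trans_lt hu).le (hfp t)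
      le_add := fun t => (hfn t).le (H2b.posCodim_add_four (hgp t))
      shift_le := fun t => (hfn _).le (by rw [hρ1]; exact H2b.posCodim_mul h hμ (hfp t))
      le_shift := fun t => (NegDim.le (by
        rw [hρ1]; exact H2b.negDim_mul h hμ (le_max_right _ _) hC₀ hb (hgn t)) (hgp _))
      le_perturb := fun k t hkt => ?_ }
  · have h1 : 0 < Real.log κ := Real.log_pos (by linarith)
    have h2 : Real.log a < 0 := Real.log_neg ha (by nlinarith)
    linarith
  · have h1 := hpert k (Real.exp t) (f t) ((hρ k).symm.le.trans (Real.exp_le_exp.2 hkt)) (hfn t)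
    refine (h1.map LinearMap.id fun u hu => (H2b.quad_anti le_rfl ?_ u).trans_lt hu).le (hgp _)
    have h3 : 0 < a ^ k := pow_pos ha k
    rw [Real.exp_add]
    refine mul_le_mul_of_nonneg_left ?_ (Real.exp_pos t).le
    have := Real.add_one_le_exp ((C' + 1) * a ^ k)
    linarith

theorem stmt14 (P : ℝ → ℝ) (κ : ℕ) (a : ℝ) (hP : CantorSelfSimilar P κ a)
    (α β : ℝ) (hα : 0 ≤ α) (hβ : 0 < β)
    (N : ℝ → ℕ)
    (hN : ∀ lam : ℝ, 0 < lam →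
      N lam = {μ : ℝ | IsEigenvalue P α β μ ∧ μ ≤ lam}.ncard)
    (ν D : ℝ) (hν : ν = Real.log κ - 3 * Real.log a) (hD : D = Real.log κ / ν) :
    ∃ s σ : ℝ → ℝ,
      Function.Periodic s ν ∧
      MonotoneOn σ (Set.Icc 0 ν) ∧
      (∀ᵐ t ∂(MeasureTheory.volume.restrict (Set.Icc (0:ℝ) ν)),
        HasDerivWithinAt σ 0 (Set.Icc 0 ν) t) ∧
      (∀ t ∈ Set.Icc (0:ℝ) ν, s t = Real.exp (-(D * t)) * σ t) ∧
      Filter.Tendsto (fun lam : ℝ => (N lam : ℝ) * lam ^ (-D) - s (Real.log lam))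
        Filter.atTop (nhds 0) := by
  have h := hP.selfSimilarCDF
  obtain ⟨μ, _, _, hμ⟩ := h.exists_measure
  obtain ⟨C, C', p, q, hC, hpq, hp, hq⟩ := h.exists_renewalPair hμ (β⁻¹ * (2 * (α ^ 2 + β ^ 2)))
  rw [← hν] at hpq
  have hD0 : 0 < D := by
    rw [hD]
    exact div_pos (Real.log_pos hpq.one_lt) hpq.ν_pos
  have hNt : ∀ t, q t ≤ N (Real.exp t) ∧ N (Real.exp t) ≤ p t + 1 := fun t => by
    rw [hN _ (Real.exp_pos t)]
    exact le_ncard_isEigenvalue_le h hμ hα hβ (Real.exp_pos t) hC (hq t) (hp t)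
  refine ⟨_, RenewalPair.limit κ ν p, hpq.periodic hD, hpq.monotone_limit.monotoneOn _,
    hpq.ae_hasDerivAt_limit.mono fun t ht => ht.hasDerivWithinAt, fun t _ => rfl, ?_⟩
  refine ((hpq.tendsto_sub hD0 hNt).comp Real.tendsto_log_atTop).congr' ?_
  filter_upwards [eventually_gt_atTop 0] with lam hlam
  simp only [Function.comp_apply, Real.exp_log hlam]
  rw [Real.rpow_def_of_pos hlam, mul_neg, mul_comm (Real.log lam)]
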